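/- Assume the system D_N = {φ_j}_{j=1}^N ⊂ C(Ω) is an orthonormal system in L_2(Ω,μ) that is uniformly bounded: ‖φ_j‖_∞ ≤ B for all j. Let 1 < p ≤ 2, t ∈ (0,1], and set p' := p/(p−1). Then there are constants V = C(B), c = C(t,p) ≥ 1 (depending only on t and p), and C = C(p,B) with the following property: for any positive integer v with u := ⌈(1 + c(2V)^{p'}(ln(2Vv))) v^{1/(p−1)}⌉ ≤ N there exist m points ξ^1,…,ξ^m ∈ Ω with m ≤ C u log N · (log(2u))² · (log(2u) + log log N) such that for any f_0 ∈ C(Ω), the WCGA with weakness parameter t applied to f_0 with respect to D_N(Ω_m) in L_p(Ω_m,μ_m) gives ‖f_u‖_{L_p(Ω_m,μ_m)} ≤ C_0 σ_v(f_0, D_N(Ω_m))_{L_p(Ω_m,μ_m)} and ‖f_u‖_{L_p(Ω,μ)} ≤ C_0 σ_v(f_0, D_N)_∞, where C_0 ≥ 1 is an absolute constant. -/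

import Mathlib

open MeasureTheory Finset
open scoped ENNReal NNReal BigOperators

noncomputable section

attribute [local instance] Classical.propDecidable

namespace SamplingRecovery

/-- The `L_p(μ)` norm of a complex-valued function, `1 ≤ p < ∞`. -/
def lpNorm {X : Type*} [MeasurableSpace X] (μ : Measure X) (p : ℝ) (f : X → ℂ) : ℝ :=
  (∫ x, ‖f x‖ ^ p ∂μ) ^ (1 / p)

/-- The discrete `L_p(Ω_m, μ_m)` norm associated with sample points `ξ`. -/
def dNorm {X : Type*} {m : ℕ} (ξ : Fin m → X) (p : ℝ) (f : X → ℂ) : ℝ :=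
  ((m : ℝ)⁻¹ * ∑ j, ‖f (ξ j)‖ ^ p) ^ (1 / p)

/-- The uniform norm of a function. -/
def supNorm {X : Type*} (f : X → ℂ) : ℝ := ⨆ x, ‖f x‖

/-- `Σ_v(D)`: the set of all `v`-term linear combinations with respect to the system `g`. -/
def SigmaSet {X ι : Type*} (g : ι → X → ℂ) (v : ℕ) : Set (X → ℂ) :=
  {f | ∃ (B : Finset ι) (c : ι → ℂ), B.card ≤ v ∧ f = fun x => ∑ i ∈ B, c i * g i x}

/-- `Σ_v` restricted to indices in a finite set `T`. -/
def SigmaSetOn {X ι : Type*} (g : ι → X → ℂ) (T : Finset ι) (v : ℕ) : Set (X → ℂ) :=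
  {f | ∃ (B : Finset ι) (c : ι → ℂ), B ⊆ T ∧ B.card ≤ v ∧ f = fun x => ∑ i ∈ B, c i * g i x}

/-- `σ_v(f, D)_X`: the best `v`-term approximation error of `f` with respect to the
system `g`, measured in the (semi)norm `nrm`. -/
def sigmaErr {X ι : Type*} (nrm : (X → ℂ) → ℝ) (g : ι → X → ℂ) (v : ℕ) (f : X → ℂ) : ℝ :=
  sInf ((fun h => nrm (f - h)) '' SigmaSet g v)

/-- `σ_v(f, D)` with the system restricted to indices in `T`. -/
def sigmaErrOn {X ι : Type*} (nrm : (X → ℂ) → ℝ) (g : ι → X → ℂ) (T : Finset ι)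
    (v : ℕ) (f : X → ℂ) : ℝ :=
  sInf ((fun h => nrm (f - h)) '' SigmaSetOn g T v)

/-- The `(v,S)`-incoherence property with parameters `V > 0` and `r > 0` in the
(semi)norm `nrm`. -/
def Incoherent {X ι : Type*} (g : ι → X → ℂ) (v S : ℕ) (V r : ℝ)
    (nrm : (X → ℂ) → ℝ) : Prop :=
  ∀ (A B : Finset ι), A ⊆ B → A.card ≤ v → B.card ≤ S →
    ∀ c : ι → ℂ,
      ∑ i ∈ A, ‖c i‖ ≤ V * (A.card : ℝ) ^ r * nrm (fun x => ∑ i ∈ B, c i * g i x)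

/-- `(v,S)`-unconditionality with parameter `U` in the (semi)norm `nrm`. -/
def Unconditional {X ι : Type*} (g : ι → X → ℂ) (v S : ℕ) (U : ℝ)
    (nrm : (X → ℂ) → ℝ) : Prop :=
  ∀ (A B : Finset ι), A ⊆ B → A.card ≤ v → B.card ≤ S →
    ∀ c : ι → ℂ,
      nrm (fun x => ∑ i ∈ A, c i * g i x) ≤ U * nrm (fun x => ∑ i ∈ B, c i * g i x)

/-- The points `ξ` provide `L_p`-universal sampling discretization for the collection
`X_u(D_N)` of `u`-term subspaces generated by the system `g`. -/
def USD {X : Type*} [MeasurableSpace X] (μ : Measure X) (p : ℝ) {ι : Type*} {m : ℕ}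
    (g : ι → X → ℂ) (u : ℕ) (ξ : Fin m → X) : Prop :=
  ∀ f ∈ SigmaSet g u,
    (1 / 2 : ℝ) * (∫ x, ‖f x‖ ^ p ∂μ) ≤ (m : ℝ)⁻¹ * ∑ j, ‖f (ξ j)‖ ^ p ∧
    (m : ℝ)⁻¹ * ∑ j, ‖f (ξ j)‖ ^ p ≤ (3 / 2 : ℝ) * (∫ x, ‖f x‖ ^ p ∂μ)

/-- The measure `μ_ξ = (1/2) μ + (1/(2m)) ∑_j δ_{ξ^j}`. -/
def sampleMeasure {X : Type*} [MeasurableSpace X] (μ : Measure X) {m : ℕ}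
    (ξ : Fin m → X) : Measure X :=
  (1 / 2 : ℝ≥0∞) • μ + ((2 * m : ℝ≥0∞))⁻¹ • ∑ j, Measure.dirac (ξ j)

/-- A realization of the Weak Chebyshev Greedy Algorithm with weakness parameter `t`
applied to `f0` with respect to the system `g`, in the space with (semi)norm `nrm`:
`G k` is the approximant after `k` iterations (`f_k = f0 - G k` is the residual),
`φ k` the element of the system chosen at step `k+1`.  At each step a norming
functional `F` of the residual is used (a linear functional of norm `≤ 1` with
`F(f_k) = ‖f_k‖`), the new element `g (φ k)` satisfies the weakness condition
`|F(g (φ k))| ≥ t ⬝ sup_i |F(g i)|`, and `G (k+1)` is a best approximant to `f0`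
from the span of the chosen elements. -/
def IsWCGA {X ι : Type*} (g : ι → X → ℂ) (nrm : (X → ℂ) → ℝ) (t : ℝ)
    (f0 : X → ℂ) (φ : ℕ → ι) (G : ℕ → X → ℂ) : Prop :=
  G 0 = 0 ∧
  ∀ k : ℕ,
    (∃ F : (X → ℂ) →ₗ[ℂ] ℂ,
      (∀ h, ‖F h‖ ≤ nrm h) ∧
      F (f0 - G k) = ((nrm (f0 - G k) : ℝ) : ℂ) ∧
      ∀ i, t * ‖F (g i)‖ ≤ ‖F (g (φ k))‖) ∧
    G (k + 1) ∈ Submodule.span ℂ ((fun j => g (φ j)) '' Set.Iic k) ∧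
    ∀ h ∈ Submodule.span ℂ ((fun j => g (φ j)) '' Set.Iic k),
      nrm (f0 - G (k + 1)) ≤ nrm (f0 - h)

/-- The dyadic shell `{k ∈ ℤ^d : [2^{j-1}] ≤ ‖k‖_∞ < 2^j}` as a finite set. -/
def shell (d j : ℕ) : Finset (Fin d → ℤ) :=
  (Finset.Icc (fun _ => -(2 ^ j : ℤ)) fun _ => (2 ^ j : ℤ)).filter
    fun k => (if j = 0 then (0 : ℝ) else (2 : ℝ) ^ (j - 1)) ≤ ‖k‖ ∧ ‖k‖ < (2 : ℝ) ^ j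

/-- The discrete ball `{k ∈ ℤ^d : ‖k‖_∞ < n}` as a finite set. -/
def lball (d n : ℕ) : Finset (Fin d → ℤ) :=
  (Finset.Icc (fun _ => -(n : ℤ)) fun _ => (n : ℤ)).filter fun k => ‖k‖ < (n : ℝ)

/-- The class `A^r_β(Ψ)`: functions admitting an absolutely convergent expansion
`f = ∑_k a_k ψ_k` with `(∑_{[2^{j-1}] ≤ ‖k‖_∞ < 2^j} |a_k|^β)^{1/β} ≤ 2^{-rj}` for all `j`. -/
def ArClass {X : Type*} {d : ℕ} (ψ : (Fin d → ℤ) → X → ℂ) (β r : ℝ) : Set (X → ℂ) :=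
  {f | ∃ a : (Fin d → ℤ) → ℂ,
    Summable (fun k => ‖a k‖) ∧
    (∀ x, HasSum (fun k => a k * ψ k x) (f x)) ∧
    ∀ j : ℕ, (∑ k ∈ shell d j, ‖a k‖ ^ β) ^ (1 / β) ≤ (2 : ℝ) ^ (-(r * j))}

/-- `ϱ_m^o(F, X)`: the optimal sampling recovery error of a class `F` from `m` point
values, measured in the (semi)norm `nrm`; the recovery maps `M` are arbitrary. -/
def optRecovery {X : Type*} (F : Set (X → ℂ)) (m : ℕ) (nrm : (X → ℂ) → ℝ) : ℝ :=
  ⨅ (ξ : Fin m → X), ⨅ (M : (Fin m → ℂ) → X → ℂ),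
    ⨆ f ∈ F, nrm (f - M fun j => f (ξ j))

/-- The Kolmogorov width `d_n(F, E)` of a set `F` in a space with (semi)norm `nrm`. -/
def kWidth {E : Type*} [AddCommGroup E] [Module ℂ E] (nrm : E → ℝ) (F : Set E)
    (n : ℕ) : ℝ :=
  ⨅ u : Fin n → E, ⨆ f ∈ F, ⨅ c : Fin n → ℂ, nrm (f - ∑ i, c i • u i)

/-- Normalized Lebesgue measure on the cube `[0, 2π)^d`, representing `𝕋^d`. -/
def torusMeasure (d : ℕ) : Measure (Fin d → ℝ) :=
  (ENNReal.ofReal ((2 * Real.pi) ^ d))⁻¹ •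
    volume.restrict (Set.univ.pi fun _ => Set.Ico (0 : ℝ) (2 * Real.pi))

/-- The trigonometric monomial `e^{i(k,x)}` on `𝕋^d`. -/
def trig {d : ℕ} (k : Fin d → ℤ) (x : Fin d → ℝ) : ℂ :=
  Complex.exp (Complex.I * ((∑ j, (k j : ℝ) * x j : ℝ) : ℂ))

end SamplingRecovery

open SamplingRecovery

/-- Number of iterations `u = ⌈(1 + c (2V)^{p'} ln(2Vv)) v^{1/(p-1)}⌉`, `p' = p/(p-1)`. -/
def uONS (c V p : ℝ) (v : ℕ) : ℕ :=
  ⌈(1 + c * (2 * V) ^ (p / (p - 1)) * Real.log (2 * V * v)) * (v : ℝ) ^ (1 / (p - 1))⌉₊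

namespace WCGAProof

lemma exp_neg_le_aux {y : ℝ} (h0 : 0 ≤ y) (h1 : y ≤ 1) : Real.exp (-y) ≤ 1 - 0.6 * y := by
  have h1y : 0 ≤ 1 - y := by linarith
  have hc := convexOn_exp.2 (Set.mem_univ (0:ℝ)) (Set.mem_univ (-1:ℝ)) h1y h0 (by ring)
  simp only [smul_eq_mul, mul_zero, zero_add, Real.exp_zero, mul_one, mul_neg] at hc
  have he : Real.exp (-1) ≤ 0.4 := by
    rw [Real.exp_neg]
    have := Real.exp_one_gt_d9
    rw [inv_le_comm₀ (by positivity) (by norm_num)]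
    norm_num
    linarith
  nlinarith

lemma sampling {α X : Type*} [Fintype α] (ψ : α → X → ℝ) (h0 : ∀ a x, 0 ≤ ψ a x)
    (h1 : ∀ a x, ψ a x ≤ 1) (e : α → ℝ)
    (havg : ∀ ω : α → ℝ, (∀ a, 0 ≤ ω a) → ∃ x, ∑ a, ω a * e a ≤ ∑ a, ω a * ψ a x)
    (w : α → ℝ) (hw : ∀ a, 0 < w a) (hs : ∑ a, w a ≤ 1) (m : ℕ) :
    ∃ ξ : Fin m → X, ∀ a, 0.6 * m * e a + Real.log (w a) ≤ ∑ j, ψ a (ξ j) := by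
  have key : ∃ ξ : Fin m → X, ∑ a, w a * Real.exp (0.6 * m * e a - ∑ j, ψ a (ξ j)) ≤ 1 := by
    induction m with
    | zero => exact ⟨Fin.elim0, by simpa using hs⟩
    | succ m ih =>
      obtain ⟨ξ, hξ⟩ := ih
      set P : α → ℝ := fun a => w a * Real.exp (0.6 * m * e a - ∑ j, ψ a (ξ j)) with hP
      have hPpos : ∀ a, 0 < P a := fun a => mul_pos (hw a) (Real.exp_pos _)
      obtain ⟨x, hx⟩ := havg (fun a => P a * Real.exp (0.6 * e a)) (fun a =>
        (mul_pos (hPpos a) (Real.exp_pos _)).le)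
      refine ⟨Fin.snoc ξ x, le_trans ?_ hξ⟩
      have h2 : ∀ a, w a * Real.exp (0.6 * (m + 1 : ℕ) * e a -
          ∑ j, ψ a ((Fin.snoc ξ x : Fin (m+1) → X) j)) =
          P a * Real.exp (0.6 * e a) * Real.exp (-ψ a x) := by
        intro a
        rw [Fin.sum_univ_castSucc]
        simp only [Fin.snoc_castSucc, Fin.snoc_last, hP]
        rw [mul_assoc (w a), ← Real.exp_add, mul_assoc (w a), ← Real.exp_add]
        congr 2
        push_cast
        ring
      calc ∑ a, w a * Real.exp (0.6 * (m + 1 : ℕ) * e a -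
          ∑ j, ψ a ((Fin.snoc ξ x : Fin (m+1) → X) j))
          = ∑ a, P a * Real.exp (0.6 * e a) * Real.exp (-ψ a x) :=
            Finset.sum_congr rfl fun a _ => h2 a
        _ ≤ ∑ a, P a * Real.exp (0.6 * e a) * (1 - 0.6 * ψ a x) := by
            apply Finset.sum_le_sum
            intro a _
            exact mul_le_mul_of_nonneg_left (exp_neg_le_aux (h0 a x) (h1 a x))
              (mul_pos (hPpos a) (Real.exp_pos _)).le
        _ = ∑ a, P a * Real.exp (0.6 * e a) -
              0.6 * ∑ a, P a * Real.exp (0.6 * e a) * ψ a x := by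
            rw [Finset.mul_sum, ← Finset.sum_sub_distrib]
            exact Finset.sum_congr rfl fun a _ => by ring
        _ ≤ ∑ a, P a * Real.exp (0.6 * e a) -
              0.6 * ∑ a, P a * Real.exp (0.6 * e a) * e a := by
            linarith
        _ = ∑ a, P a * (Real.exp (0.6 * e a) * (1 - 0.6 * e a)) := by
            rw [Finset.mul_sum, ← Finset.sum_sub_distrib]
            exact Finset.sum_congr rfl fun a _ => by ring
        _ ≤ ∑ a, P a := by
            apply Finset.sum_le_sum
            intro a _
            have h3 : Real.exp (0.6 * e a) * (1 - 0.6 * e a) ≤ 1 := by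
              have h4 := Real.add_one_le_exp (-(0.6 * e a))
              calc Real.exp (0.6 * e a) * (1 - 0.6 * e a)
                  ≤ Real.exp (0.6 * e a) * Real.exp (-(0.6 * e a)) :=
                    mul_le_mul_of_nonneg_left (by linarith) (Real.exp_pos _).le
                _ = 1 := by rw [← Real.exp_add]; simp
            have := mul_le_mul_of_nonneg_left h3 (hPpos a).le
            simpa using this
  obtain ⟨ξ, hξ⟩ := key
  refine ⟨ξ, fun a => ?_⟩
  have h2 : w a * Real.exp (0.6 * m * e a - ∑ j, ψ a (ξ j)) ≤ 1 :=
    le_trans (Finset.single_le_sum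
      (f := fun a => w a * Real.exp (0.6 * m * e a - ∑ j, ψ a (ξ j)))
      (fun a _ => (mul_pos (hw a) (Real.exp_pos _)).le) (Finset.mem_univ a)) hξ
  have h3 := Real.log_le_log (mul_pos (hw a) (Real.exp_pos _)) h2
  rw [Real.log_mul (hw a).ne' (Real.exp_pos _).ne', Real.log_exp, Real.log_one] at h3
  linarith

/-- Derandomized Maurey, real version. -/
lemma maurey_real {J α : Type*} [Fintype J] [Fintype α] (pr : J → ℝ) (hp : ∀ j, 0 ≤ pr j)
    (hp1 : ∑ j, pr j = 1) (X : α → J → ℝ) (hX0 : ∀ a, ∑ j, pr j * X a j = 0) (D ε : ℝ)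
    (hD : 0 < D) (hX : ∀ a j, |X a j| ≤ D) (hε : 0 < ε) (hεD : ε ≤ 2 * D) (r : ℕ)
    (hr : Real.log (Fintype.card α) * (4 * D ^ 2) ≤ r * ε ^ 2) :
    ∃ e : Fin r → J, ∀ a, ∑ l, X a (e l) ≤ r * ε := by
  set lam := ε / (2 * D ^ 2) with hlam
  have hlampos : 0 < lam := by positivity
  have hlD : lam * D ≤ 1 := by
    rw [hlam, div_mul_eq_mul_div, div_le_one (by positivity)]
    nlinarith
  have key : ∀ r : ℕ, ∃ e : Fin r → J, ∑ a, Real.exp (lam * ∑ l, X a (e l)) ≤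
      Fintype.card α * Real.exp (r * (lam * D) ^ 2) := by
    intro r
    induction r with
    | zero => exact ⟨Fin.elim0, by simp⟩
    | succ r ih =>
      obtain ⟨e, he⟩ := ih
      set P : α → ℝ := fun a => Real.exp (lam * ∑ l, X a (e l)) with hP
      have hPpos : ∀ a, 0 < P a := fun a => Real.exp_pos _
      have hmgf : ∀ a, ∑ j, pr j * Real.exp (lam * X a j) ≤ Real.exp ((lam * D) ^ 2) := by
        intro a
        calc ∑ j, pr j * Real.exp (lam * X a j)
            ≤ ∑ j, pr j * (1 + lam * X a j + (lam * D) ^ 2) := by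
              apply Finset.sum_le_sum
              intro j _
              apply mul_le_mul_of_nonneg_left _ (hp j)
              have h1 : |lam * X a j| ≤ lam * D := by
                rw [abs_mul, abs_of_pos hlampos]
                exact mul_le_mul_of_nonneg_left (hX a j) hlampos.le
              have h2 := Real.abs_exp_sub_one_sub_id_le (h1.trans hlD)
              have h3 := (abs_le.mp h2).2
              have h4 : (lam * X a j) ^ 2 ≤ (lam * D) ^ 2 := by
                rw [← sq_abs]
                exact pow_le_pow_left₀ (abs_nonneg _) h1 2
              linarith
          _ = (1 + (lam * D) ^ 2) * ∑ j, pr j + lam * ∑ j, pr j * X a j := by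
              rw [Finset.mul_sum, Finset.mul_sum, ← Finset.sum_add_distrib]
              exact Finset.sum_congr rfl fun j _ => by ring
          _ = (lam * D) ^ 2 + 1 := by rw [hp1, hX0]; ring
          _ ≤ _ := Real.add_one_le_exp _
      have hj : ∃ j, ∑ a, P a * Real.exp (lam * X a j) ≤
          ∑ a, P a * Real.exp ((lam * D) ^ 2) := by
        by_contra hcon
        push Not at hcon
        have h1 : ∑ j, pr j * ∑ a, P a * Real.exp (lam * X a j) ≤
            ∑ a, P a * Real.exp ((lam * D) ^ 2) := by
          calc ∑ j, pr j * ∑ a, P a * Real.exp (lam * X a j)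
              = ∑ a, P a * ∑ j, pr j * Real.exp (lam * X a j) := by
                simp_rw [Finset.mul_sum]
                rw [Finset.sum_comm]
                exact Finset.sum_congr rfl fun a _ => Finset.sum_congr rfl fun j _ => by ring
            _ ≤ _ := Finset.sum_le_sum fun a _ =>
                mul_le_mul_of_nonneg_left (hmgf a) (hPpos a).le
        have h2 : ∑ j, pr j * ∑ a, P a * Real.exp ((lam * D) ^ 2) <
            ∑ j, pr j * ∑ a, P a * Real.exp (lam * X a j) := by
          have : ∃ j, 0 < pr j := by
            by_contra h
            push Not at h
            have : ∑ j, pr j ≤ 0 := Finset.sum_nonpos fun j _ => h j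
            linarith
          obtain ⟨j, hj⟩ := this
          exact Finset.sum_lt_sum (fun j _ => mul_le_mul_of_nonneg_left (hcon j).le (hp j))
            ⟨j, Finset.mem_univ _, mul_lt_mul_of_pos_left (hcon j) hj⟩
        rw [← Finset.sum_mul, hp1, one_mul] at h2
        linarith
      obtain ⟨j, hj⟩ := hj
      refine ⟨Fin.snoc e j, ?_⟩
      have h2 : ∀ a, Real.exp (lam * ∑ l, X a ((Fin.snoc e j : Fin (r+1) → J) l)) =
          P a * Real.exp (lam * X a j) := by
        intro a
        rw [Fin.sum_univ_castSucc]
        simp only [Fin.snoc_castSucc, Fin.snoc_last, hP]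
        rw [← Real.exp_add]; congr 1; ring
      simp_rw [h2]
      refine hj.trans ?_
      rw [← Finset.sum_mul]
      refine (mul_le_mul_of_nonneg_right he (Real.exp_pos _).le).trans ?_
      rw [mul_assoc, ← Real.exp_add]
      apply le_of_eq
      congr 2
      push_cast; ring
  obtain ⟨e, he⟩ := key r
  refine ⟨e, fun a => ?_⟩
  have h1 : Real.exp (lam * ∑ l, X a (e l)) ≤ Fintype.card α * Real.exp (r * (lam * D) ^ 2) :=
    (Finset.single_le_sum (f := fun a => Real.exp (lam * ∑ l, X a (e l)))
      (fun a _ => (Real.exp_pos _).le) (Finset.mem_univ a)).trans he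
  have hcard : (0:ℝ) < Fintype.card α := by
    have : Nonempty α := ⟨a⟩
    exact_mod_cast Fintype.card_pos
  have h2 := Real.log_le_log (Real.exp_pos _) h1
  rw [Real.log_exp, Real.log_mul hcard.ne' (Real.exp_pos _).ne', Real.log_exp] at h2
  have h3 : Real.log (Fintype.card α) ≤ r * ε ^ 2 / (4 * D ^ 2) := by
    rw [le_div_iff₀ (by positivity)]; exact hr
  have h4 : r * ε ^ 2 / (4 * D ^ 2) + r * (lam * D) ^ 2 = lam * (r * ε) := by
    rw [hlam]; field_simp; ring
  have h5 : lam * ∑ l, X a (e l) ≤ lam * (r * ε) := by linarith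
  exact le_of_mul_le_mul_left h5 hlampos

/-- the elementary vectors used in Maurey's construction -/
def mval {Y : Type*} {N : ℕ} (g : Fin N → Y → ℂ) : Option (Fin N × Fin 4) → Y → ℂ
  | none => fun _ => 0
  | some (i, n) => fun y => Complex.I ^ (n : ℕ) * g i y

/-- positive parts of a complex number in the four directions. -/
def cpart (z : ℂ) (n : Fin 4) : ℝ := max (z * (-Complex.I) ^ (n : ℕ)).re 0

lemma cpart_sum (z : ℂ) : ∑ n : Fin 4, (cpart z n : ℂ) * Complex.I ^ (n : ℕ) = z := by
  simp only [Fin.sum_univ_four, cpart]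
  apply Complex.ext
  · simp [pow_succ]
    rcases le_total z.re 0 with h | h
    · rw [max_eq_right h, max_eq_left (by linarith)]; ring
    · rw [max_eq_left h, max_eq_right (by linarith)]; ring
  · simp [pow_succ]
    rcases le_total z.im 0 with h | h
    · rw [max_eq_right h, max_eq_left (by linarith)]; ring
    · rw [max_eq_left h, max_eq_right (by linarith)]; ring

lemma cpart_le (z : ℂ) : ∑ n : Fin 4, cpart z n ≤ 2 * ‖z‖ := by
  have h1 := Complex.abs_re_le_norm z
  have h2 := Complex.abs_im_le_norm z
  simp only [Fin.sum_univ_four, cpart]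
  simp [pow_succ]
  rcases le_total z.re 0 with h | h <;> rcases le_total z.im 0 with h' | h' <;>
  simp only [abs_of_nonpos, abs_of_nonneg, h, h', max_eq_left, max_eq_right, Left.neg_nonpos_iff, Left.nonneg_neg_iff] at * <;> linarith

lemma maurey_sys {Y : Type*} [Fintype Y] {N : ℕ} (g : Fin N → Y → ℂ) (B : ℝ)
    (hB : 0 < B) (hg : ∀ i y, ‖g i y‖ ≤ B) (c : Fin N → ℂ) (W : ℝ) (hW : 0 < W)
    (hc : ∑ i, ‖c i‖ ≤ W) (ε : ℝ) (hε : 0 < ε) (hεW : ε ≤ 16 * (W * B)) (r : ℕ) (hr0 : 0 < r)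
    (hr : Real.log (4 * Fintype.card Y) * (256 * (W * B) ^ 2) ≤ r * ε ^ 2) :
    ∃ e : Fin r → Option (Fin N × Fin 4), ∀ y,
      ‖∑ i, c i * g i y - (2 * W / r : ℝ) * ∑ l, mval g (e l) y‖ ≤ ε := by
  set pr : Option (Fin N × Fin 4) → ℝ := fun o => match o with
    | none => 1 - ∑ i, ∑ n, cpart (c i) n / (2 * W)
    | some (i, n) => cpart (c i) n / (2 * W) with hpr
  have hcp : ∀ z n, 0 ≤ cpart z n := fun z n => le_max_right _ _
  have hp : ∀ j, 0 ≤ pr j := by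
    rintro (_ | ⟨i, n⟩)
    · simp only [hpr, sub_nonneg]
      simp_rw [← Finset.sum_div]
      rw [div_le_one (by positivity)]
      calc ∑ i, ∑ n, cpart (c i) n ≤ ∑ i, 2 * ‖c i‖ := Finset.sum_le_sum fun i _ => cpart_le _
        _ = 2 * ∑ i, ‖c i‖ := by rw [Finset.mul_sum]
        _ ≤ _ := by linarith
    · exact div_nonneg (hcp _ _) (by positivity)
  have hp1 : ∑ j, pr j = 1 := by
    rw [Fintype.sum_option, Fintype.sum_prod_type]
    simp [hpr]
  set f : Y → ℂ := fun y => ∑ i, c i * g i y with hf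
  have hmean : ∀ y, ∑ j, (pr j : ℂ) * (2 * W * mval g j y) = f y := by
    intro y
    rw [Fintype.sum_option, Fintype.sum_prod_type]
    simp only [hpr, mval, mul_zero, zero_add, hf]
    apply Finset.sum_congr rfl
    intro i _
    conv_rhs => rw [← cpart_sum (c i), Finset.sum_mul]
    apply Finset.sum_congr rfl
    intro n _
    push_cast
    have : (W : ℂ) ≠ 0 := by exact_mod_cast hW.ne'
    field_simp
  have hmv : ∀ j y, ‖2 * W * mval g j y‖ ≤ 2 * (W * B) := by
    rintro (_ | ⟨i, n⟩) y
    · simp [mval]; positivity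
    · simp only [mval, norm_mul, norm_pow, Complex.norm_I, one_pow, one_mul, Complex.norm_real,
        Complex.norm_ofNat, Real.norm_eq_abs, abs_of_pos hW]
      have := hg i y
      nlinarith
  have hfb : ∀ y, ‖f y‖ ≤ 2 * (W * B) := by
    intro y
    rw [← hmean]
    refine (norm_sum_le _ _).trans ?_
    calc ∑ j, ‖(pr j : ℂ) * (2 * W * mval g j y)‖ ≤ ∑ j, pr j * (2 * (W * B)) := by
          apply Finset.sum_le_sum
          intro j _
          rw [norm_mul, Complex.norm_real, Real.norm_eq_abs, abs_of_nonneg (hp j)]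
          exact mul_le_mul_of_nonneg_left (hmv j y) (hp j)
      _ = _ := by rw [← Finset.sum_mul, hp1, one_mul]
  obtain ⟨e, he⟩ := maurey_real (α := Y × Fin 4) pr hp hp1
    (fun a j => ((-Complex.I) ^ (a.2 : ℕ) * (2 * W * mval g j a.1 - f a.1)).re)
    (by
      rintro ⟨y, n⟩
      have h1 : ∑ j, (pr j : ℂ) * ((-Complex.I) ^ (n : ℕ) * (2 * W * mval g j y - f y)) = 0 := by
        have : ∀ j, (pr j : ℂ) * ((-Complex.I) ^ (n : ℕ) * (2 * W * mval g j y - f y)) =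
          (-Complex.I) ^ (n : ℕ) * ((pr j : ℂ) * (2 * W * mval g j y) - pr j * f y) := by
          intro j; ring
        simp_rw [this]
        rw [← Finset.mul_sum, Finset.sum_sub_distrib, hmean, ← Finset.sum_mul]
        have : ∑ j, (pr j : ℂ) = 1 := by exact_mod_cast hp1
        rw [this]; ring
      have h2 := congrArg Complex.re h1
      rw [Complex.re_sum] at h2
      simpa only [Complex.re_ofReal_mul, Complex.zero_re] using h2)
    (4 * (W * B)) (ε / 2) (by positivity)
    (by
      rintro ⟨y, n⟩ j
      refine (Complex.abs_re_le_norm _).trans ?_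
      rw [norm_mul, norm_pow, norm_neg, Complex.norm_I, one_pow, one_mul]
      refine (norm_sub_le _ _).trans ?_
      linarith [hmv j y, hfb y])
    (by positivity) (by linarith) r (by
      rw [Fintype.card_prod, Fintype.card_fin, Nat.cast_mul, mul_comm (Fintype.card Y : ℝ)]
      push_cast
      nlinarith [hr])
  refine ⟨e, fun y => ?_⟩
  have hrpos : (0:ℝ) < r := by exact_mod_cast hr0
  set z : ℂ := ∑ l, (2 * W * mval g (e l) y - f y) with hz
  have hzn : ∀ n : Fin 4, ((-Complex.I) ^ (n : ℕ) * z).re ≤ r * (ε / 2) := by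
    intro n
    have := he (y, n)
    rw [hz, Finset.mul_sum, Complex.re_sum]
    exact this
  have hre : |z.re| ≤ r * (ε / 2) := by
    have h0 := hzn 0
    have h2 := hzn 2
    simp [pow_succ] at h0 h2
    exact abs_le.mpr ⟨by linarith, by linarith⟩
  have him : |z.im| ≤ r * (ε / 2) := by
    have h0 := hzn 1
    have h2 := hzn 3
    simp [pow_succ] at h0 h2
    exact abs_le.mpr ⟨by linarith, by linarith⟩
  have hznorm : ‖z‖ ≤ r * ε := by
    have := Complex.norm_le_abs_re_add_abs_im z
    linarith
  have hfin : ∑ i, c i * g i y - (2 * W / r : ℝ) * ∑ l, mval g (e l) y = -(z / r) := by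
    rw [hz, Finset.sum_sub_distrib, ← Finset.mul_sum]
    have : (r : ℂ) ≠ 0 := by exact_mod_cast hrpos.ne'
    simp only [Finset.sum_const, Finset.card_univ, Fintype.card_fin, nsmul_eq_mul, hf]
    push_cast
    field_simp
    ring
  rw [hfin, norm_neg, norm_div, Complex.norm_natCast, div_le_iff₀ hrpos]
  linarith

end WCGAProof
namespace WCGAProof

/-- empirical p-th power mean -/
def Ep {M : ℕ} (p : ℝ) (f : Fin M → ℂ) : ℝ := (M : ℝ)⁻¹ * ∑ y, ‖f y‖ ^ p

lemma Ep_nonneg {M : ℕ} (p : ℝ) (f : Fin M → ℂ) : 0 ≤ Ep p f :=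
  mul_nonneg (by positivity) (Finset.sum_nonneg fun y _ => by positivity)

lemma add_rpow_le_two {p a b : ℝ} (hp1 : 1 ≤ p) (hp2 : p ≤ 2) (ha : 0 ≤ a) (hb : 0 ≤ b) :
    (a + b) ^ p ≤ 2 * (a ^ p + b ^ p) := by
  have h0 := NNReal.rpow_add_le_mul_rpow_add_rpow ⟨a, ha⟩ ⟨b, hb⟩ hp1
  have h1 : (a + b) ^ p ≤ (2:ℝ) ^ (p - 1) * (a ^ p + b ^ p) := by exact_mod_cast h0
  refine h1.trans ?_
  apply mul_le_mul_of_nonneg_right _ (by positivity)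
  calc (2:ℝ) ^ (p - 1) ≤ (2:ℝ) ^ (1:ℝ) :=
        Real.rpow_le_rpow_of_exponent_le (by norm_num) (by linarith)
    _ = 2 := by simp

lemma norm_add_rpow_le {p : ℝ} (hp1 : 1 ≤ p) (hp2 : p ≤ 2) (a b : ℂ) :
    ‖a + b‖ ^ p ≤ 2 * (‖a‖ ^ p + ‖b‖ ^ p) :=
  (Real.rpow_le_rpow (norm_nonneg _) (norm_add_le a b) (by linarith)).trans
    (add_rpow_le_two hp1 hp2 (norm_nonneg _) (norm_nonneg _))

lemma norm_sub_rpow_le {p : ℝ} (hp1 : 1 ≤ p) (hp2 : p ≤ 2) (a b : ℂ) :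
    ‖a - b‖ ^ p ≤ 2 * (‖a‖ ^ p + ‖b‖ ^ p) := by
  have := norm_add_rpow_le hp1 hp2 a (-b)
  rwa [norm_neg, ← sub_eq_add_neg] at this

lemma Ep_sub_le {M : ℕ} {p : ℝ} (hp1 : 1 ≤ p) (hp2 : p ≤ 2) (f h : Fin M → ℂ) :
    Ep p (f - h) ≤ 2 * (Ep p f + Ep p h) := by
  unfold Ep
  rw [← mul_add, ← Finset.sum_add_distrib, mul_left_comm]
  apply mul_le_mul_of_nonneg_left _ (by positivity)
  rw [Finset.mul_sum]
  exact Finset.sum_le_sum fun y _ => norm_sub_rpow_le hp1 hp2 _ _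

lemma sq_le_interp {p x ε : ℝ} (hp1 : 1 ≤ p) (hp2 : p ≤ 2) (hx : 0 ≤ x) (h : x ≤ ε) :
    x ^ (2:ℝ) ≤ ε ^ (2 - p) * x ^ p := by
  have : x ^ (2:ℝ) = x ^ (2 - p) * x ^ p := by
    rw [← Real.rpow_add_of_nonneg hx (by linarith) (by linarith)]; congr 1; ring
  rw [this]
  exact mul_le_mul_of_nonneg_right (Real.rpow_le_rpow hx h (by linarith)) (by positivity)

lemma Ep_two_le {M : ℕ} {p : ℝ} (hp1 : 1 ≤ p) (hp2 : p ≤ 2) (f : Fin M → ℂ) (ε : ℝ)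
    (h : ∀ y, ‖f y‖ ≤ ε) : Ep 2 f ≤ ε ^ (2 - p) * Ep p f := by
  unfold Ep
  rw [mul_left_comm]
  apply mul_le_mul_of_nonneg_left _ (by positivity)
  rw [Finset.mul_sum]
  exact Finset.sum_le_sum fun y _ => sq_le_interp hp1 hp2 (norm_nonneg _) (h y)

lemma sigma_sub {X ι : Type*} (g : ι → X → ℂ) {a b : ℕ} {f h : X → ℂ} (hf : f ∈ SigmaSet g a)
    (hh : h ∈ SigmaSet g b) : f - h ∈ SigmaSet g (a + b) := by
  obtain ⟨A, c, hA, rfl⟩ := hf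
  obtain ⟨A', c', hA', rfl⟩ := hh
  refine ⟨A ∪ A', fun i => (if i ∈ A then c i else 0) - (if i ∈ A' then c' i else 0),
    (Finset.card_union_le _ _).trans (by omega), ?_⟩
  funext x
  simp only [Pi.sub_apply, sub_mul, Finset.sum_sub_distrib, ite_mul, zero_mul]
  rw [← Finset.sum_filter, ← Finset.sum_filter]
  congr 1
  · apply Finset.sum_congr _ (fun _ _ => rfl)
    ext i; simp only [Finset.mem_filter, Finset.mem_union]; tauto
  · apply Finset.sum_congr _ (fun _ _ => rfl)
    ext i; simp only [Finset.mem_filter, Finset.mem_union]; tauto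

lemma sigma_smul {X ι : Type*} (g : ι → X → ℂ) {a : ℕ} {f : X → ℂ} (hf : f ∈ SigmaSet g a)
    (z : ℂ) : (fun x => z * f x) ∈ SigmaSet g a := by
  obtain ⟨A, c, hA, rfl⟩ := hf
  refine ⟨A, fun i => z * c i, hA, ?_⟩
  funext x
  rw [Finset.mul_sum]
  exact Finset.sum_congr rfl fun i _ => by ring

lemma sigma_mono {X ι : Type*} (g : ι → X → ℂ) {a b : ℕ} (hab : a ≤ b) {f : X → ℂ}
    (hf : f ∈ SigmaSet g a) : f ∈ SigmaSet g b := by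
  obtain ⟨A, c, hA, rfl⟩ := hf
  exact ⟨A, c, hA.trans hab, rfl⟩

/-- full-support coefficients -/
lemma sigma_coef {X : Type*} {N : ℕ} (A : Finset (Fin N)) (c : Fin N → ℂ) (g : Fin N → X → ℂ)
    (x : X) : ∑ i ∈ A, c i * g i x = ∑ i, (if i ∈ A then c i else 0) * g i x := by
  simp only [ite_mul, zero_mul]
  rw [← Finset.sum_filter]
  apply Finset.sum_congr _ (fun _ _ => rfl)
  ext i; simp

section nets

variable {M N s : ℕ} (g : Fin N → Fin M → ℂ) (B K p : ℝ)

/-- ℓ²-stability -/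
def Stab (g : Fin N → Fin M → ℂ) (K : ℝ) (σ : ℕ) : Prop :=
  ∀ (A : Finset (Fin N)) (c : Fin N → ℂ), A.card ≤ σ →
    ∑ i ∈ A, ‖c i‖ ^ 2 ≤ K * Ep 2 (fun y => ∑ i ∈ A, c i * g i y)

/-- unit ball of s-sparse functions -/
def FS (g : Fin N → Fin M → ℂ) (p : ℝ) (s : ℕ) : Set (Fin M → ℂ) :=
  {f | f ∈ SigmaSet g s ∧ Ep p f ≤ 1}

lemma l1_bound {σ : ℕ} (hS : Stab g K σ) (A : Finset (Fin N)) (c : Fin N → ℂ)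
    (hA : A.card ≤ σ) :
    (∑ i ∈ A, ‖c i‖) ^ 2 ≤ σ * (K * Ep 2 (fun y => ∑ i ∈ A, c i * g i y)) := by
  have h1 := sq_sum_le_card_mul_sum_sq (s := A) (f := fun i => ‖c i‖)
  refine h1.trans ?_
  have h2 := hS A c hA
  have h3 : (0:ℝ) ≤ ∑ i ∈ A, ‖c i‖ ^ 2 := Finset.sum_nonneg fun i _ => by positivity
  have h4 : (A.card : ℝ) ≤ σ := by exact_mod_cast hA
  nlinarith

lemma FS_sup (hp1 : 1 ≤ p) (hp2 : p ≤ 2) (hB : 0 < B) (hg : ∀ i y, ‖g i y‖ ≤ B)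
    (hK : 0 < K) (hS : Stab g K (2 * s)) {f : Fin M → ℂ} (hf : f ∈ FS g p s) (y : Fin M) :
    ‖f y‖ ^ p ≤ 2 * s * K * B ^ 2 := by
  obtain ⟨⟨A, c, hA, hfe⟩, hE⟩ := hf
  obtain ⟨y0, -, hy0⟩ := Finset.exists_max_image Finset.univ (fun y => ‖f y‖) ⟨y, Finset.mem_univ y⟩
  have hA2 : A.card ≤ 2 * s := by omega
  have h1 := l1_bound g K hS A c hA2
  rw [← hfe] at h1
  have h2 := Ep_two_le hp1 hp2 f ‖f y0‖ (fun y => hy0 y (Finset.mem_univ _))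
  have h3 : ‖f y0‖ ≤ B * ∑ i ∈ A, ‖c i‖ := by
    rw [hfe, Finset.mul_sum]
    refine (norm_sum_le _ _).trans (Finset.sum_le_sum fun i _ => ?_)
    rw [norm_mul, mul_comm]
    exact mul_le_mul_of_nonneg_right (hg i y0) (norm_nonneg _)
  set S := ‖f y0‖ with hSd
  have hS0 : 0 ≤ S := norm_nonneg _
  refine (Real.rpow_le_rpow (norm_nonneg _) (hy0 y (Finset.mem_univ _)) (by linarith)).trans ?_
  change S ^ p ≤ _
  rcases hS0.eq_or_lt with h | h
  · rw [← h, Real.zero_rpow (by linarith)]; positivity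
  · have h4 : S ^ 2 ≤ B ^ 2 * (∑ i ∈ A, ‖c i‖) ^ 2 := by
      rw [← mul_pow]; exact pow_le_pow_left₀ hS0 h3 2
    have hpos : 0 < S ^ (2 - p) := Real.rpow_pos_of_pos h _
    have h5 : Ep 2 f ≤ S ^ (2 - p) := h2.trans (mul_le_of_le_one_right hpos.le hE)
    have h6 : S ^ 2 = S ^ p * S ^ (2 - p) := by
      rw [← Real.rpow_add h, ← Real.rpow_natCast]; congr 1; push_cast; ring
    have h7 : (∑ i ∈ A, ‖c i‖) ^ 2 ≤ 2 * s * K * S ^ (2 - p) := by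
      refine h1.trans ?_
      push_cast
      rw [← mul_assoc]
      exact mul_le_mul_of_nonneg_left h5 (by positivity)
    have h8 : S ^ p * S ^ (2 - p) ≤ (2 * s * K * B ^ 2) * S ^ (2 - p) := by
      rw [← h6]
      nlinarith [sq_nonneg B]
    exact le_of_mul_le_mul_right h8 hpos

lemma FS_zero (hp1 : 1 ≤ p) : (0 : Fin M → ℂ) ∈ FS g p s := by
  refine ⟨⟨∅, 0, by simp, by funext x; simp⟩, ?_⟩
  simp [Ep, Real.zero_rpow (by linarith : p ≠ 0)]

lemma net_step (hp1 : 1 ≤ p) (hp2 : p ≤ 2) (hB : 0 < B) (hg : ∀ i y, ‖g i y‖ ≤ B)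
    (hK : 0 < K) (hs : 0 < s) (hS : Stab g K (2 * s)) (H : Finset (Fin M → ℂ))
    (hH : ∀ h ∈ H, h ∈ FS g p s) (ε : ℝ) (hε : 0 < ε) (hεQ : ε ^ p ≤ 2 * s * K * B ^ 2)
    (hcov : ∀ f ∈ FS g p s, ∃ h ∈ H, ∀ y, ‖f y - h y‖ ≤ ε) (r : ℕ) (hr0 : 0 < r)
    (hr : Real.log (4 * M) * (16384 * (2 * s * K * B ^ 2)) ≤ r * ε ^ p) :
    ∃ H' : Finset (Fin M → ℂ), (∀ h ∈ H', h ∈ FS g p s) ∧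
      (∀ f ∈ FS g p s, ∃ h ∈ H', ∀ y, ‖f y - h y‖ ≤ ε / 2) ∧
      H'.card ≤ H.card * (4 * N + 1) ^ r := by
  have hsR : (0:ℝ) < s := by exact_mod_cast hs
  set W : ℝ := Real.sqrt (8 * s * K * ε ^ (2 - p)) with hW
  have hepos : 0 < ε ^ (2 - p) := Real.rpow_pos_of_pos hε _
  have heppos : 0 < ε ^ p := Real.rpow_pos_of_pos hε _
  have hWpos : 0 < W := Real.sqrt_pos.mpr (by positivity)
  have hW2 : W ^ 2 = 8 * s * K * ε ^ (2 - p) := Real.sq_sqrt (by positivity)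
  have hee : ε ^ p * ε ^ (2 - p) = ε ^ 2 := by
    rw [← Real.rpow_add hε, ← Real.rpow_natCast]; congr 1; push_cast; ring
  set ctr : (Fin M → ℂ) × (Fin r → Option (Fin N × Fin 4)) → Fin M → ℂ :=
    fun q y => q.1 y + (2 * W / r : ℝ) * ∑ l, mval g (q.2 l) y with hctr
  set P : (Fin M → ℂ) × (Fin r → Option (Fin N × Fin 4)) → Prop :=
    fun q => ∃ f ∈ FS g p s, ∀ y, ‖f y - ctr q y‖ ≤ ε / 4 with hP
  set rep : (Fin M → ℂ) × (Fin r → Option (Fin N × Fin 4)) → Fin M → ℂ :=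
    fun q => if h : P q then h.choose else 0 with hrep
  refine ⟨(H ×ˢ Finset.univ).image rep, ?_, ?_, ?_⟩
  · intro h hh
    obtain ⟨q, -, rfl⟩ := Finset.mem_image.mp hh
    by_cases hq : P q
    · simp only [hrep, hq, dif_pos]
      exact hq.choose_spec.1
    · simp only [hrep, hq, dif_neg, not_false_eq_true]
      exact FS_zero g p hp1
  · intro f hf
    obtain ⟨h, hhH, hfh⟩ := hcov f hf
    have hsub := sigma_sub g hf.1 (hH h hhH).1
    obtain ⟨A, c, hA, hAe⟩ := hsub
    have hA2 : A.card ≤ 2 * s := by omega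
    have hEd : Ep p (f - h) ≤ 4 := by
      have := Ep_sub_le hp1 hp2 f h
      linarith [hf.2, (hH h hhH).2]
    have hE2 := Ep_two_le hp1 hp2 (f - h) ε hfh
    have hl1 := l1_bound g K hS A c hA2
    rw [← hAe] at hl1
    have hl1' : ∑ i ∈ A, ‖c i‖ ≤ W := by
      rw [hW]
      apply Real.le_sqrt_of_sq_le
      refine hl1.trans ?_
      have : Ep 2 (f - h) ≤ ε ^ (2 - p) * 4 :=
        hE2.trans (mul_le_mul_of_nonneg_left hEd hepos.le)
      push_cast
      calc (2 * (s:ℝ)) * (K * Ep 2 (f - h)) ≤ (2 * (s:ℝ)) * (K * (ε ^ (2 - p) * 4)) := by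
            gcongr
        _ = _ := by ring
    have hWB : (W * B) ^ 2 = 4 * (2 * s * K * B ^ 2) * ε ^ (2 - p) := by
      rw [mul_pow, hW2]; ring
    have hWBe : ε ≤ W * B := by
      refine (sq_le_sq₀ hε.le (by positivity)).mp ?_
      rw [hWB, ← hee]
      nlinarith
    obtain ⟨e, he⟩ := maurey_sys g B hB hg (fun i => if i ∈ A then c i else 0) W hWpos
      (by
        refine le_trans (le_of_eq ?_) hl1'
        simp only [apply_ite norm, norm_zero]
        rw [← Finset.sum_filter]
        apply Finset.sum_congr _ (fun _ _ => rfl)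
        ext i; simp)
      (ε / 4) (by positivity) (by linarith) r hr0
      (by
        rw [hWB, Fintype.card_fin]
        have : (r:ℝ) * (ε / 4) ^ 2 = (r * ε ^ p) * ε ^ (2 - p) / 16 := by
          rw [mul_assoc, hee]; ring
        rw [this]
        nlinarith)
    have hPq : P (h, e) := by
      refine ⟨f, hf, fun y => ?_⟩
      have h1 := he y
      rw [← sigma_coef] at h1
      have h2 : f y - h y = ∑ i ∈ A, c i * g i y := congrFun hAe y
      rw [← h2] at h1
      simp only [hctr]
      rwa [← sub_sub]
    refine ⟨rep (h, e), Finset.mem_image_of_mem _ (by simp [hhH]), fun y => ?_⟩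
    have h3 : ∀ y, ‖rep (h, e) y - ctr (h, e) y‖ ≤ ε / 4 := by
      simp only [hrep, hPq, dif_pos]
      exact hPq.choose_spec.2
    have h4 : ‖f y - ctr (h, e) y‖ ≤ ε / 4 := by
      have h1 := he y
      rw [← sigma_coef] at h1
      have h2 : f y - h y = ∑ i ∈ A, c i * g i y := congrFun hAe y
      rw [← h2] at h1
      simp only [hctr]
      rwa [← sub_sub]
    have h5 := h3 y
    calc ‖f y - rep (h, e) y‖ = ‖(f y - ctr (h, e) y) - (rep (h, e) y - ctr (h, e) y)‖ := by
          congr 1; ring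
      _ ≤ _ := norm_sub_le _ _
      _ ≤ _ := by linarith
  · refine Finset.card_image_le.trans ?_
    rw [Finset.card_product, Finset.card_univ, Fintype.card_fun, Fintype.card_option,
      Fintype.card_prod, Fintype.card_fin, Fintype.card_fin, Fintype.card_fin, mul_comm N 4]

end nets

end WCGAProof
namespace WCGAProof

lemma geom_trunc (q : ℝ) (hq : 2 ≤ q) (X : ℝ) (hX : 0 ≤ X) (n : ℕ) : ∀ a : ℝ, 0 ≤ a →
    ∑ k ∈ Finset.range n, (if q * (a / q ^ k) ≤ X then a / q ^ k else 0) ≤ min X (2 * a) := by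
  induction n with
  | zero => intro a ha; simp; exact ⟨hX, ha⟩
  | succ n ih =>
    intro a ha
    rw [Finset.sum_range_succ']
    have hq0 : 0 < q := by linarith
    have h1 := ih (a / q) (by positivity)
    have h2 : ∀ k, a / q / q ^ k = a / q ^ (k + 1) := by
      intro k; rw [pow_succ, div_div, mul_comm]
    simp_rw [h2] at h1
    have h3 : 2 * (a / q) ≤ a := by
      rw [mul_div_assoc', div_le_iff₀ hq0]; nlinarith
    have h4 := le_min_iff.mp h1
    simp only [pow_zero, div_one]
    refine le_min ?_ ?_
    · split_ifs with h
      · nlinarith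
      · linarith [h4.1]
    · split_ifs with h <;> linarith [h4.2]

section nets

variable {M N s : ℕ} (g : Fin N → Fin M → ℂ) (B K p : ℝ)

lemma eps_pow (hp1 : 1 ≤ p) {Q : ℝ} (hQ : 0 ≤ Q) (k : ℕ) :
    (Q ^ (1 / p) / 2 ^ k) ^ p = Q / ((2:ℝ) ^ p) ^ k := by
  rw [Real.div_rpow (by positivity) (by positivity), ← Real.rpow_mul hQ,
    one_div_mul_cancel (by linarith), Real.rpow_one]
  congr 1
  rw [← Real.rpow_natCast, ← Real.rpow_natCast, ← Real.rpow_mul (by norm_num),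
    ← Real.rpow_mul (by norm_num), mul_comm]

lemma two_rpow_ge (hp1 : 1 ≤ p) : (2:ℝ) ≤ 2 ^ p := by
  calc (2:ℝ) = 2 ^ (1:ℝ) := by simp
    _ ≤ _ := Real.rpow_le_rpow_of_exponent_le (by norm_num) hp1

lemma one_le_log_four_mul (hM : 0 < M) : 1 ≤ Real.log (4 * M) := by
  have h1 : (1:ℝ) ≤ M := by exact_mod_cast hM
  rw [Real.le_log_iff_exp_le (by positivity)]
  have := Real.exp_one_lt_d9
  linarith

lemma net_exists (hp1 : 1 ≤ p) (hp2 : p ≤ 2) (hB : 0 < B) (hg : ∀ i y, ‖g i y‖ ≤ B)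
    (hK : 0 < K) (hs : 0 < s) (hS : Stab g K (2 * s)) (hM : 0 < M) (k : ℕ) :
    ∃ H : Finset (Fin M → ℂ), (∀ h ∈ H, h ∈ FS g p s) ∧
      (∀ f ∈ FS g p s, ∃ h ∈ H, ∀ y, ‖f y - h y‖ ≤ (2 * s * K * B ^ 2) ^ (1 / p) / 2 ^ k) ∧
      (H.card : ℝ) ≤ Real.exp (16385 * Real.log (4 * M) * Real.log (4 * N + 1) *
        ((2:ℝ) ^ p) ^ k) := by
  have hsR : (0:ℝ) < s := by exact_mod_cast hs
  have hQ : 0 < 2 * s * K * B ^ 2 := by positivity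
  set Q := 2 * s * K * B ^ 2 with hQd
  have hq := two_rpow_ge p hp1
  set q := (2:ℝ) ^ p with hqd
  have hq0 : 0 < q := by linarith
  have hlM := one_le_log_four_mul hM
  have hlN : 0 ≤ Real.log (4 * N + 1) := Real.log_nonneg (by linarith [(Nat.cast_nonneg N : (0:ℝ) ≤ N)])
  induction k with
  | zero =>
    refine ⟨{0}, ?_, ?_, ?_⟩
    · intro h hh; rw [Finset.mem_singleton.mp hh]; exact FS_zero g p hp1
    · intro f hf
      refine ⟨0, by simp, fun y => ?_⟩
      have := FS_sup g B K p hp1 hp2 hB hg hK hS hf y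
      simp only [Pi.zero_apply, sub_zero, pow_zero, div_one]
      rw [one_div]
      exact (Real.le_rpow_inv_iff_of_pos (norm_nonneg _) hQ.le (by linarith)).mpr this
    · rw [Finset.card_singleton, Nat.cast_one]
      exact Real.one_le_exp (by positivity)
  | succ k ih =>
    obtain ⟨H, hH1, hH2, hH3⟩ := ih
    have hεpos : 0 < Q ^ (1 / p) / 2 ^ k := div_pos (Real.rpow_pos_of_pos hQ _) (by positivity)
    have hεp := eps_pow p hp1 hQ.le k
    have hqk : 1 ≤ q ^ k := one_le_pow₀ (by linarith)
    set r := ⌈16384 * Real.log (4 * M) * q ^ k⌉₊ with hr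
    have hrge : 16384 * Real.log (4 * M) * q ^ k ≤ r := Nat.le_ceil _
    have hrle : (r:ℝ) ≤ 16385 * Real.log (4 * M) * q ^ k := by
      have := (Nat.ceil_lt_add_one (by positivity : 0 ≤ 16384 * Real.log (4 * M) * q ^ k)).le
      have h2 : 1 ≤ Real.log (4 * M) * q ^ k := one_le_mul_of_one_le_of_one_le hlM hqk
      linarith
    have hr0 : 0 < r := Nat.ceil_pos.mpr (by positivity)
    obtain ⟨H', h1, h2, h3⟩ := net_step g B K p hp1 hp2 hB hg hK hs hS H hH1 _ hεpos
      (by rw [hεp]; exact div_le_self hQ.le hqk) hH2 r hr0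
      (by
        rw [hεp, ← hQd, mul_div_assoc', le_div_iff₀ (by positivity)]
        nlinarith)
    refine ⟨H', h1, ?_, ?_⟩
    · have : Q ^ (1 / p) / 2 ^ k / 2 = Q ^ (1 / p) / 2 ^ (k + 1) := by
        rw [pow_succ, div_div]
      rw [← this]; exact h2
    · have h3' : (H'.card : ℝ) ≤ H.card * (4 * N + 1) ^ r := by exact_mod_cast h3
      refine h3'.trans ?_
      have h4 : ((4 * N + 1 : ℝ)) ^ r = Real.exp (r * Real.log (4 * N + 1)) := by
        rw [Real.exp_nat_mul, Real.exp_log (by positivity)]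
      rw [h4]
      calc (H.card : ℝ) * Real.exp (r * Real.log (4 * N + 1))
          ≤ Real.exp (16385 * Real.log (4 * M) * Real.log (4 * N + 1) * q ^ k) *
              Real.exp ((16385 * Real.log (4 * M) * q ^ k) * Real.log (4 * N + 1)) := by
            gcongr
        _ ≤ _ := by
            rw [← Real.exp_add]
            apply Real.exp_le_exp.mpr
            rw [pow_succ]
            have : 0 ≤ 16385 * Real.log (4 * M) * Real.log (4 * N + 1) * q ^ k := by positivity
            nlinarith

lemma lower_pt {R x : ℝ} (hx0 : 0 ≤ x) (hxR : x ≤ R) (hp1 : 1 ≤ p) (L : ℕ) (hR : 0 < R) :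
    (x / 8) ^ p - (R / 2 ^ L / 2) ^ p ≤
      ∑ k ∈ Finset.range (L + 1), (R / 2 ^ k) ^ p * (if 4 * (R / 2 ^ k) ≤ x then 1 else 0) := by
  have hnn : ∀ k ∈ Finset.range (L + 1),
      0 ≤ (R / 2 ^ k) ^ p * (if 4 * (R / 2 ^ k) ≤ x then 1 else 0) := by
    intro k _
    apply mul_nonneg (by positivity)
    split_ifs <;> norm_num
  by_cases h : 4 * (R / 2 ^ L) ≤ x
  · have hex : ∃ k, 4 * (R / 2 ^ k) ≤ x := ⟨L, h⟩
    set k := Nat.find hex with hk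
    have hk1 : 4 * (R / 2 ^ k) ≤ x := Nat.find_spec hex
    have hkL : k ≤ L := Nat.find_min' hex h
    have hk2 : x ≤ 8 * (R / 2 ^ k) := by
      rcases Nat.eq_zero_or_pos k with h0 | h0
      · rw [h0]; simp; linarith
      · have := Nat.find_min hex (m := k - 1) (by omega)
        push Not at this
        have h2 : (2:ℝ) ^ k = 2 ^ (k - 1) * 2 := by
          rw [← pow_succ]; congr 1; omega
        rw [h2, ← div_div]; linarith
    calc (x / 8) ^ p - (R / 2 ^ L / 2) ^ p ≤ (x / 8) ^ p := by
          have : 0 ≤ (R / 2 ^ L / 2) ^ p := by positivity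
          linarith
      _ ≤ (R / 2 ^ k) ^ p := Real.rpow_le_rpow (by positivity) (by linarith) (by linarith)
      _ = (R / 2 ^ k) ^ p * (if 4 * (R / 2 ^ k) ≤ x then 1 else 0) := by rw [if_pos hk1, mul_one]
      _ ≤ _ := Finset.single_le_sum hnn (Finset.mem_range.mpr (by omega))
  · push Not at h
    have : (x / 8) ^ p ≤ (R / 2 ^ L / 2) ^ p :=
      Real.rpow_le_rpow (by positivity) (by linarith) (by linarith)
    linarith [Finset.sum_nonneg hnn]

lemma sum_half (n : ℕ) : ∑ k ∈ Finset.range n, (1 / 2 : ℝ) ^ (k + 1) ≤ 1 := by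
  have : ∑ k ∈ Finset.range n, (1 / 2 : ℝ) ^ (k + 1) = 1 - (1 / 2) ^ n := by
    induction n with
    | zero => simp
    | succ n ih => rw [Finset.sum_range_succ, ih]; ring
  rw [this]
  have : (0:ℝ) ≤ (1 / 2) ^ n := by positivity
  linarith

lemma stage2 (hp1 : 1 ≤ p) (hp2 : p ≤ 2) (hB : 0 < B) (hg : ∀ i y, ‖g i y‖ ≤ B)
    (hK : 0 < K) (hs : 0 < s) (hS : Stab g K (2 * s)) (hM : 0 < M) (hN : 0 < N)
    (hQ1 : 1 ≤ 2 * s * K * B ^ 2) (L : ℕ) (hL : 8 * (2 * s * K * B ^ 2) ≤ 2 ^ L) (m : ℕ)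
    (hm : 2000 * (16385 * Real.log (4 * M) * Real.log (4 * N + 1)) * (2 * s * K * B ^ 2) *
      (L + 1) ≤ m) :
    ∃ ξ : Fin m → Fin M, ∀ f ∈ SigmaSet g s, Ep p f ≤ 300 * Ep p (f ∘ ξ) := by
  have hsR : (0:ℝ) < s := by exact_mod_cast hs
  have hMR : (0:ℝ) < M := by exact_mod_cast hM
  choose H hH1 hH2 hH3 using net_exists g B K p hp1 hp2 hB hg hK hs hS hM
  set A := 16385 * Real.log (4 * M) * Real.log (4 * N + 1) with hA
  have hsup : ∀ f ∈ FS g p s, ∀ y, ‖f y‖ ^ p ≤ 2 * s * K * B ^ 2 := fun f hf y =>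
    FS_sup g B K p hp1 hp2 hB hg hK hS hf y
  set Q := 2 * s * K * B ^ 2 with hQd
  have hQ : 0 < Q := by linarith
  have hq := two_rpow_ge p hp1
  have hlM := one_le_log_four_mul hM
  have hlN : 1 ≤ Real.log (4 * N + 1) := by
    have h1 : (1:ℝ) ≤ N := by exact_mod_cast hN
    rw [Real.le_log_iff_exp_le (by positivity)]
    have := Real.exp_one_lt_d9
    linarith
  have hA1 : 1 ≤ A := by
    have := one_le_mul_of_one_le_of_one_le hlM hlN
    rw [hA]; nlinarith
  set q := (2:ℝ) ^ p with hqd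
  have hq0 : 0 < q := by linarith
  set R := Q ^ (1 / p) with hR
  have hRpos : 0 < R := Real.rpow_pos_of_pos hQ _
  have hRQ : R ≤ Q := by
    calc R ≤ Q ^ (1:ℝ) := Real.rpow_le_rpow_of_exponent_le hQ1 (by
          rw [div_le_one (by linarith)]; exact hp1)
      _ = Q := Real.rpow_one _
  have hεp : ∀ k : ℕ, (R / 2 ^ k) ^ p = Q / q ^ k := fun k => eps_pow p hp1 hQ.le k
  have hmpos : (0:ℝ) < m := lt_of_lt_of_le (by positivity) hm
  -- the family
  set ψ : ((k : Fin (L + 1)) × (H k)) → Fin M → ℝ :=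
    fun a y => if 3 * (R / 2 ^ (a.1 : ℕ)) ≤ ‖(a.2 : Fin M → ℂ) y‖ then 1 else 0 with hψ
  obtain ⟨ξ, hξ⟩ := sampling ψ
    (fun a x => by simp only [hψ]; split_ifs <;> norm_num)
    (fun a x => by simp only [hψ]; split_ifs <;> norm_num)
    (fun a => (M:ℝ)⁻¹ * ∑ y, ψ a y)
    (by
      intro ω hω
      by_contra hcon
      push Not at hcon
      have h1 : ∑ y : Fin M, ∑ a, ω a * ψ a y <
          ∑ y : Fin M, ∑ a, ω a * ((M:ℝ)⁻¹ * ∑ y, ψ a y) := by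
        have : Nonempty (Fin M) := ⟨⟨0, hM⟩⟩
        exact Finset.sum_lt_sum_of_nonempty Finset.univ_nonempty fun y _ => hcon y
      rw [Finset.sum_const, Finset.card_univ, Fintype.card_fin, nsmul_eq_mul, Finset.sum_comm,
        Finset.mul_sum] at h1
      apply lt_irrefl _ (lt_of_lt_of_eq h1 _)
      apply Finset.sum_congr rfl
      intro a _
      rw [← Finset.mul_sum]
      field_simp)
    (fun a => Real.exp (-(2 * A * q ^ (a.1 : ℕ)))) (fun a => Real.exp_pos _)
    (by
      rw [Fintype.sum_sigma]
      simp only [Finset.sum_const, Finset.card_univ, Fintype.card_coe, nsmul_eq_mul]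
      refine le_trans ?_ (sum_half (L + 1))
      rw [← Fin.sum_univ_eq_sum_range (fun k => (1 / 2 : ℝ) ^ (k + 1))]
      apply Finset.sum_le_sum
      intro k _
      have h1 : ((k:ℕ):ℝ) + 1 ≤ A * q ^ (k:ℕ) := by
        have h2 : ((k:ℕ):ℝ) + 1 ≤ 2 ^ (k:ℕ) := by
          exact_mod_cast Nat.lt_two_pow_self
        have h3 : (2:ℝ) ^ (k:ℕ) ≤ q ^ (k:ℕ) := pow_le_pow_left₀ (by norm_num) hq _
        have h4 : q ^ (k:ℕ) ≤ A * q ^ (k:ℕ) := le_mul_of_one_le_left (by positivity) hA1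
        linarith
      calc ((H k).card : ℝ) * Real.exp (-(2 * A * q ^ (k:ℕ)))
          ≤ Real.exp (A * q ^ (k:ℕ)) * Real.exp (-(2 * A * q ^ (k:ℕ))) :=
            mul_le_mul_of_nonneg_right (hH3 k) (Real.exp_pos _).le
        _ = Real.exp (-(A * q ^ (k:ℕ))) := by rw [← Real.exp_add]; congr 1; ring
        _ ≤ Real.exp (-(((k:ℕ):ℝ) + 1)) := Real.exp_le_exp.mpr (by linarith)
        _ = (Real.exp (-1)) ^ ((k:ℕ) + 1) := by
            rw [← Real.exp_nat_mul]; congr 1; push_cast; ring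
        _ ≤ _ := by
            apply pow_le_pow_left₀ (Real.exp_pos _).le
            have := exp_neg_le_aux (y := 1) (by norm_num) le_rfl
            linarith)
    m
  have main : ∀ f ∈ SigmaSet g s, Ep p f = 1 → 1 / 300 ≤ Ep p (f ∘ ξ) := by
    intro f hf hE
    have hfF : f ∈ FS g p s := ⟨hf, hE.le⟩
    choose hn hnH hnd using fun k => hH2 k f hfF
    set a : Fin (L + 1) → ((k : Fin (L + 1)) × (H k)) := fun k => ⟨k, ⟨hn k, hnH k⟩⟩ with ha
    have hxR : ∀ y, ‖f y‖ ≤ R := by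
      intro y
      have := hsup f hfF y
      rw [hR, one_div]
      exact (Real.le_rpow_inv_iff_of_pos (norm_nonneg _) hQ.le (by linarith)).mpr this
    -- upper pointwise
    have hup : ∀ y, ∑ k : Fin (L + 1), (R / 2 ^ (k:ℕ)) ^ p * ψ (a k) y ≤ ‖f y‖ ^ p := by
      intro y
      have h1 := (le_min_iff.mp (geom_trunc q hq (‖f y‖ ^ p) (by positivity) (L + 1) Q hQ.le)).1
      refine le_trans ?_ h1
      rw [← Fin.sum_univ_eq_sum_range
        (fun k => if q * (Q / q ^ k) ≤ ‖f y‖ ^ p then Q / q ^ k else 0)]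
      apply Finset.sum_le_sum
      intro k _
      rw [hεp]
      by_cases h3 : 3 * (R / 2 ^ (k:ℕ)) ≤ ‖hn k y‖
      · have h4 : 2 * (R / 2 ^ (k:ℕ)) ≤ ‖f y‖ := by
          have h5 := hnd k y
          have h6 : ‖hn k y‖ ≤ ‖f y‖ + ‖f y - hn k y‖ := by
            calc ‖hn k y‖ = ‖f y - (f y - hn k y)‖ := by congr 1; ring
              _ ≤ _ := norm_sub_le _ _
          linarith
        have h7 : q * (Q / q ^ (k:ℕ)) ≤ ‖f y‖ ^ p := by
          rw [← hεp, hqd, ← Real.mul_rpow (by norm_num) (by positivity)]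
          exact Real.rpow_le_rpow (by positivity) h4 (by linarith)
        rw [if_pos h7]
        simp only [hψ, ha, if_pos h3, mul_one, le_refl]
      · simp only [hψ, ha, if_neg h3, mul_zero]
        split_ifs <;> positivity
    have hlow : ∀ y, (‖f y‖ / 8) ^ p - (R / 2 ^ L / 2) ^ p ≤
        ∑ k : Fin (L + 1), (R / 2 ^ (k:ℕ)) ^ p * ψ (a k) y := by
      intro y
      refine (lower_pt p (norm_nonneg _) (hxR y) hp1 L hRpos).trans ?_
      rw [← Fin.sum_univ_eq_sum_range
        (fun k => (R / 2 ^ k) ^ p * (if 4 * (R / 2 ^ k) ≤ ‖f y‖ then (1:ℝ) else 0))]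
      apply Finset.sum_le_sum
      intro k _
      apply mul_le_mul_of_nonneg_left _ (by positivity)
      by_cases h4 : 4 * (R / 2 ^ (k:ℕ)) ≤ ‖f y‖
      · have h3 : 3 * (R / 2 ^ (k:ℕ)) ≤ ‖hn k y‖ := by
          have h5 := hnd k y
          have h6 : ‖f y‖ ≤ ‖hn k y‖ + ‖f y - hn k y‖ := by
            calc ‖f y‖ = ‖hn k y + (f y - hn k y)‖ := by congr 1; ring
              _ ≤ _ := norm_add_le _ _
          linarith
        simp only [hψ, ha, if_pos h3, if_pos h4, le_refl]
      · rw [if_neg h4]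
        simp only [hψ]; split_ifs <;> norm_num
    -- mean lower bound
    have h8 : (1 / 64 : ℝ) ≤ (1 / 8 : ℝ) ^ p := by
      calc (1 / 64 : ℝ) = (1 / 8 : ℝ) ^ (2:ℝ) := by norm_num
        _ ≤ _ := Real.rpow_le_rpow_of_exponent_ge (by norm_num) (by norm_num) hp2
    have hRL : (R / 2 ^ L / 2) ^ p ≤ (1 / 8 : ℝ) ^ p / 2 := by
      have h1 : R / 2 ^ L ≤ 1 / 8 := by
        rw [div_le_iff₀ (by positivity)]; linarith
      calc (R / 2 ^ L / 2) ^ p ≤ ((1 / 8) / 2) ^ p :=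
            Real.rpow_le_rpow (by positivity) (by linarith) (by linarith)
        _ = (1 / 8 : ℝ) ^ p / q := Real.div_rpow (by norm_num) (by norm_num) _
        _ ≤ _ := by gcongr
    have hmean : (1 / 128 : ℝ) ≤ ∑ k : Fin (L + 1), (R / 2 ^ (k:ℕ)) ^ p *
        ((M:ℝ)⁻¹ * ∑ y, ψ (a k) y) := by
      have h1 : ∑ k : Fin (L + 1), (R / 2 ^ (k:ℕ)) ^ p * ((M:ℝ)⁻¹ * ∑ y, ψ (a k) y) =
          (M:ℝ)⁻¹ * ∑ y, ∑ k : Fin (L + 1), (R / 2 ^ (k:ℕ)) ^ p * ψ (a k) y := by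
        rw [Finset.sum_comm, Finset.mul_sum]
        apply Finset.sum_congr rfl
        intro k _
        rw [← Finset.mul_sum]; ring
      rw [h1]
      have h2 : (M:ℝ)⁻¹ * ∑ y, ((‖f y‖ / 8) ^ p - (R / 2 ^ L / 2) ^ p) ≤
          (M:ℝ)⁻¹ * ∑ y, ∑ k : Fin (L + 1), (R / 2 ^ (k:ℕ)) ^ p * ψ (a k) y :=
        mul_le_mul_of_nonneg_left (Finset.sum_le_sum fun y _ => hlow y) (by positivity)
      have h3 : (M:ℝ)⁻¹ * ∑ y, ((‖f y‖ / 8) ^ p - (R / 2 ^ L / 2) ^ p) =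
          (1 / 8 : ℝ) ^ p - (R / 2 ^ L / 2) ^ p := by
        rw [Finset.sum_sub_distrib, Finset.sum_const, Finset.card_univ, Fintype.card_fin,
          nsmul_eq_mul, mul_sub, ← mul_assoc, inv_mul_cancel₀ hMR.ne', one_mul]
        congr 1
        have : ∀ y, (‖f y‖ / 8) ^ p = (1 / 8 : ℝ) ^ p * ‖f y‖ ^ p := by
          intro y
          rw [← Real.mul_rpow (by norm_num) (norm_nonneg _)]; congr 1; ring
        simp_rw [this]
        rw [← Finset.mul_sum, mul_left_comm]
        unfold Ep at hE
        rw [hE, mul_one]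
      linarith
    have hfin : (m:ℝ)⁻¹ * ∑ j, ∑ k : Fin (L + 1), (R / 2 ^ (k:ℕ)) ^ p * ψ (a k) (ξ j) ≤
        Ep p (f ∘ ξ) := by
      unfold Ep
      exact mul_le_mul_of_nonneg_left (Finset.sum_le_sum fun j _ => hup (ξ j)) (by positivity)
    refine le_trans ?_ hfin
    have h5 : (m:ℝ)⁻¹ * ∑ j, ∑ k : Fin (L + 1), (R / 2 ^ (k:ℕ)) ^ p * ψ (a k) (ξ j) =
        ∑ k : Fin (L + 1), (R / 2 ^ (k:ℕ)) ^ p * ((m:ℝ)⁻¹ * ∑ j, ψ (a k) (ξ j)) := by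
      rw [Finset.sum_comm, Finset.mul_sum]
      apply Finset.sum_congr rfl
      intro k _
      rw [← Finset.mul_sum]; ring
    rw [h5]
    have h6 : ∀ k : Fin (L + 1), 0.6 * ((R / 2 ^ (k:ℕ)) ^ p * ((M:ℝ)⁻¹ * ∑ y, ψ (a k) y)) -
        2 * A * Q / m ≤ (R / 2 ^ (k:ℕ)) ^ p * ((m:ℝ)⁻¹ * ∑ j, ψ (a k) (ξ j)) := by
      intro k
      have h7 := hξ (a k)
      rw [Real.log_exp] at h7
      have h9 : (m:ℝ)⁻¹ * (0.6 * m * ((M:ℝ)⁻¹ * ∑ y, ψ (a k) y) + -(2 * A * q ^ (k:ℕ))) ≤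
        (m:ℝ)⁻¹ * ∑ j, ψ (a k) (ξ j) := mul_le_mul_of_nonneg_left h7 (by positivity)
      have h10 := mul_le_mul_of_nonneg_left h9 (by positivity : 0 ≤ (R / 2 ^ (k:ℕ)) ^ p)
      refine le_trans (le_of_eq ?_) h10
      rw [hεp]
      have : q ^ (k:ℕ) ≠ 0 := by positivity
      field_simp
      ring
    refine le_trans ?_ (Finset.sum_le_sum fun k _ => h6 k)
    rw [Finset.sum_sub_distrib, ← Finset.mul_sum, Finset.sum_const, Finset.card_univ,
      Fintype.card_fin, nsmul_eq_mul]
    have h11 : ((L + 1 : ℕ) : ℝ) * (2 * A * Q / m) ≤ 1 / 1000 := by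
      rw [mul_div_assoc', div_le_iff₀ hmpos]
      push_cast
      nlinarith
    have h12 : 0.6 * (1 / 128 : ℝ) ≤ 0.6 * ∑ k : Fin (L + 1), (R / 2 ^ (k:ℕ)) ^ p *
        ((M:ℝ)⁻¹ * ∑ y, ψ (a k) y) := by linarith
    refine le_trans ?_ (sub_le_sub h12 h11)
    norm_num
  refine ⟨ξ, fun f hf => ?_⟩
  rcases (Ep_nonneg p f).eq_or_lt with h0 | h0
  · rw [← h0]; have := Ep_nonneg p (f ∘ ξ); linarith
  · set z : ℝ := (Ep p f) ^ (-(1 / p)) with hz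
    have hzpos : 0 < z := Real.rpow_pos_of_pos h0 _
    have hzp : z ^ p = (Ep p f)⁻¹ := by
      rw [hz, ← Real.rpow_mul h0.le, neg_mul, one_div_mul_cancel (by linarith),
        Real.rpow_neg_one]
    have hscale : ∀ {m' : ℕ} (h : Fin m' → ℂ), Ep p (fun x => (z:ℂ) * h x) = z ^ p * Ep p h := by
      intro m' h
      unfold Ep
      have : ∀ x, ‖(z:ℂ) * h x‖ ^ p = z ^ p * ‖h x‖ ^ p := by
        intro x
        rw [norm_mul, Complex.norm_real, Real.norm_eq_abs, abs_of_pos hzpos,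
          Real.mul_rpow hzpos.le (norm_nonneg _)]
      simp_rw [this]
      rw [← Finset.mul_sum]; ring
    have h1 := main _ (sigma_smul g hf (z:ℂ)) (by rw [hscale, hzp, inv_mul_cancel₀ h0.ne'])
    have h2 : Ep p ((fun x => (z:ℂ) * f x) ∘ ξ) = z ^ p * Ep p (f ∘ ξ) := hscale (f ∘ ξ)
    rw [h2, hzp, inv_mul_eq_div, le_div_iff₀ h0] at h1
    linarith

end nets

end WCGAProof
namespace WCGAProof
set_option linter.unusedSectionVars false
set_option linter.unusedVariables false

section stage1
variable {X : Type*} [TopologicalSpace X] [CompactSpace X] [T2Space X] [MeasurableSpace X] [BorelSpace X]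
  (μ : Measure X) [IsProbabilityMeasure μ] {N : ℕ} (g : Fin N → X → ℂ) (B : ℝ)

lemma cont_sum (hgc : ∀ i, Continuous (g i)) (A : Finset (Fin N)) (c : Fin N → ℂ) :
    Continuous (fun x => ∑ i ∈ A, c i * g i x) :=
  continuous_finsetSum _ fun i _ => continuous_const.mul (hgc i)

lemma integ_cont {E : Type*} [NormedAddCommGroup E] [SecondCountableTopologyEither X E] {f : X → E}
    (hf : Continuous f) : Integrable f μ := by
  have := hf.continuousOn.integrableOn_compact (μ := μ) (isCompact_univ (X := X))
  rwa [integrableOn_univ] at this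

lemma orth_sum [SecondCountableTopologyEither X ℂ] (hgc : ∀ i, Continuous (g i))
    (ho : ∀ i j, ∫ x, g i x * (starRingEnd ℂ) (g j x) ∂μ = if i = j then 1 else 0)
    (A : Finset (Fin N)) (c : Fin N → ℂ) :
    ∫ x, ‖∑ i ∈ A, c i * g i x‖ ^ 2 ∂μ = ∑ i ∈ A, ‖c i‖ ^ 2 := by
  have h1 : ∀ x, ((‖∑ i ∈ A, c i * g i x‖ ^ 2 : ℝ) : ℂ) =
      ∑ i ∈ A, ∑ j ∈ A, c i * (starRingEnd ℂ) (c j) * (g i x * (starRingEnd ℂ) (g j x)) := by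
    intro x
    rw [Complex.ofReal_pow, ← Complex.mul_conj', map_sum, Finset.sum_mul_sum]
    refine Finset.sum_congr rfl fun i _ => Finset.sum_congr rfl fun j _ => ?_
    rw [map_mul]; ring
  have hI : ∀ i j, Integrable (fun x => c i * (starRingEnd ℂ) (c j) *
      (g i x * (starRingEnd ℂ) (g j x))) μ := fun i j =>
    integ_cont μ (continuous_const.mul ((hgc i).mul (Complex.continuous_conj.comp (hgc j))))
  have h2 : ((∫ x, ‖∑ i ∈ A, c i * g i x‖ ^ 2 ∂μ : ℝ) : ℂ) = ∑ i ∈ A, (‖c i‖ ^ 2 : ℂ) := by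
    rw [← integral_complex_ofReal]
    simp_rw [h1]
    rw [integral_finsetSum _ (fun i _ => integrable_finsetSum _ fun j _ => hI i j)]
    refine Finset.sum_congr rfl fun i hi => ?_
    rw [integral_finsetSum _ (fun j _ => hI i j)]
    simp_rw [integral_const_mul, ho]
    simp only [mul_ite, mul_one, mul_zero, Finset.sum_ite_eq, hi, if_true]
    rw [Complex.mul_conj']
  exact_mod_cast h2

/-- grid points -/
def gval (Q : ℕ) (a : Fin (2 * Q + 1) × Fin (2 * Q + 1)) : ℂ :=
  ((a.1 : ℕ) / (Q : ℝ) - 1 : ℝ) + ((a.2 : ℕ) / (Q : ℝ) - 1 : ℝ) * Complex.I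

lemma grid_real (Q : ℕ) (hQ : 0 < Q) (y : ℝ) (hy : |y| ≤ 1) :
    ∃ a : Fin (2 * Q + 1), |y - ((a : ℕ) / (Q : ℝ) - 1)| ≤ 1 / Q := by
  have hQR : (0:ℝ) < Q := by exact_mod_cast hQ
  rw [abs_le] at hy
  have h0 : 0 ≤ (y + 1) * Q := mul_nonneg (by linarith) hQR.le
  have h1 : ⌊(y + 1) * Q⌋₊ < 2 * Q + 1 := by
    rw [Nat.floor_lt h0]; push_cast; nlinarith
  refine ⟨⟨_, h1⟩, ?_⟩
  have h2 := Nat.floor_le h0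
  have h3 := Nat.lt_floor_add_one ((y + 1) * Q)
  have h4 : y - ((⌊(y + 1) * Q⌋₊ : ℝ) / (Q : ℝ) - 1) = ((y + 1) * Q - ⌊(y + 1) * Q⌋₊) / Q := by
    field_simp; ring
  simp only
  rw [h4, abs_of_nonneg (div_nonneg (by linarith) hQR.le)]
  exact div_le_div_of_nonneg_right (by linarith) hQR.le

lemma grid_cplx (Q : ℕ) (hQ : 0 < Q) (z : ℂ) (hz : ‖z‖ ≤ 1) :
    ∃ a, ‖z - gval Q a‖ ≤ 2 / Q := by
  obtain ⟨a, ha⟩ := grid_real Q hQ z.re ((Complex.abs_re_le_norm z).trans hz)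
  obtain ⟨b, hb⟩ := grid_real Q hQ z.im ((Complex.abs_im_le_norm z).trans hz)
  refine ⟨(a, b), (Complex.norm_le_abs_re_add_abs_im _).trans ?_⟩
  have : (2:ℝ) / Q = 1 / Q + 1 / Q := by ring
  rw [this]
  refine add_le_add ?_ ?_
  · simpa [gval] using ha
  · simpa [gval] using hb

/-- net functions -/
def hnet (Q σ : ℕ) (e : Fin σ → Fin N × (Fin (2 * Q + 1) × Fin (2 * Q + 1))) (x : X) : ℂ :=
  ∑ l, gval Q (e l).2 * g (e l).1 x

lemma hnet_exists (hN : 0 < N) (hB : 0 ≤ B) (hg : ∀ i x, ‖g i x‖ ≤ B) (Q : ℕ) (hQ : 0 < Q)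
    (c : Fin N → ℂ) (σ : ℕ) : ∀ (A : Finset (Fin N)), A.card ≤ σ → (∀ i ∈ A, ‖c i‖ ≤ 1) →
    ∃ e, ∀ x, ‖∑ i ∈ A, c i * g i x - hnet g Q σ e x‖ ≤ σ * (2 * B / Q) := by
  have hz : ∃ a, gval Q a = 0 := by
    have hQR : (Q:ℝ) ≠ 0 := by exact_mod_cast hQ.ne'
    refine ⟨(⟨Q, by omega⟩, ⟨Q, by omega⟩), ?_⟩
    simp [gval, div_self hQR]
  have hpos : 0 ≤ 2 * B / Q := by positivity
  induction σ with
  | zero =>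
    intro A hA hc
    have : A = ∅ := by simpa using hA
    subst this
    exact ⟨Fin.elim0, fun x => by simp [hnet]⟩
  | succ σ ih =>
    intro A hA hc
    rcases A.eq_empty_or_nonempty with rfl | ⟨i0, hi0⟩
    · obtain ⟨a, ha⟩ := hz
      refine ⟨fun _ => (⟨0, hN⟩, a), fun x => ?_⟩
      simp only [hnet, ha]
      simp
      positivity
    · have hcard := Finset.card_erase_of_mem hi0
      obtain ⟨e, he⟩ := ih (A.erase i0) (by omega) (fun i hi => hc i (Finset.mem_of_mem_erase hi))
      obtain ⟨a, ha⟩ := grid_cplx Q hQ (c i0) (hc i0 hi0)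
      refine ⟨Fin.cons (i0, a) e, fun x => ?_⟩
      have h1 : hnet g Q (σ + 1) (Fin.cons (i0, a) e) x = gval Q a * g i0 x + hnet g Q σ e x := by
        simp [hnet, Fin.sum_univ_succ]
      rw [h1, ← Finset.add_sum_erase A _ hi0]
      have h2 : c i0 * g i0 x + ∑ i ∈ A.erase i0, c i * g i x -
          (gval Q a * g i0 x + hnet g Q σ e x) = (c i0 - gval Q a) * g i0 x +
          (∑ i ∈ A.erase i0, c i * g i x - hnet g Q σ e x) := by ring
      rw [h2]
      refine (norm_add_le _ _).trans ?_
      rw [norm_mul]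
      have h3 : ‖c i0 - gval Q a‖ * ‖g i0 x‖ ≤ 2 / Q * B :=
        mul_le_mul ha (hg _ _) (norm_nonneg _) (by positivity)
      have h4 := he x
      push_cast
      have h5 : (2:ℝ) / Q * B = 2 * B / Q := by ring
      linarith

lemma cont_hnet (hgc : ∀ i, Continuous (g i)) (Q σ : ℕ) (e) : Continuous (hnet g Q σ e) :=
  continuous_finsetSum _ fun i _ => continuous_const.mul (hgc _)

/-- the normalized test functions -/
def psi1 (B q : ℝ) (h : X → ℂ) (x : X) : ℝ := min 1 (‖h x‖ ^ q / (4 * B ^ 2))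

lemma cont_psi1 {q : ℝ} (hq : 0 ≤ q) {h : X → ℂ} (hh : Continuous h) : Continuous (psi1 B q h) := by
  unfold psi1
  exact continuous_const.min ((hh.norm.rpow_const fun _ => Or.inr hq).div_const _)

/-- core estimate for one normalized function and one net point -/
lemma stage1_core (hB : 1 ≤ B) {q : ℝ} (hq1 : 1 ≤ q) (hq2 : q ≤ 2) {f h : X → ℂ}
    (hf : Continuous f) (hh : Continuous h) (hfB : ∀ x, ‖f x‖ ≤ B) {ρ δ n : ℝ} (hρ0 : 0 ≤ ρ)
    (hfh : ∀ x, ‖f x - h x‖ ≤ ρ) (hρ1 : ρ ≤ 1) (hρδ : 40 * ρ ≤ δ)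
    (hlow : δ ≤ ∫ x, ‖f x‖ ^ q ∂μ) {M : ℕ} (hM : 0 < M) (hMn : 60 * B ^ 2 * n ≤ M * δ)
    (x : Fin M → X)
    (hs : 0.6 * M * (∫ x, psi1 B q h x ∂μ) - n ≤ ∑ j, psi1 B q h (x j)) :
    ∫ x, ‖f x‖ ^ q ∂μ ≤ 16 * Ep q (f ∘ x) := by
  have hMR : (0:ℝ) < M := by exact_mod_cast hM
  have hρq : ρ ^ q ≤ ρ := by
    calc ρ ^ q ≤ ρ ^ (1:ℝ) := by
          rcases hρ0.eq_or_lt with h | h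
          · rw [← h, Real.zero_rpow (by linarith), Real.zero_rpow (by norm_num)]
          · exact Real.rpow_le_rpow_of_exponent_ge h hρ1 hq1
      _ = ρ := by simp
  have hhB : ∀ y, ‖h y‖ ^ q ≤ 4 * B ^ 2 := by
    intro y
    have h1 : ‖h y‖ ≤ 2 * B := by
      have := norm_sub_le (f y) (f y - h y)
      rw [sub_sub_cancel] at this
      linarith [hfB y, hfh y]
    calc ‖h y‖ ^ q ≤ (2 * B) ^ q := Real.rpow_le_rpow (norm_nonneg _) h1 (by linarith)
      _ ≤ (2 * B) ^ (2:ℝ) := Real.rpow_le_rpow_of_exponent_le (by linarith) hq2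
      _ = 4 * B ^ 2 := by rw [Real.rpow_two]; ring
  have hpsi : ∀ y, psi1 B q h y = ‖h y‖ ^ q / (4 * B ^ 2) := by
    intro y
    unfold psi1
    rw [min_eq_right]
    rw [div_le_one (by positivity)]
    exact hhB y
  simp only [hpsi, integral_div] at hs
  rw [← Finset.sum_div] at hs
  have hR : (0:ℝ) < 4 * B ^ 2 := by positivity
  have hs2 : 0.6 * M * (∫ x, ‖h x‖ ^ q ∂μ) - n * (4 * B ^ 2) ≤ ∑ j, ‖h (x j)‖ ^ q := by
    rw [le_div_iff₀ hR] at hs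
    calc _ = (0.6 * M * ((∫ x, ‖h x‖ ^ q ∂μ) / (4 * B ^ 2)) - n) * (4 * B ^ 2) := by
          field_simp
      _ ≤ _ := hs
  have hfhq : ∀ y, ‖f y - h y‖ ^ q ≤ ρ := fun y =>
    (Real.rpow_le_rpow (norm_nonneg _) (hfh y) (by linarith)).trans hρq
  have hcI : ∀ {k : X → ℂ}, Continuous k → Integrable (fun x => ‖k x‖ ^ q) μ := fun hk =>
    integ_cont μ (hk.norm.rpow_const fun _ => Or.inr (by linarith))
  have hI : ∫ x, ‖f x‖ ^ q ∂μ ≤ 2 * (∫ x, ‖h x‖ ^ q ∂μ) + 2 * ρ := by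
    have : ∫ x, ‖f x‖ ^ q ∂μ ≤ ∫ x, (2 * ‖h x‖ ^ q + 2 * ρ) ∂μ := by
      refine integral_mono (hcI hf) (((hcI hh).const_mul 2).add (integrable_const _)) fun y => ?_
      have h1 := norm_add_rpow_le hq1 hq2 (h y) (f y - h y)
      rw [add_sub_cancel] at h1
      have := hfhq y
      simp only
      linarith
    rw [integral_add ((hcI hh).const_mul 2) (integrable_const _), integral_const_mul] at this
    simpa using this
  have hS : ∑ j, ‖h (x j)‖ ^ q ≤ 2 * (∑ j, ‖f (x j)‖ ^ q) + M * (2 * ρ) := by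
    have : ∑ j, ‖h (x j)‖ ^ q ≤ ∑ j, (2 * ‖f (x j)‖ ^ q + 2 * ρ) := by
      refine Finset.sum_le_sum fun j _ => ?_
      have h1 := norm_sub_rpow_le hq1 hq2 (f (x j)) (f (x j) - h (x j))
      rw [sub_sub_cancel] at h1
      have := hfhq (x j)
      linarith
    rw [Finset.sum_add_distrib, ← Finset.mul_sum] at this
    simpa using this
  have hEp : ∑ j, ‖f (x j)‖ ^ q = M * Ep q (f ∘ x) := by
    unfold Ep; field_simp; rfl
  rw [hEp] at hS
  set If := ∫ x, ‖f x‖ ^ q ∂μ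
  set Ih := ∫ x, ‖h x‖ ^ q ∂μ
  set E := Ep q (f ∘ x)
  -- all divided by M
  have h1 : 0.6 * M * Ih ≤ 2 * (M * E) + M * (2 * ρ) + n * (4 * B ^ 2) := by linarith
  have h2 : n * (4 * B ^ 2) ≤ M * δ / 15 := by linarith
  have h3 : M * (0.6 * Ih) ≤ M * (2 * E + 2 * ρ + δ / 15) := by linarith
  have h4 := le_of_mul_le_mul_left h3 hMR
  linarith

lemma stage1_bounds (hB : 1 ≤ B) (hgc : ∀ i, Continuous (g i)) (hg : ∀ i x, ‖g i x‖ ≤ B)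
    (ho : ∀ i j, ∫ x, g i x * (starRingEnd ℂ) (g j x) ∂μ = if i = j then 1 else 0)
    {σ : ℕ} (hσ : 0 < σ) (A : Finset (Fin N)) (hA : A.card ≤ σ) (c : Fin N → ℂ)
    (hc : ∑ i ∈ A, ‖c i‖ = 1) :
    (∀ x, ‖∑ i ∈ A, c i * g i x‖ ≤ B) ∧ ∀ q : ℝ, 1 ≤ q → q ≤ 2 →
      1 / (σ * B) ≤ ∫ x, ‖∑ i ∈ A, c i * g i x‖ ^ q ∂μ := by
  have hsup : ∀ x, ‖∑ i ∈ A, c i * g i x‖ ≤ B := by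
    intro x
    calc ‖∑ i ∈ A, c i * g i x‖ ≤ ∑ i ∈ A, ‖c i * g i x‖ := norm_sum_le _ _
      _ ≤ ∑ i ∈ A, ‖c i‖ * B := Finset.sum_le_sum fun i _ => by
          rw [norm_mul]; exact mul_le_mul_of_nonneg_left (hg _ _) (norm_nonneg _)
      _ = B := by rw [← Finset.sum_mul, hc, one_mul]
  refine ⟨hsup, fun q hq1 hq2 => ?_⟩
  have hσR : (0:ℝ) < σ := by exact_mod_cast hσ
  have h1 : (1:ℝ) ≤ σ * ∑ i ∈ A, ‖c i‖ ^ 2 := by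
    have := sq_sum_le_card_mul_sum_sq (s := A) (f := fun i => ‖c i‖)
    rw [hc] at this
    have h3 : (0:ℝ) ≤ ∑ i ∈ A, ‖c i‖ ^ 2 := Finset.sum_nonneg fun i _ => by positivity
    have h4 : (A.card : ℝ) ≤ σ := by exact_mod_cast hA
    nlinarith [mul_le_mul_of_nonneg_right h4 h3]
  rw [← orth_sum μ g hgc ho A c] at h1
  have hcf := cont_sum g hgc A c
  have h2 : ∫ x, ‖∑ i ∈ A, c i * g i x‖ ^ 2 ∂μ ≤ B * ∫ x, ‖∑ i ∈ A, c i * g i x‖ ^ q ∂μ := by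
    rw [← integral_const_mul]
    refine integral_mono (integ_cont μ (hcf.norm.pow 2))
      ((integ_cont μ (hcf.norm.rpow_const fun _ => Or.inr (by linarith))).const_mul _) fun x => ?_
    have h3 := sq_le_interp hq1 hq2 (norm_nonneg _) (hsup x)
    rw [Real.rpow_two] at h3
    refine h3.trans ?_
    apply mul_le_mul_of_nonneg_right _ (by positivity)
    calc B ^ (2 - q) ≤ B ^ (1:ℝ) := Real.rpow_le_rpow_of_exponent_le hB (by linarith)
      _ = B := by simp
  rw [div_le_iff₀ (by positivity)]
  calc (1:ℝ) ≤ _ := h1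
    _ ≤ σ * (B * ∫ x, ‖∑ i ∈ A, c i * g i x‖ ^ q ∂μ) := mul_le_mul_of_nonneg_left h2 hσR.le
    _ = _ := by ring

lemma stage1 (hB : 1 ≤ B) (hgc : ∀ i, Continuous (g i)) (hg : ∀ i x, ‖g i x‖ ≤ B)
    (ho : ∀ i j, ∫ x, g i x * (starRingEnd ℂ) (g j x) ∂μ = if i = j then 1 else 0)
    {σ : ℕ} (hσ : 0 < σ) (hN : 0 < N) {p : ℝ} (hp1 : 1 ≤ p) (hp2 : p ≤ 2) (Q M : ℕ) (hQ : 0 < Q)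
    (hQB : 80 * B ^ 2 * σ ^ 2 ≤ Q) (hM : 0 < M)
    (hMn : 60 * B ^ 3 * σ * (Real.log 2 + σ * (Real.log N + 2 * Real.log (2 * Q + 1))) ≤ M) :
    ∃ x : Fin M → X, ∀ f ∈ SigmaSet g σ,
      ∫ y, ‖f y‖ ^ p ∂μ ≤ 16 * Ep p (f ∘ x) ∧
      ∫ y, ‖f y‖ ^ (2:ℝ) ∂μ ≤ 16 * Ep 2 (f ∘ x) := by
  have hσR : (0:ℝ) < σ := by exact_mod_cast hσ
  have hσ1 : (1:ℝ) ≤ σ := by exact_mod_cast hσ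
  have hNR : (0:ℝ) < N := by exact_mod_cast hN
  have hMR : (0:ℝ) < M := by exact_mod_cast hM
  have hQR : (0:ℝ) < Q := by exact_mod_cast hQ
  set E := Fin σ → Fin N × (Fin (2 * Q + 1) × Fin (2 * Q + 1)) with hE
  set qq : Bool → ℝ := fun b => if b then p else 2 with hqq
  have hqq1 : ∀ b, 1 ≤ qq b := by intro b; simp only [hqq]; split_ifs <;> linarith
  have hqq2 : ∀ b, qq b ≤ 2 := by intro b; simp only [hqq]; split_ifs <;> linarith
  set n := Real.log 2 + σ * (Real.log N + 2 * Real.log (2 * Q + 1)) with hn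
  have hcard : Real.log (Fintype.card (Bool × E)) = n := by
    have : Fintype.card (Bool × E) = 2 * (N * ((2 * Q + 1) * (2 * Q + 1))) ^ σ := by
      simp [hE]
    rw [this]
    push_cast
    rw [Real.log_mul (by norm_num) (by positivity), Real.log_pow, Real.log_mul (by positivity) (by positivity),
      Real.log_mul (by positivity) (by positivity)]
    rw [hn]; ring
  have hcpos : (0:ℝ) < Fintype.card (Bool × E) := by
    have : Nonempty E := ⟨fun _ => (⟨0, hN⟩, (⟨0, by omega⟩, ⟨0, by omega⟩))⟩
    exact_mod_cast Fintype.card_pos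
  have hpc : ∀ a : Bool × E, Continuous (psi1 B (qq a.1) (hnet g Q σ a.2)) := fun a =>
    cont_psi1 B (by linarith [hqq1 a.1]) (cont_hnet g hgc Q σ a.2)
  obtain ⟨x, hx⟩ := sampling (fun a : Bool × E => psi1 B (qq a.1) (hnet g Q σ a.2))
    (fun a y => le_min zero_le_one (by positivity)) (fun a y => min_le_left _ _)
    (fun a => ∫ y, psi1 B (qq a.1) (hnet g Q σ a.2) y ∂μ)
    (by
      intro ω hω
      have hi : Integrable (fun y => ∑ a, ω a * psi1 B (qq a.1) (hnet g Q σ a.2) y) μ :=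
        integrable_finsetSum _ fun a _ => (integ_cont μ (hpc a)).const_mul _
      obtain ⟨y, hy⟩ := exists_integral_le hi
      refine ⟨y, ?_⟩
      rw [integral_finsetSum _ fun a _ => (integ_cont μ (hpc a)).const_mul _] at hy
      simpa only [integral_const_mul] using hy)
    (fun _ => (Fintype.card (Bool × E) : ℝ)⁻¹) (fun _ => by positivity)
    (by rw [Finset.sum_const, nsmul_eq_mul, Finset.card_univ, mul_inv_cancel₀ hcpos.ne']) M
  refine ⟨x, ?_⟩
  have key : ∀ f ∈ SigmaSet g σ, ∀ b, ∫ y, ‖f y‖ ^ (qq b) ∂μ ≤ 16 * Ep (qq b) (f ∘ x) := by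
    rintro f ⟨A, c, hA, rfl⟩ b
    have hq0 : 0 < qq b := by linarith [hqq1 b]
    rcases (Finset.sum_nonneg fun i (_ : i ∈ A) => norm_nonneg (c i)).eq_or_lt with hW | hW
    · have : (fun y => ∑ i ∈ A, c i * g i y) = 0 := by
        funext y
        refine Finset.sum_eq_zero fun i hi => ?_
        have := (Finset.sum_eq_zero_iff_of_nonneg fun i _ => norm_nonneg (c i)).1 hW.symm i hi
        rw [norm_eq_zero.1 this, zero_mul]
      have h2 : ∀ y, ∑ i ∈ A, c i * g i y = 0 := fun y => congrFun this y
      simp only [h2]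
      simp [Real.zero_rpow hq0.ne']
      exact Ep_nonneg _ _
    set W := ∑ i ∈ A, ‖c i‖ with hWdef
    set c' : Fin N → ℂ := fun i => c i / (W:ℂ) with hc'
    have hWC : (W:ℂ) ≠ 0 := by exact_mod_cast hW.ne'
    have hc1 : ∑ i ∈ A, ‖c' i‖ = 1 := by
      simp only [hc', norm_div, Complex.norm_real, Real.norm_eq_abs, abs_of_pos hW]
      rw [← Finset.sum_div, ← hWdef, div_self hW.ne']
    have hfs : ∀ y, ∑ i ∈ A, c i * g i y = W * ∑ i ∈ A, c' i * g i y := by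
      intro y
      rw [Finset.mul_sum]
      refine Finset.sum_congr rfl fun i _ => ?_
      simp only [hc']; field_simp
    have hle : ∀ i ∈ A, ‖c' i‖ ≤ 1 := fun i hi =>
      (Finset.single_le_sum (fun i _ => norm_nonneg (c' i)) hi).trans hc1.le
    obtain ⟨e, he⟩ := hnet_exists g B hN (by linarith) hg Q hQ c' σ A hA hle
    obtain ⟨hsup, hlow⟩ := stage1_bounds μ g B hB hgc hg ho hσ A hA c' hc1
    have hBp : 0 < B := by linarith
    have hrho : 40 * (σ * (2 * B / Q)) ≤ 1 / (σ * B) := by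
      rw [le_div_iff₀ (by positivity)]
      have : 40 * (σ * (2 * B / Q)) * (σ * B) = (80 * B ^ 2 * σ ^ 2) / Q := by field_simp; ring
      rw [this, div_le_one hQR]
      exact hQB
    have hd1 : 1 / (σ * B) ≤ 1 := by
      rw [div_le_one (by positivity)]; nlinarith
    have hs := hx (b, e)
    simp only [Real.log_inv, hcard] at hs
    have := stage1_core μ B hB (hqq1 b) (hqq2 b) (cont_sum g hgc A c') (cont_hnet g hgc Q σ e) hsup
      (ρ := σ * (2 * B / Q)) (δ := 1 / (σ * B)) (n := n) (by positivity) he (by linarith) hrho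
      (hlow _ (hqq1 b) (hqq2 b)) hM (by
        rw [mul_one_div, le_div_iff₀ (by positivity)]
        calc _ = 60 * B ^ 3 * σ * n := by ring
          _ ≤ M := hMn) x (by linarith)
    have hnW : ∀ z : ℂ, ‖(W:ℂ) * z‖ ^ (qq b) = W ^ (qq b) * ‖z‖ ^ (qq b) := by
      intro z
      rw [norm_mul, Complex.norm_real, Real.norm_eq_abs, abs_of_pos hW,
        Real.mul_rpow hW.le (norm_nonneg _)]
    have e1 : Ep (qq b) ((fun y => ∑ i ∈ A, c i * g i y) ∘ x) = W ^ (qq b) *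
        Ep (qq b) ((fun y => ∑ i ∈ A, c' i * g i y) ∘ x) := by
      unfold Ep
      simp only [Function.comp, hfs, hnW, ← Finset.mul_sum]
      ring
    rw [e1]
    simp only [hfs, hnW, integral_const_mul]
    have hWp : 0 ≤ W ^ (qq b) := by positivity
    nlinarith [mul_le_mul_of_nonneg_left this hWp]
  intro f hf
  exact ⟨by simpa [hqq] using key f hf true, by simpa [hqq] using key f hf false⟩

end stage1

end WCGAProof
namespace WCGAProof

section disc
variable {X : Type*} [TopologicalSpace X] [CompactSpace X] [T2Space X] [MeasurableSpace X] [BorelSpace X]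
  (μ : Measure X) [IsProbabilityMeasure μ] {N : ℕ} (g : Fin N → X → ℂ) (B : ℝ)

lemma disc_combine (hB : 1 ≤ B) (hgc : ∀ i, Continuous (g i)) (hg : ∀ i x, ‖g i x‖ ≤ B)
    (ho : ∀ i j, ∫ x, g i x * (starRingEnd ℂ) (g j x) ∂μ = if i = j then 1 else 0)
    {s : ℕ} (hs : 0 < s) (hN : 0 < N) {p : ℝ} (hp1 : 1 ≤ p) (hp2 : p ≤ 2) (Q M L m : ℕ) (hQ : 0 < Q)
    (hQB : 80 * B ^ 2 * (2 * s) ^ 2 ≤ Q) (hM : 0 < M)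
    (hMn : 60 * B ^ 3 * (2 * s) * (Real.log 2 + (2 * s) * (Real.log N + 2 * Real.log (2 * Q + 1))) ≤ M)
    (hL : 8 * (32 * s * B ^ 2) ≤ 2 ^ L)
    (hm : 2000 * (16385 * Real.log (4 * M) * Real.log (4 * N + 1)) * (32 * s * B ^ 2) *
      (L + 1) ≤ m) :
    ∃ ξ : Fin m → X, ∀ f ∈ SigmaSet g s, ∫ y, ‖f y‖ ^ p ∂μ ≤ 4800 * Ep p (f ∘ ξ) := by
  have hs1 : (1:ℝ) ≤ s := by exact_mod_cast hs
  obtain ⟨x, hx⟩ := stage1 μ g B hB hgc hg ho (σ := 2 * s) (by omega) hN hp1 hp2 Q M hQ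
    (by push_cast; exact hQB) hM (by push_cast; exact hMn)
  have hS : Stab (fun i y => g i (x y)) 16 (2 * s) := by
    intro A c hA
    have h1 := (hx (fun y => ∑ i ∈ A, c i * g i y) ⟨A, c, hA, rfl⟩).2
    simp only [Real.rpow_two] at h1
    rw [orth_sum μ g hgc ho A c] at h1
    exact h1
  have e32 : (2:ℝ) * s * 16 * B ^ 2 = 32 * s * B ^ 2 := by ring
  obtain ⟨ξ, hξ⟩ := stage2 (fun i y => g i (x y)) B 16 p hp1 hp2 (by linarith)
    (fun i y => hg i (x y)) (by norm_num) hs hS hM hN (by rw [e32]; nlinarith) L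
    (by rw [e32]; exact hL) m (by rw [e32]; exact hm)
  refine ⟨x ∘ ξ, fun f hf => ?_⟩
  have h1 := (hx f (sigma_mono g (by omega) hf)).1
  have h2 := hξ (f ∘ x) (by
    obtain ⟨A, c, hA, rfl⟩ := hf
    exact ⟨A, c, hA, rfl⟩)
  have h3 : (f ∘ x) ∘ ξ = f ∘ (x ∘ ξ) := rfl
  rw [h3] at h2
  linarith

/-- constant in the bound on the number of points -/
def CM (B : ℝ) : ℝ := Real.log (10 ^ 9 * B ^ 5)
def CL (B : ℝ) : ℝ := 2 * Real.log (512 * B ^ 2) + 4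
def Cpt (B : ℝ) : ℝ := 2 * (2000 * 16385 * (2 * CM B + 6) * 4 * 64 * B ^ 2 * CL B)

set_option maxHeartbeats 2000000 in
lemma disc_num (hB : 1 ≤ B) (u s : ℕ) (hu : 2 ≤ u) (huN : u ≤ N) (hs : 0 < s) (hsu : s ≤ 2 * u) :
    ∃ Q M L m : ℕ, 0 < Q ∧ 80 * B ^ 2 * (2 * s) ^ 2 ≤ Q ∧ 0 < M ∧
      60 * B ^ 3 * (2 * s) * (Real.log 2 + (2 * s) * (Real.log N + 2 * Real.log (2 * Q + 1))) ≤ M ∧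
      8 * (32 * s * B ^ 2) ≤ 2 ^ L ∧
      2000 * (16385 * Real.log (4 * M) * Real.log (4 * N + 1)) * (32 * s * B ^ 2) * (L + 1) ≤ m ∧
      (m:ℝ) ≤ Cpt B * u * Real.log N * (Real.log (2 * u)) ^ 2 *
        (Real.log (2 * u) + Real.log (Real.log N)) := by
  have huR : (2:ℝ) ≤ u := by exact_mod_cast hu
  have huNR : (u:ℝ) ≤ N := by exact_mod_cast huN
  have hs1 : (1:ℝ) ≤ s := by exact_mod_cast hs
  have hsuR : (s:ℝ) ≤ 2 * u := by exact_mod_cast hsu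
  have hl2 := Real.log_two_gt_d9
  have hl2' := Real.log_two_lt_d9
  have hNR : (2:ℝ) ≤ N := by linarith
  have hlam : Real.log 2 ≤ Real.log N := Real.log_le_log (by norm_num) hNR
  set lam := Real.log N with hlamdef
  have hlampos : 0 < lam := by linarith
  set ℓ := Real.log (2 * u) with hℓ
  have hℓ1 : 1.386 ≤ ℓ := by
    have : Real.log 4 ≤ ℓ := Real.log_le_log (by norm_num) (by linarith)
    have h4 : Real.log 4 = 2 * Real.log 2 := by
      rw [show (4:ℝ) = 2 ^ 2 by norm_num, Real.log_pow]; norm_num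
    linarith
  have hll : -0.45 ≤ Real.log lam := by
    have h1 := Real.one_sub_inv_le_log_of_pos hlampos
    have h2 : lam⁻¹ ≤ 1.45 := by
      rw [inv_le_comm₀ hlampos (by norm_num)]
      refine le_trans ?_ (le_trans hl2.le hlam)
      norm_num
    linarith
  set S := ℓ + Real.log lam with hS
  have hS1 : 0.9 ≤ S := by linarith
  set Q := ⌈80 * B ^ 2 * (2 * (s:ℝ)) ^ 2⌉₊ with hQ
  have hQ0 : 0 < Q := Nat.ceil_pos.2 (by positivity)
  have hQ1 : (Q:ℝ) ≤ 1281 * B ^ 2 * u ^ 2 := by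
    have h1 := (Nat.ceil_lt_add_one (a := 80 * B ^ 2 * (2 * (s:ℝ)) ^ 2) (by positivity)).le
    have h2 : 80 * B ^ 2 * (2 * (s:ℝ)) ^ 2 ≤ 80 * B ^ 2 * (2 * (2 * u)) ^ 2 := by
      gcongr
    have h3 : 1 ≤ B ^ 2 * (u:ℝ) ^ 2 := by
      have := one_le_pow₀ hB (n := 2)
      have := one_le_pow₀ (show (1:ℝ) ≤ u by linarith) (n := 2)
      nlinarith
    nlinarith
  have hlogQ : Real.log (2 * Q + 1) ≤ 2562 * B ^ 2 * u ^ 2 := by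
    have := Real.log_le_sub_one_of_pos (show (0:ℝ) < 2 * Q + 1 by positivity)
    linarith
  have hlogQ0 : 0 ≤ Real.log (2 * Q + 1) := Real.log_nonneg (by
    have : (0:ℝ) ≤ Q := by positivity
    linarith)
  set bM := 60 * B ^ 3 * (2 * s) * (Real.log 2 + (2 * s) * (lam + 2 * Real.log (2 * Q + 1))) with hbM
  have hbM0 : 0 < bM := by positivity
  set M := ⌈bM⌉₊ with hM
  have hM0 : 0 < M := Nat.ceil_pos.2 hbM0
  have hB2 := one_le_pow₀ hB (n := 2)
  have hu1 : (1:ℝ) ≤ u := by linarith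
  have hM1 : 4 * (M:ℝ) ≤ 10 ^ 9 * B ^ 5 * (u ^ 4 * lam) := by
    have h1 := (Nat.ceil_lt_add_one hbM0.le).le
    have h2 : bM ≤ 60 * B ^ 3 * (2 * (2 * u)) * (lam + (2 * (2 * u)) * (lam + 2 * (2562 * B ^ 2 * u ^ 2))) := by
      rw [hbM]; gcongr
    rw [show (2:ℝ) * (2 * u) = 4 * u by ring] at h2
    have h3 : (1:ℝ) ≤ 1.5 * lam := by linarith
    have h4 : lam + (4 * u) * (lam + 2 * (2562 * B ^ 2 * u ^ 2)) ≤ B ^ 2 * u ^ 3 * lam * 40000 := by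
      have a1 : lam ≤ B ^ 2 * u ^ 3 * lam := by
        have : (1:ℝ) ≤ B ^ 2 * u ^ 3 := one_le_mul_of_one_le_of_one_le hB2 (one_le_pow₀ hu1)
        nlinarith
      have a2 : u * lam ≤ B ^ 2 * u ^ 3 * lam := by
        have : (u:ℝ) ≤ B ^ 2 * u ^ 3 := by
          have h5 : (1:ℝ) ≤ B ^ 2 * u ^ 2 := one_le_mul_of_one_le_of_one_le hB2 (one_le_pow₀ hu1)
          nlinarith
        nlinarith
      have a3 : B ^ 2 * u ^ 3 ≤ B ^ 2 * u ^ 3 * (1.5 * lam) := by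
        have : 0 ≤ B ^ 2 * (u:ℝ) ^ 3 := by positivity
        nlinarith
      have a4 : lam + (4 * u) * (lam + 2 * (2562 * B ^ 2 * u ^ 2)) =
          lam + 4 * (u * lam) + 20496 * (B ^ 2 * u ^ 3) := by ring
      rw [a4]
      linarith
    have h5 : bM ≤ 60 * B ^ 3 * (4 * u) * (B ^ 2 * u ^ 3 * lam * 40000) := by
      refine h2.trans ?_
      gcongr
    have h6 : 60 * B ^ 3 * (4 * u) * (B ^ 2 * u ^ 3 * lam * 40000) = 9600000 * (B ^ 5 * (u ^ 4 * lam)) := by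
      ring
    have h7 : (1:ℝ) ≤ 1.5 * (B ^ 5 * (u ^ 4 * lam)) := by
      have : (1:ℝ) ≤ B ^ 5 * u ^ 4 := one_le_mul_of_one_le_of_one_le (one_le_pow₀ hB) (one_le_pow₀ hu1)
      nlinarith
    have h8 : 10 ^ 9 * B ^ 5 * (u ^ 4 * lam) = 10 ^ 9 * (B ^ 5 * (u ^ 4 * lam)) := by ring
    rw [h8]
    linarith
  have hCM0 : 0 ≤ CM B := Real.log_nonneg (by have := one_le_pow₀ hB (n := 5); linarith)
  have hlogM : Real.log (4 * M) ≤ (2 * CM B + 6) * S := by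
    have hMR : (0:ℝ) < M := by exact_mod_cast hM0
    have h1 := Real.log_le_log (by positivity) hM1
    rw [Real.log_mul (x := 10 ^ 9 * B ^ 5) (by positivity) (by positivity),
      Real.log_mul (x := (u:ℝ) ^ 4) (by positivity) (by positivity), Real.log_pow] at h1
    have h2 : Real.log u ≤ ℓ := Real.log_le_log (by linarith) (by linarith)
    have h3 : Real.log (4 * M) ≤ CM B + (4 * ℓ + Real.log lam) := by
      unfold CM; push_cast at h1; linarith
    have h4 : CM B ≤ 2 * CM B * S := by nlinarith
    linarith
  have hlogN : Real.log (4 * N + 1) ≤ 4 * lam := by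
    rw [hlamdef, show (4:ℝ) * Real.log N = Real.log ((N:ℝ) ^ 4) by rw [Real.log_pow]; norm_num]
    apply Real.log_le_log (by positivity)
    have : (4:ℝ) ≤ N ^ 2 := by nlinarith
    nlinarith
  have hlogN0 : 0 ≤ Real.log (4 * N + 1) := Real.log_nonneg (by linarith)
  have hlogM1 := one_le_log_four_mul (M := M) hM0
  set P := 32 * (s:ℝ) * B ^ 2 with hP
  have hP1 : 32 ≤ P := by rw [hP]; nlinarith
  have hP2 : P ≤ 64 * u * B ^ 2 := by rw [hP]; nlinarith
  set L := ⌈Real.log (8 * P) / Real.log 2⌉₊ with hL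
  have hlP0 : 0 ≤ Real.log (8 * P) := Real.log_nonneg (by linarith)
  have hL1 : 8 * P ≤ 2 ^ L := by
    have h1 := Nat.le_ceil (Real.log (8 * P) / Real.log 2)
    rw [div_le_iff₀ (by linarith), ← Real.log_pow] at h1
    exact (Real.log_le_log_iff (by positivity) (by positivity)).1 h1
  have hL2 : (L:ℝ) + 1 ≤ CL B * ℓ := by
    have h1 := (Nat.ceil_lt_add_one (a := Real.log (8 * P) / Real.log 2) (by positivity)).le
    have h2 : Real.log (8 * P) / Real.log 2 ≤ 2 * Real.log (8 * P) := by
      rw [div_le_iff₀ (by linarith)]; nlinarith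
    have h3 : Real.log (8 * P) ≤ Real.log (512 * B ^ 2) + ℓ := by
      rw [hℓ, ← Real.log_mul (by positivity) (by positivity)]
      apply Real.log_le_log (by positivity)
      have : 0 ≤ B ^ 2 * (u:ℝ) := by positivity
      nlinarith
    have h4 : 0 ≤ Real.log (512 * B ^ 2) := Real.log_nonneg (by linarith)
    unfold CL
    have : (L:ℝ) ≤ Real.log (8 * P) / Real.log 2 + 1 := h1
    nlinarith
  set bm := 2000 * (16385 * Real.log (4 * M) * Real.log (4 * N + 1)) * P * (L + 1) with hbm
  refine ⟨Q, M, L, ⌈bm⌉₊, hQ0, Nat.le_ceil _, hM0, Nat.le_ceil _, hL1, Nat.le_ceil _, ?_⟩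
  have hbm1 : 1 ≤ bm := by
    have a1 : 1 ≤ Real.log (4 * N + 1) := by
      rw [Real.le_log_iff_exp_le (by positivity)]
      have := Real.exp_one_lt_d9
      linarith
    have a2 : (1:ℝ) ≤ L + 1 := by linarith [show (0:ℝ) ≤ L by positivity]
    rw [hbm]
    refine one_le_mul_of_one_le_of_one_le (one_le_mul_of_one_le_of_one_le ?_ (by linarith)) a2
    have := one_le_mul_of_one_le_of_one_le hlogM1 a1
    linarith
  have hbm2 : bm ≤ 2000 * (16385 * ((2 * CM B + 6) * S) * (4 * lam)) * (64 * u * B ^ 2) * (CL B * ℓ) := by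
    rw [hbm]; gcongr
  have hceil := (Nat.ceil_lt_add_one (show 0 ≤ bm by linarith)).le
  have hCL0 : 0 ≤ CL B := by
    unfold CL
    have : 0 ≤ Real.log (512 * B ^ 2) := Real.log_nonneg (by linarith)
    linarith
  have hfin : Cpt B * u * lam * ℓ ^ 2 * S =
      2 * (2000 * (16385 * ((2 * CM B + 6) * S) * (4 * lam)) * (64 * u * B ^ 2) * (CL B * ℓ)) * ℓ := by
    unfold Cpt; ring
  rw [hfin]
  have hX : 0 ≤ 2 * (2000 * (16385 * ((2 * CM B + 6) * S) * (4 * lam)) * (64 * u * B ^ 2) * (CL B * ℓ)) := by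
    linarith
  nlinarith

end disc
end WCGAProof
namespace WCGAProof

section incoh
variable {X : Type*} [TopologicalSpace X] [CompactSpace X] [T2Space X] [MeasurableSpace X] [BorelSpace X]
  (μ : Measure X) [IsProbabilityMeasure μ] {N : ℕ} (g : Fin N → X → ℂ) (B : ℝ)

lemma orth_pair (hgc : ∀ i, Continuous (g i))
    (ho : ∀ i j, ∫ x, g i x * (starRingEnd ℂ) (g j x) ∂μ = if i = j then 1 else 0)
    (A A' : Finset (Fin N)) (hAA : A ⊆ A') (c d : Fin N → ℂ) :
    ∫ x, (∑ i ∈ A', c i * g i x) * (starRingEnd ℂ) (∑ j ∈ A, d j * g j x) ∂μ =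
      ∑ j ∈ A, c j * (starRingEnd ℂ) (d j) := by
  have h1 : ∀ x, (∑ i ∈ A', c i * g i x) * (starRingEnd ℂ) (∑ j ∈ A, d j * g j x) =
      ∑ j ∈ A, ∑ i ∈ A', c i * (starRingEnd ℂ) (d j) * (g i x * (starRingEnd ℂ) (g j x)) := by
    intro x
    rw [map_sum, Finset.sum_mul_sum, Finset.sum_comm]
    refine Finset.sum_congr rfl fun i _ => Finset.sum_congr rfl fun j _ => ?_
    rw [map_mul]; ring
  have hI : ∀ i j, Integrable (fun x => c i * (starRingEnd ℂ) (d j) *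
      (g i x * (starRingEnd ℂ) (g j x))) μ := fun i j =>
    integ_cont μ (continuous_const.mul ((hgc i).mul (Complex.continuous_conj.comp (hgc j))))
  simp_rw [h1]
  rw [integral_finsetSum _ (fun j _ => integrable_finsetSum _ fun i _ => hI i j)]
  refine Finset.sum_congr rfl fun j hj => ?_
  rw [integral_finsetSum _ (fun i _ => hI i j)]
  simp_rw [integral_const_mul, ho]
  simp only [mul_ite, mul_one, mul_zero, Finset.sum_ite_eq', hAA hj, if_true]

lemma incoh (hB : 1 ≤ B) (hgc : ∀ i, Continuous (g i)) (hg : ∀ i x, ‖g i x‖ ≤ B)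
    (ho : ∀ i j, ∫ x, g i x * (starRingEnd ℂ) (g j x) ∂μ = if i = j then 1 else 0)
    {p : ℝ} (hp1 : 1 < p) (hp2 : p ≤ 2)
    (A A' : Finset (Fin N)) (hAA : A ⊆ A') (c : Fin N → ℂ) :
    ∑ i ∈ A, ‖c i‖ ≤ B * (A.card : ℝ) ^ (1 / p) *
      (∫ x, ‖∑ i ∈ A', c i * g i x‖ ^ p ∂μ) ^ (1 / p) := by
  rcases A.eq_empty_or_nonempty with rfl | hne
  · simp; positivity
  have ha : (0:ℝ) < A.card := by exact_mod_cast hne.card_pos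
  have ha1 : (1:ℝ) ≤ A.card := by exact_mod_cast hne.card_pos
  set a : ℝ := (A.card : ℝ) with hadef
  set d : Fin N → ℂ := fun i => c i / (‖c i‖ : ℂ) with hd
  have hd1 : ∀ i, ‖d i‖ ≤ 1 := by
    intro i
    simp only [hd, norm_div, Complex.norm_real, norm_norm]
    exact div_self_le_one _
  have hcd : ∀ i, c i * (starRingEnd ℂ) (d i) = (‖c i‖ : ℂ) := by
    intro i
    simp only [hd, map_div₀, Complex.conj_ofReal]
    by_cases h : c i = 0
    · simp [h]
    · have : (‖c i‖ : ℂ) ≠ 0 := by exact_mod_cast norm_ne_zero_iff.2 h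
      rw [← mul_div_assoc, Complex.mul_conj', sq, mul_div_assoc, div_self this, mul_one]
  set q := p / (p - 1) with hq
  have hpq : p.HolderConjugate q := Real.HolderConjugate.conjExponent hp1
  have hq2 : 2 ≤ q := by
    rw [hq, le_div_iff₀ (by linarith)]; linarith
  set f : X → ℂ := fun x => ∑ i ∈ A', c i * g i x with hf
  set D : X → ℂ := fun x => ∑ j ∈ A, d j * g j x with hD
  have hfc : Continuous f := cont_sum g hgc A' c
  have hDc : Continuous D := cont_sum g hgc A d
  have h1 := orth_pair μ g hgc ho A A' hAA c d
  simp only [hcd] at h1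
  have h2 : ∑ i ∈ A, ‖c i‖ ≤ ∫ x, ‖f x‖ * ‖D x‖ ∂μ := by
    have h3 := norm_integral_le_integral_norm (μ := μ) (fun x => f x * (starRingEnd ℂ) (D x))
    have h4 : ∫ x, f x * (starRingEnd ℂ) (D x) ∂μ = ((∑ i ∈ A, ‖c i‖ : ℝ) : ℂ) := by
      rw [h1]; push_cast; rfl
    rw [h4, Complex.norm_real, Real.norm_eq_abs] at h3
    simp only [norm_mul, RCLike.norm_conj] at h3
    exact (le_abs_self _).trans h3
  have hmem : ∀ {k : X → ℂ}, Continuous k → ∀ r : ℝ≥0∞, MemLp (fun x => ‖k x‖) r μ := by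
    intro k hk r
    obtain ⟨C, hC⟩ := (isCompact_range hk.norm).bddAbove
    refine MemLp.of_bound (hk.norm.aestronglyMeasurable) C (Filter.Eventually.of_forall fun x => ?_)
    rw [norm_norm]
    exact hC ⟨x, rfl⟩
  have h3 := integral_mul_le_Lp_mul_Lq_of_nonneg (μ := μ) hpq
    (Filter.Eventually.of_forall fun x => norm_nonneg (f x))
    (Filter.Eventually.of_forall fun x => norm_nonneg (D x)) (hmem hfc _) (hmem hDc _)
  have hDsup : ∀ x, ‖D x‖ ≤ B * a := by
    intro x
    calc ‖D x‖ ≤ ∑ j ∈ A, ‖d j * g j x‖ := norm_sum_le _ _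
      _ ≤ ∑ j ∈ A, B := Finset.sum_le_sum fun j _ => by
          rw [norm_mul]
          nlinarith [hd1 j, hg j x, norm_nonneg (d j), norm_nonneg (g j x)]
      _ = B * a := by rw [Finset.sum_const, nsmul_eq_mul, mul_comm]
  have hD2 : ∫ x, ‖D x‖ ^ 2 ∂μ ≤ a := by
    rw [orth_sum μ g hgc ho A d]
    calc _ ≤ ∑ j ∈ A, (1:ℝ) := Finset.sum_le_sum fun j _ => by
          nlinarith [hd1 j, norm_nonneg (d j)]
      _ = a := by simp [hadef]
  have hDq : ∫ x, ‖D x‖ ^ q ∂μ ≤ (B * a) ^ (q - 2) * a := by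
    calc _ ≤ ∫ x, (B * a) ^ (q - 2) * ‖D x‖ ^ 2 ∂μ := by
          refine integral_mono (integ_cont μ (hDc.norm.rpow_const fun _ => Or.inr (by linarith)))
            ((integ_cont μ (hDc.norm.pow 2)).const_mul _) fun x => ?_
          have : ‖D x‖ ^ q = ‖D x‖ ^ (q - 2) * ‖D x‖ ^ 2 := by
            rw [← Real.rpow_two, ← Real.rpow_add_of_nonneg (norm_nonneg _) (by linarith) (by norm_num)]
            congr 1; ring
          simp only
          rw [this]
          exact mul_le_mul_of_nonneg_right
            (Real.rpow_le_rpow (norm_nonneg _) (hDsup x) (by linarith)) (by positivity)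
      _ = (B * a) ^ (q - 2) * ∫ x, ‖D x‖ ^ 2 ∂μ := integral_const_mul _ _
      _ ≤ _ := mul_le_mul_of_nonneg_left hD2 (by positivity)
  have hB0 : 0 < B := by linarith
  have hDq2 : (∫ x, ‖D x‖ ^ q ∂μ) ^ (1 / q) ≤ B * a ^ (1 / p) := by
    have hq0 : 0 < q := by linarith
    have e1 : (B * a) ^ (q - 2) * a ≤ (B * a ^ (1 / p)) ^ q := by
      rw [Real.mul_rpow hB0.le ha.le, Real.mul_rpow hB0.le (by positivity), ← Real.rpow_mul ha.le,
        mul_assoc]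
      have e2 : a ^ (q - 2) * a = a ^ (1 / p * q) := by
        have : 1 / p * q = (q - 2) + 1 := by
          have hp0 : p - 1 ≠ 0 := by linarith
          have hp0' : p ≠ 0 := by linarith
          rw [hq]; field_simp; ring
        rw [this, Real.rpow_add_one ha.ne']
      rw [e2]
      exact mul_le_mul_of_nonneg_right
        (Real.rpow_le_rpow_of_exponent_le hB (by linarith)) (by positivity)
    calc _ ≤ ((B * a ^ (1 / p)) ^ q) ^ (1 / q) :=
          Real.rpow_le_rpow (integral_nonneg fun x => by positivity) (hDq.trans e1) (by positivity)
      _ = _ := by rw [← Real.rpow_mul (by positivity), mul_one_div_cancel hq0.ne', Real.rpow_one]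
  calc _ ≤ _ := h2.trans h3
    _ ≤ (∫ x, ‖f x‖ ^ p ∂μ) ^ (1 / p) * (B * a ^ (1 / p)) :=
        mul_le_mul_of_nonneg_left hDq2 (Real.rpow_nonneg (integral_nonneg fun x => by positivity) _)
    _ = _ := by ring

lemma dNorm_eq {Y : Type*} {m : ℕ} (ξ : Fin m → Y) (p : ℝ) (f : Y → ℂ) :
    dNorm ξ p f = (Ep p (f ∘ ξ)) ^ (1 / p) := rfl

lemma incoh_d (hB : 1 ≤ B) (hgc : ∀ i, Continuous (g i)) (hg : ∀ i x, ‖g i x‖ ≤ B)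
    (ho : ∀ i j, ∫ x, g i x * (starRingEnd ℂ) (g j x) ∂μ = if i = j then 1 else 0)
    {p : ℝ} (hp1 : 1 < p) (hp2 : p ≤ 2) {m s : ℕ} (ξ : Fin m → X)
    (hξ : ∀ f ∈ SigmaSet g s, ∫ y, ‖f y‖ ^ p ∂μ ≤ 4800 * Ep p (f ∘ ξ)) :
    Incoherent g s s (4800 * B) (1 / p) (dNorm ξ p) := by
  intro A A' hAA _ hA' c
  refine (incoh μ g B hB hgc hg ho hp1 hp2 A A' hAA c).trans ?_
  have h1 := hξ (fun x => ∑ i ∈ A', c i * g i x) ⟨A', c, hA', rfl⟩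
  have hp0 : 0 < p := by linarith
  have h2 : (∫ x, ‖∑ i ∈ A', c i * g i x‖ ^ p ∂μ) ^ (1 / p) ≤
      4800 * dNorm ξ p (fun x => ∑ i ∈ A', c i * g i x) := by
    rw [dNorm_eq]
    calc _ ≤ (4800 * Ep p ((fun x => ∑ i ∈ A', c i * g i x) ∘ ξ)) ^ (1 / p) :=
          Real.rpow_le_rpow (integral_nonneg fun x => by positivity) h1 (by positivity)
      _ = 4800 ^ (1 / p) * (Ep p ((fun x => ∑ i ∈ A', c i * g i x) ∘ ξ)) ^ (1 / p) :=
          Real.mul_rpow (by norm_num) (Ep_nonneg _ _)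
      _ ≤ _ := by
          apply mul_le_mul_of_nonneg_right _ (Real.rpow_nonneg (Ep_nonneg _ _) _)
          calc (4800:ℝ) ^ (1 / p) ≤ 4800 ^ (1:ℝ) :=
                Real.rpow_le_rpow_of_exponent_le (by norm_num) (by
                  rw [div_le_one hp0]; linarith)
            _ = 4800 := by simp
  calc _ ≤ B * (A.card : ℝ) ^ (1 / p) * (4800 * dNorm ξ p (fun x => ∑ i ∈ A', c i * g i x)) :=
        mul_le_mul_of_nonneg_left h2 (by positivity)
    _ = _ := by ring

end incoh
end WCGAProof
namespace WCGAProof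

section comb

lemma stage_dec (η : ℕ → ℝ) (h0 : ∀ k, 0 ≤ η k) (ha : Antitone η) {δ β b : ℝ} {k n : ℕ}
    (hb : 0 < b) (hn : Real.log b ≤ β * n)
    (h : ∀ i < n, δ < η (k + i) → η (k + i + 1) ≤ η (k + i) * (1 - β)) :
    η (k + n) ≤ δ ∨ η (k + n) ≤ η k / b := by
  by_cases hc : η (k + n) ≤ δ
  · exact Or.inl hc
  right
  push Not at hc
  have key : ∀ i ≤ n, η (k + i) ≤ η k * Real.exp (-(β * i)) := by
    intro i
    induction i with
    | zero => intro _; simp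
    | succ i ih =>
      intro hi
      have h1 := ih (by omega)
      have h2 := h i (by omega) (lt_of_lt_of_le hc (ha (by omega)))
      have h3 : 1 - β ≤ Real.exp (-β) := by
        have := Real.add_one_le_exp (-β); linarith
      calc η (k + (i + 1)) ≤ η (k + i) * (1 - β) := h2
        _ ≤ η (k + i) * Real.exp (-β) := mul_le_mul_of_nonneg_left h3 (h0 _)
        _ ≤ η k * Real.exp (-(β * i)) * Real.exp (-β) :=
            mul_le_mul_of_nonneg_right h1 (Real.exp_pos _).le
        _ = _ := by
            rw [mul_assoc, ← Real.exp_add]; push_cast; congr 2; ring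
  refine (key n le_rfl).trans ?_
  rw [div_eq_mul_inv]
  apply mul_le_mul_of_nonneg_left _ (h0 k)
  calc Real.exp (-(β * n)) ≤ Real.exp (-Real.log b) := Real.exp_le_exp.2 (by linarith)
    _ = b⁻¹ := by rw [Real.exp_neg, Real.exp_log hb]

/-- dyadic sizes 0,1,2,4,... -/
def aj : ℕ → ℕ
  | 0 => 0
  | j + 1 => 2 ^ j

lemma aj_two (j : ℕ) : 2 ^ j ≤ 2 * (aj j + 1) := by
  cases j with
  | zero => simp [aj]
  | succ j => simp [aj, pow_succ]; omega

lemma le_aj (n : ℕ) : n ≤ aj n := by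
  cases n with
  | zero => simp
  | succ n => simp only [aj]; exact Nat.lt_two_pow_self

lemma geo_sum {α : ℝ} (hα : 1 ≤ α) (j : ℕ) :
    ∑ i ∈ Finset.range (j + 1), ((2:ℝ) ^ i) ^ α ≤ 2 * ((2:ℝ) ^ j) ^ α := by
  induction j with
  | zero => simp
  | succ j ih =>
    rw [Finset.sum_range_succ]
    have : 2 * ((2:ℝ) ^ j) ^ α ≤ ((2:ℝ) ^ (j + 1)) ^ α := by
      rw [pow_succ, mul_comm ((2:ℝ) ^ j), Real.mul_rpow (by norm_num) (by positivity)]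
      exact mul_le_mul_of_nonneg_right (two_rpow_ge α hα) (by positivity)
    linarith

variable {ι : Type*}

lemma greedy_comb (η : ℕ → ℝ) (h0 : ∀ k, 0 ≤ η k) (ha : Antitone η) (Tk : ℕ → Finset ι)
    (hT : Antitone Tk) (y : ι → ℝ) (hy : ∀ i, 0 ≤ y i) (ε B : ℝ) (hε : 0 ≤ ε) (hB : 0 < B) (u v : ℕ)
    (β : ℕ → ℝ) (Λ α b W : ℝ)
    (H1 : ∀ k < u, ∀ A ⊆ Tk k, ∀ a : ℕ, 1 ≤ a → A.card ≤ a →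
      2 * (ε + B * ∑ i ∈ Tk k \ A, y i) < η k → η (k + 1) ≤ η k * (1 - β a))
    (H3 : ∀ k ≤ u, η k ≤ ε + B * ∑ i ∈ Tk k, y i)
    (H2 : ∀ k ≤ u, ∑ i ∈ Tk k, y i ≤ W * (η k + ε)) (hW : 0 ≤ W) (hb : 10 * (W * B) ≤ b) (hb1 : 1 ≤ b)
    (hβ : ∀ a : ℕ, 1 ≤ a → 0 < β a ∧ Real.log b ≤ β a * (Λ * (a:ℝ) ^ α)) (hΛ : 1 ≤ Λ) (hα : 1 ≤ α)
    (hv : (Tk 0).card ≤ v) (hu : 4 * Λ * 2 ^ α * (v:ℝ) ^ α ≤ u) : η u ≤ 8 * ε := by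
  set D := 4 * Λ * 2 ^ α * (v:ℝ) ^ (α - 1) with hD
  have hD0 : 0 ≤ D := by positivity
  have main : ∀ n k : ℕ, (Tk k).card ≤ n → n ≤ v → (k:ℝ) + D * n ≤ u →
      ∃ k' ≤ u, η k' ≤ 8 * ε := by
    intro n
    induction n using Nat.strong_induction_on with
    | _ n ihn =>
    intro k hcard hnv hbud
    have hku : k ≤ u := by
      have : (k:ℝ) ≤ u := by
        have : 0 ≤ D * n := by positivity
        linarith
      exact_mod_cast this
    set U := Tk k with hU
    have hmin : ∀ a : ℕ, ∃ A ⊆ U, A.card ≤ a ∧ ∀ A' ⊆ U, A'.card ≤ a →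
        ∑ i ∈ U \ A, y i ≤ ∑ i ∈ U \ A', y i := by
      intro a
      obtain ⟨A, hA, hAm⟩ := Finset.exists_min_image (U.powerset.filter fun A => A.card ≤ a)
        (fun A => ∑ i ∈ U \ A, y i) ⟨∅, by simp⟩
      simp only [Finset.mem_filter, Finset.mem_powerset] at hA hAm
      exact ⟨A, hA.1, hA.2, fun A' h1 h2 => hAm A' ⟨h1, h2⟩⟩
    choose Ao hAo1 hAo2 hAo3 using hmin
    set w : ℕ → ℝ := fun a => ∑ i ∈ U \ Ao a, y i with hw
    have hw0 : ∀ a, 0 ≤ w a := fun a => Finset.sum_nonneg fun i _ => hy i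
    have hwn : ∀ a, n ≤ a → w a = 0 := by
      intro a hna
      refine le_antisymm ?_ (hw0 a)
      have := hAo3 a U (Finset.Subset.refl _) (hcard.trans hna)
      simpa using this
    -- exit conditions
    have step : ∀ j : ℕ, (∃ k' ≤ u, η k' ≤ 8 * ε) ∨
        (∃ kj : ℕ, k ≤ kj ∧ kj ≤ u ∧ (kj:ℝ) ≤ k + ∑ i ∈ Finset.range j, 2 * Λ * ((2:ℝ) ^ i) ^ α ∧
          η kj ≤ 4 * (ε + B * w (aj j))) := by
      intro j
      induction j with
      | zero =>
        right
        refine ⟨k, le_rfl, hku, by simp, ?_⟩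
        have h1 := H3 k hku
        have h2 : w (aj 0) = ∑ i ∈ U, y i := by
          have : Ao 0 = ∅ := by simpa using hAo2 0
          simp [hw, aj, this]
        rw [h2]
        have : 0 ≤ B * ∑ i ∈ U, y i := mul_nonneg hB.le (Finset.sum_nonneg fun i _ => hy i)
        linarith
      | succ j ih =>
        rcases ih with ih | ⟨kj, hkj1, hkj2, hkj3, hkj4⟩
        · exact Or.inl ih
        by_cases hwz : w (aj j) = 0
        · left
          refine ⟨kj, hkj2, ?_⟩
          rw [hwz] at hkj4
          linarith
        have hwpos : 0 < w (aj j) := lt_of_le_of_ne (hw0 _) (Ne.symm hwz)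
        have hajn : aj j + 1 ≤ n := by
          by_contra hcon
          exact hwz (hwn _ (by omega))
        obtain ⟨hβ0, hβ1⟩ := hβ (2 ^ j) Nat.one_le_two_pow
        set nj := ⌈Λ * (((2 ^ j : ℕ) : ℝ)) ^ α⌉₊ with hnj
        have hX1 : 1 ≤ Λ * (((2 ^ j : ℕ) : ℝ)) ^ α := by
          apply one_le_mul_of_one_le_of_one_le hΛ
          apply Real.one_le_rpow _ (by linarith)
          exact_mod_cast Nat.one_le_two_pow
        have hnj1 : (nj:ℝ) ≤ 2 * Λ * ((2:ℝ) ^ j) ^ α := by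
          have h1 := (Nat.ceil_lt_add_one (show 0 ≤ Λ * (((2 ^ j : ℕ) : ℝ)) ^ α by linarith)).le
          have h2 : (((2 ^ j : ℕ) : ℝ)) = (2:ℝ) ^ j := by push_cast; rfl
          rw [h2] at h1 hX1
          have h3 : (nj:ℝ) ≤ Λ * ((2:ℝ) ^ j) ^ α + 1 := by rw [hnj, h2]; exact h1
          linarith
        have htime : ((kj + nj : ℕ) : ℝ) ≤ k + ∑ i ∈ Finset.range (j + 1), 2 * Λ * ((2:ℝ) ^ i) ^ α := by
          rw [Finset.sum_range_succ]; push_cast; linarith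
        have htime2 : ((kj + nj : ℕ) : ℝ) ≤ k + D * (aj j + 1 : ℕ) := by
          refine htime.trans ?_
          rw [← Finset.mul_sum]
          have h1 := geo_sum hα j
          have h2 : ((2:ℝ) ^ j) ^ α ≤ 2 ^ α * ((v:ℝ) ^ (α - 1) * (aj j + 1 : ℕ)) := by
            set d : ℝ := ((aj j + 1 : ℕ) : ℝ) with hd
            have hd1 : 1 ≤ d := by rw [hd]; push_cast; linarith [show (0:ℝ) ≤ aj j by positivity]
            have hdv : d ≤ v := by rw [hd]; exact_mod_cast hajn.trans hnv
            calc ((2:ℝ) ^ j) ^ α ≤ (2 * d) ^ α := by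
                  apply Real.rpow_le_rpow (by positivity) _ (by linarith)
                  rw [hd]; exact_mod_cast aj_two j
              _ = 2 ^ α * d ^ α := Real.mul_rpow (by norm_num) (by linarith)
              _ = 2 ^ α * (d ^ (α - 1) * d) := by
                  congr 1
                  rw [← Real.rpow_add_one (by linarith)]; congr 1; ring
              _ ≤ _ := by
                  apply mul_le_mul_of_nonneg_left _ (by positivity)
                  apply mul_le_mul_of_nonneg_right _ (by linarith)
                  exact Real.rpow_le_rpow (by linarith) hdv (by linarith)
          have h3 : 2 * Λ * ∑ i ∈ Finset.range (j + 1), ((2:ℝ) ^ i) ^ α ≤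
              2 * Λ * (2 * (2 ^ α * ((v:ℝ) ^ (α - 1) * (aj j + 1 : ℕ)))) :=
            mul_le_mul_of_nonneg_left (by linarith) (by linarith)
          have h4 : 2 * Λ * (2 * (2 ^ α * ((v:ℝ) ^ (α - 1) * (aj j + 1 : ℕ)))) =
              D * (aj j + 1 : ℕ) := by rw [hD]; ring
          linarith
        have htu : kj + nj ≤ u := by
          have h1 : D * (aj j + 1 : ℕ) ≤ D * n :=
            mul_le_mul_of_nonneg_left (by exact_mod_cast hajn) hD0
          have : ((kj + nj : ℕ) : ℝ) ≤ u := by linarith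
          exact_mod_cast this
        -- run the stage
        have hstage := stage_dec η h0 ha (δ := 2 * (ε + B * w (aj (j + 1)))) (β := β (2 ^ j)) (b := b)
          (k := kj) (n := nj) (by linarith)
          (hβ1.trans (mul_le_mul_of_nonneg_left (Nat.le_ceil _) hβ0.le)) (by
            intro i hi hlt
            have hTU : Tk (kj + i) ⊆ U := hT (by omega)
            refine H1 (kj + i) (by omega) (Tk (kj + i) ∩ Ao (aj (j + 1))) Finset.inter_subset_left (2 ^ j)
              Nat.one_le_two_pow ((Finset.card_le_card Finset.inter_subset_right).trans (hAo2 _)) ?_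
            refine lt_of_le_of_lt ?_ hlt
            have : ∑ i ∈ Tk (kj + i) \ (Tk (kj + i) ∩ Ao (aj (j + 1))), y i ≤ w (aj (j + 1)) := by
              refine Finset.sum_le_sum_of_subset_of_nonneg ?_ fun i _ _ => hy i
              intro z hz
              simp only [Finset.mem_sdiff, Finset.mem_inter, not_and] at hz ⊢
              exact ⟨hTU hz.1, hz.2 hz.1⟩
            have := mul_le_mul_of_nonneg_left this hB.le
            linarith)
        rcases hstage with hst | hst
        · right
          refine ⟨kj + nj, by omega, htu, htime, hst.trans ?_⟩
          have : 0 ≤ B * w (aj (j + 1)) := mul_nonneg hB.le (hw0 _)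
          linarith
        left
        have hbp : 0 < b := by linarith
        have h1 : η (kj + nj) * b ≤ 4 * ε + 4 * (B * w (aj j)) := by
          rw [le_div_iff₀ hbp] at hst
          linarith
        have hηn := h0 (kj + nj)
        by_cases hsm : B * w (aj j) ≤ b * ε
        · refine ⟨kj + nj, htu, ?_⟩
          have : η (kj + nj) * b ≤ 8 * ε * b := by nlinarith
          exact le_of_mul_le_mul_right this hbp
        push Not at hsm
        -- progress
        have hprog : aj j + 1 ≤ (U \ Tk (kj + nj)).card := by
          by_contra hcon
          push Not at hcon
          have h2 := hAo3 (aj j) (U \ Tk (kj + nj)) Finset.sdiff_subset (by omega)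
          have hTU : Tk (kj + nj) ⊆ U := hT (by omega)
          rw [Finset.sdiff_sdiff_eq_self hTU] at h2
          have h3 := H2 (kj + nj) htu
          have h4 : w (aj j) ≤ W * (η (kj + nj) + ε) := h2.trans h3
          have h5 : b * (η (kj + nj) + ε) ≤ 9 * (B * w (aj j)) := by nlinarith
          have h6 : b * w (aj j) ≤ W * (9 * (B * w (aj j))) := by
            calc b * w (aj j) ≤ b * (W * (η (kj + nj) + ε)) := mul_le_mul_of_nonneg_left h4 hbp.le
              _ = W * (b * (η (kj + nj) + ε)) := by ring
              _ ≤ _ := mul_le_mul_of_nonneg_left h5 hW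
          have h7 : b ≤ 9 * (W * B) := by
            have : b * w (aj j) ≤ 9 * (W * B) * w (aj j) := by linarith
            exact le_of_mul_le_mul_right this hwpos
          have h8 : 0 ≤ W * B := mul_nonneg hW hB.le
          nlinarith
        set d := aj j + 1 with hd
        have hTU : Tk (kj + nj) ⊆ U := hT (by omega)
        have hc2 : (Tk (kj + nj)).card ≤ n - d := by
          have := Finset.card_sdiff_add_card_eq_card hTU
          omega
        refine ihn (n - d) (by omega) (kj + nj) hc2 (by omega) ?_
        rw [Nat.cast_sub hajn]
        have : D * ((n:ℝ) - (d:ℕ)) = D * n - D * (d:ℕ) := by ring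
        rw [this]
        linarith
    rcases step n with h | ⟨kj, -, hk2, -, hk4⟩
    · exact h
    · refine ⟨kj, hk2, ?_⟩
      rw [hwn _ (le_aj n)] at hk4
      linarith
  have hDv : D * v = 4 * Λ * 2 ^ α * (v:ℝ) ^ α := by
    rcases Nat.eq_zero_or_pos v with h | h
    · subst h; simp [Real.zero_rpow (by linarith : α ≠ 0)]
    · have hvp : (v:ℝ) ≠ 0 := by exact_mod_cast h.ne'
      rw [hD, mul_assoc, ← Real.rpow_add_one hvp]; congr 2; ring
  obtain ⟨k', hk', hh⟩ := main v 0 hv le_rfl (by rw [hDv]; simpa using hu)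
  exact (ha hk').trans hh

end comb
end WCGAProof
namespace WCGAProof

section norm

lemma clarkson_pt {p : ℝ} (hp1 : 1 ≤ p) (hp2 : p ≤ 2) (a b : ℂ) :
    ‖a + b‖ ^ p + ‖a - b‖ ^ p ≤ 2 * (‖a‖ ^ p + ‖b‖ ^ p) := by
  have hpar : ‖a + b‖ ^ 2 + ‖a - b‖ ^ 2 = 2 * (‖a‖ ^ 2 + ‖b‖ ^ 2) := by
    have := parallelogram_law_with_norm ℝ a b
    nlinarith
  have hsq : ∀ z : ℂ, (‖z‖ ^ 2) ^ (p / 2) = ‖z‖ ^ p := by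
    intro z
    rw [← Real.rpow_two, ← Real.rpow_mul (norm_nonneg _)]; congr 1; ring
  have hconc := (Real.concaveOn_rpow (p := p / 2) (by linarith) (by linarith)).2
    (Set.mem_Ici.2 (show (0:ℝ) ≤ ‖a + b‖ ^ 2 by positivity))
    (Set.mem_Ici.2 (show (0:ℝ) ≤ ‖a - b‖ ^ 2 by positivity))
    (show (0:ℝ) ≤ 1 / 2 by norm_num) (show (0:ℝ) ≤ 1 / 2 by norm_num) (by norm_num)
  simp only [smul_eq_mul] at hconc
  have h1 : (1 / 2 : ℝ) * ‖a + b‖ ^ 2 + 1 / 2 * ‖a - b‖ ^ 2 = ‖a‖ ^ 2 + ‖b‖ ^ 2 := by linarith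
  rw [h1, hsq, hsq] at hconc
  have h2 := Real.rpow_add_le_add_rpow (p := p / 2) (sq_nonneg ‖a‖) (sq_nonneg ‖b‖) (by linarith) (by linarith)
  rw [hsq, hsq] at h2
  linarith

/-- what we need of the seminorm -/
structure SN {X : Type*} (p : ℝ) (nrm : (X → ℂ) → ℝ) : Prop where
  nn : ∀ f, 0 ≤ nrm f
  tri : ∀ f h, nrm (f + h) ≤ nrm f + nrm h
  smul : ∀ (z : ℂ) f, nrm (z • f) = ‖z‖ * nrm f
  smooth : ∀ f h, nrm (f + h) + nrm (f - h) ≤ 2 * (nrm f ^ p + nrm h ^ p) ^ (1 / p)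

lemma dNorm_SN {X : Type*} {m : ℕ} (ξ : Fin m → X) {p : ℝ} (hp1 : 1 ≤ p) (hp2 : p ≤ 2) :
    SN p (dNorm ξ p) := by
  have hp0 : 0 < p := by linarith
  have hpw : ∀ f : X → ℂ, dNorm ξ p f ^ p = Ep p (f ∘ ξ) := by
    intro f
    rw [dNorm_eq, ← Real.rpow_mul (Ep_nonneg _ _), one_div_mul_cancel hp0.ne', Real.rpow_one]
  have hnn : ∀ f : X → ℂ, 0 ≤ dNorm ξ p f := fun f => Real.rpow_nonneg (Ep_nonneg _ _) _
  refine ⟨hnn, ?_, ?_, ?_⟩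
  · intro f h
    have h1 := Real.Lp_add_le (s := Finset.univ) (fun j => ‖f (ξ j)‖) (fun j => ‖h (ξ j)‖) hp1
    simp only [← Pi.add_apply, abs_norm] at h1
    unfold dNorm
    rw [Real.mul_rpow (by positivity) (Finset.sum_nonneg fun _ _ => by positivity),
      Real.mul_rpow (by positivity) (Finset.sum_nonneg fun _ _ => by positivity),
      Real.mul_rpow (by positivity) (Finset.sum_nonneg fun _ _ => by positivity), ← mul_add]
    apply mul_le_mul_of_nonneg_left _ (by positivity)
    refine le_trans ?_ h1
    apply Real.rpow_le_rpow (Finset.sum_nonneg fun _ _ => by positivity) _ (by positivity)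
    refine Finset.sum_le_sum fun j _ => ?_
    apply Real.rpow_le_rpow (norm_nonneg _) _ hp0.le
    rw [abs_of_nonneg (by positivity)]
    exact norm_add_le _ _
  · intro z f
    have : Ep p ((z • f) ∘ ξ) = ‖z‖ ^ p * Ep p (f ∘ ξ) := by
      unfold Ep
      simp only [Function.comp, Pi.smul_apply, smul_eq_mul, norm_mul]
      simp only [Real.mul_rpow (norm_nonneg _) (norm_nonneg _), ← Finset.mul_sum]
      ring
    rw [dNorm_eq, dNorm_eq, this, Real.mul_rpow (by positivity) (Ep_nonneg _ _),
      ← Real.rpow_mul (norm_nonneg _), mul_one_div_cancel hp0.ne', Real.rpow_one]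
  · intro f h
    have hE : Ep p ((f + h) ∘ ξ) + Ep p ((f - h) ∘ ξ) ≤ 2 * (Ep p (f ∘ ξ) + Ep p (h ∘ ξ)) := by
      unfold Ep
      rw [← mul_add, ← mul_add, ← Finset.sum_add_distrib, ← Finset.sum_add_distrib, mul_left_comm]
      apply mul_le_mul_of_nonneg_left _ (by positivity)
      rw [Finset.mul_sum]
      exact Finset.sum_le_sum fun j _ => clarkson_pt hp1 hp2 _ _
    rw [← hpw, ← hpw, ← hpw, ← hpw] at hE
    have hcv := (convexOn_rpow hp1).2 (Set.mem_Ici.2 (hnn (f + h)))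
      (Set.mem_Ici.2 (hnn (f - h)))
      (show (0:ℝ) ≤ 1 / 2 by norm_num) (show (0:ℝ) ≤ 1 / 2 by norm_num) (by norm_num)
    simp only [smul_eq_mul] at hcv
    have h1 : (1 / 2 * dNorm ξ p (f + h) + 1 / 2 * dNorm ξ p (f - h)) ^ p ≤
        dNorm ξ p f ^ p + dNorm ξ p h ^ p := by linarith
    have hn2 : 0 ≤ 1 / 2 * dNorm ξ p (f + h) + 1 / 2 * dNorm ξ p (f - h) := by
      have := hnn (f + h); have := hnn (f - h); linarith
    have h2 := Real.rpow_le_rpow (by positivity) h1 (show 0 ≤ 1 / p by positivity)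
    rw [← Real.rpow_mul hn2, mul_one_div_cancel hp0.ne', Real.rpow_one] at h2
    linarith

variable {X : Type*} {p : ℝ} {nrm : (X → ℂ) → ℝ}

lemma SN.neg (hs : SN p nrm) (f : X → ℂ) : nrm (-f) = nrm f := by
  have := hs.smul (-1) f
  simpa using this

lemma SN.sub (hs : SN p nrm) (f h : X → ℂ) : nrm (f - h) ≤ nrm f + nrm h := by
  rw [sub_eq_add_neg, ← hs.neg h]; exact hs.tri _ _

lemma SN.smooth_F (hs : SN p nrm) (hp1 : 1 < p) {f : X → ℂ} (F : (X → ℂ) →ₗ[ℂ] ℂ)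
    (hF : ∀ h, ‖F h‖ ≤ nrm h) (hFf : F f = ((nrm f : ℝ) : ℂ)) (hf : 0 < nrm f) (y : X → ℂ) :
    nrm (f - y) ≤ nrm f - (F y).re + 2 * (nrm f * (nrm y / nrm f) ^ p) := by
  have h1 := hs.smooth f y
  have h2 : nrm f + (F y).re ≤ nrm (f + y) := by
    refine le_trans ?_ (hF (f + y))
    refine le_trans ?_ (Complex.re_le_norm _)
    rw [map_add, hFf]; simp
  have hy := hs.nn y
  have h3 : (nrm f ^ p + nrm y ^ p) ^ (1 / p) ≤ nrm f * (1 + (nrm y / nrm f) ^ p) := by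
    have e1 : nrm f ^ p + nrm y ^ p = nrm f ^ p * (1 + (nrm y / nrm f) ^ p) := by
      rw [Real.div_rpow hy hf.le]
      have : nrm f ^ p ≠ 0 := (Real.rpow_pos_of_pos hf p).ne'
      field_simp
    rw [e1, Real.mul_rpow (by positivity) (by positivity), ← Real.rpow_mul hf.le,
      mul_one_div_cancel (by linarith), Real.rpow_one]
    apply mul_le_mul_of_nonneg_left _ hf.le
    have h4 : 1 ≤ 1 + (nrm y / nrm f) ^ p := by
      have : 0 ≤ (nrm y / nrm f) ^ p := by positivity
      linarith
    calc _ ≤ (1 + (nrm y / nrm f) ^ p) ^ (1:ℝ) :=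
          Real.rpow_le_rpow_of_exponent_le h4 (by rw [div_le_one (by linarith)]; linarith)
      _ = _ := by simp
  linarith

/-- rotate: a unimodular number -/
lemma exists_unimod (z : ℂ) : ∃ w : ℂ, ‖w‖ = 1 ∧ w * z = (‖z‖ : ℂ) := by
  by_cases h : z = 0
  · exact ⟨1, by simp, by simp [h]⟩
  · have hz : (‖z‖ : ℂ) ≠ 0 := by exact_mod_cast norm_ne_zero_iff.2 h
    refine ⟨(starRingEnd ℂ) z / (‖z‖ : ℂ), ?_, ?_⟩
    · rw [norm_div, RCLike.norm_conj, Complex.norm_real, norm_norm, div_self (norm_ne_zero_iff.2 h)]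
    · rw [div_mul_eq_mul_div, Complex.conj_mul', sq, mul_div_assoc, div_self hz, mul_one]

lemma SN.smooth_rot (hs : SN p nrm) (hp1 : 1 < p) {f : X → ℂ} (F : (X → ℂ) →ₗ[ℂ] ℂ)
    (hF : ∀ h, ‖F h‖ ≤ nrm h) (hFf : F f = ((nrm f : ℝ) : ℂ)) (hf : 0 < nrm f) (y : X → ℂ) :
    ∃ w : ℂ, ∀ r : ℝ, 0 ≤ r →
      nrm (f - ((r * nrm f : ℝ) * w : ℂ) • y) ≤
        nrm f * (1 - r * ‖F y‖ + 2 * (r ^ p * nrm y ^ p)) := by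
  obtain ⟨w, hw1, hw2⟩ := exists_unimod (F y)
  refine ⟨w, fun r hr => ?_⟩
  have h1 := hs.smooth_F hp1 F hF hFf hf (((r * nrm f : ℝ) * w : ℂ) • y)
  have h2 : (F (((r * nrm f : ℝ) * w : ℂ) • y)).re = r * nrm f * ‖F y‖ := by
    rw [map_smul, smul_eq_mul, mul_assoc, hw2, ← Complex.ofReal_mul, Complex.ofReal_re]
  have h3 : nrm (((r * nrm f : ℝ) * w : ℂ) • y) / nrm f = r * nrm y := by
    rw [hs.smul, norm_mul, hw1, Complex.norm_real, Real.norm_eq_abs, abs_of_nonneg (by positivity)]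
    field_simp
  rw [h2, h3, Real.mul_rpow hr (hs.nn y)] at h1
  linarith

lemma SN.vanish (hs : SN p nrm) (hp1 : 1 < p) {f : X → ℂ} (F : (X → ℂ) →ₗ[ℂ] ℂ)
    (hF : ∀ h, ‖F h‖ ≤ nrm h) (hFf : F f = ((nrm f : ℝ) : ℂ)) (hf : 0 < nrm f) (y : X → ℂ)
    (hbest : ∀ z : ℂ, nrm f ≤ nrm (f - z • y)) : F y = 0 := by
  by_contra hne
  have hx : 0 < ‖F y‖ := norm_pos_iff.2 hne
  obtain ⟨w, hw⟩ := hs.smooth_rot hp1 F hF hFf hf y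
  set x := ‖F y‖ with hxd
  set C := 2 * nrm y ^ p with hC
  have hC0 : 0 ≤ C := by have := hs.nn y; positivity
  set r := (x / (C + 1)) ^ (1 / (p - 1)) with hr
  have hr0 : 0 < r := by positivity
  have hrp : r ^ (p - 1) = x / (C + 1) := by
    rw [hr, ← Real.rpow_mul (by positivity), one_div_mul_cancel (by linarith), Real.rpow_one]
  have h1 := (hbest _).trans (hw r hr0.le)
  have h2 : 1 ≤ 1 - r * x + 2 * (r ^ p * nrm y ^ p) := by
    by_contra hcon
    push Not at hcon
    nlinarith
  have h3 : r ^ p = r ^ (p - 1) * r := by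
    rw [← Real.rpow_add_one hr0.ne']; congr 1; ring
  rw [h3, hrp] at h2
  have h4 : r * x ≤ r * (C * (x / (C + 1))) := by
    have : 2 * (x / (C + 1) * r * nrm y ^ p) = r * (C * (x / (C + 1))) := by rw [hC]; ring
    linarith
  have h5 := le_of_mul_le_mul_left h4 hr0
  have h6 : C * (x / (C + 1)) < x := by
    rw [← mul_div_assoc, div_lt_iff₀ (by linarith)]
    nlinarith
  linarith

end norm
end WCGAProof

namespace WCGAProof
section wcga

variable {X ι : Type*} {p : ℝ} {nrm : (X → ℂ) → ℝ} {g : ι → X → ℂ} {t : ℝ} {f0 : X → ℂ}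
  {φ : ℕ → ι} {G : ℕ → X → ℂ}

lemma iic_eq (k : ℕ) : Set.Iic k = Set.Iio (k + 1) := by
  ext j; simp

/-- span of the first `k` selected elements -/
def Sp (g : ι → X → ℂ) (φ : ℕ → ι) (k : ℕ) : Submodule ℂ (X → ℂ) :=
  Submodule.span ℂ ((fun j => g (φ j)) '' Set.Iio k)

lemma wcga_mem (hw : IsWCGA g nrm t f0 φ G) (k : ℕ) : G k ∈ Sp g φ k := by
  cases k with
  | zero => rw [hw.1]; exact Submodule.zero_mem _
  | succ k =>
    have := (hw.2 k).2.1
    rw [iic_eq] at this; exact this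

lemma wcga_best (hw : IsWCGA g nrm t f0 φ G) (k : ℕ) : ∀ h ∈ Sp g φ k,
    nrm (f0 - G k) ≤ nrm (f0 - h) := by
  cases k with
  | zero =>
    intro h hh
    have : h = 0 := by
      simpa [Sp] using hh
    rw [this, hw.1]
  | succ k =>
    have := (hw.2 k).2.2
    rw [iic_eq] at this; exact this

lemma Sp_mono {k l : ℕ} (h : k ≤ l) : Sp g φ k ≤ Sp g φ l :=
  Submodule.span_mono (Set.image_mono (Set.Iio_subset_Iio h))

lemma Sp_mem {j k : ℕ} (h : j < k) : g (φ j) ∈ Sp g φ k :=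
  Submodule.subset_span ⟨j, h, rfl⟩

lemma wcga_anti (hw : IsWCGA g nrm t f0 φ G) : Antitone fun k => nrm (f0 - G k) := by
  intro k l hkl
  exact wcga_best hw l _ (Sp_mono hkl (wcga_mem hw k))

lemma Sp_repr {k : ℕ} {h : X → ℂ} (hh : h ∈ Sp g φ k) :
    ∃ c : ι → ℂ, h = fun x => ∑ i ∈ (Finset.range k).image φ, c i * g i x := by
  have e : ((fun j => g (φ j)) '' Set.Iio k) = g '' (((Finset.range k).image φ : Finset ι) : Set ι) := by
    ext f; simp
  unfold Sp at hh
  rw [e, Submodule.mem_span_image_finset_iff_exists_fun'] at hh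
  obtain ⟨c, hc⟩ := hh
  refine ⟨c, ?_⟩
  rw [← hc]; ext x; simp

lemma wcga_vanish (hs : SN p nrm) (hp1 : 1 < p) (hw : IsWCGA g nrm t f0 φ G) (k : ℕ)
    (F : (X → ℂ) →ₗ[ℂ] ℂ)
    (hF : ∀ h, ‖F h‖ ≤ nrm h) (hFf : F (f0 - G k) = ((nrm (f0 - G k) : ℝ) : ℂ))
    (hf : 0 < nrm (f0 - G k)) (y : X → ℂ) (hy : y ∈ Sp g φ k) : F y = 0 := by
  apply hs.vanish hp1 F hF hFf hf y
  intro z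
  rw [sub_sub]
  exact wcga_best hw k _ (Submodule.add_mem _ (wcga_mem hw k) (Submodule.smul_mem _ _ hy))

variable {B V1 : ℝ} {s u v : ℕ}

/-- the unselected part -/
def Tq (φ : ℕ → ι) (T : Finset ι) (k : ℕ) : Finset ι := T \ (Finset.range k).image φ

lemma Tq_anti (T : Finset ι) : Antitone (Tq φ T) := by
  intro k l h
  exact Finset.sdiff_subset_sdiff le_rfl (Finset.image_subset_image (Finset.range_mono h))

lemma wcga_incoh (hs : SN p nrm) (hV : 0 ≤ V1) (hinc : Incoherent g s s V1 (1 / p) nrm) (hsuv : u + v ≤ s)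
    (hw : IsWCGA g nrm t f0 φ G) (T : Finset ι) (hT : T.card ≤ v) (x : ι → ℂ)
    {k : ℕ} (hk : k ≤ u) (A : Finset ι) (hA : A ⊆ Tq φ T k) :
    ∑ i ∈ A, ‖x i‖ ≤ V1 * (A.card : ℝ) ^ (1 / p) *
      (nrm (f0 - fun y => ∑ i ∈ T, x i * g i y) + nrm (f0 - G k)) := by
  obtain ⟨c, hc⟩ := Sp_repr (wcga_mem hw k)
  set P := (Finset.range k).image φ with hP
  have hPc : P.card ≤ k := by
    refine Finset.card_image_le.trans ?_; simp
  have hTP : (T ∪ P).card ≤ s := (Finset.card_union_le _ _).trans (by omega)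
  have hAT : A ⊆ T ∪ P := fun i hi => Finset.mem_union_left _ (Finset.mem_sdiff.1 (hA hi)).1
  have h1 := hinc A (T ∪ P) hAT ((Finset.card_le_card hAT).trans hTP) hTP
    (fun i => (if i ∈ T then x i else 0) - (if i ∈ P then c i else 0))
  have e1 : ∑ i ∈ A, ‖(if i ∈ T then x i else 0) - (if i ∈ P then c i else 0)‖ = ∑ i ∈ A, ‖x i‖ := by
    refine Finset.sum_congr rfl fun i hi => ?_
    have := Finset.mem_sdiff.1 (hA hi)
    rw [if_pos this.1, if_neg this.2, sub_zero]
  have e2 : (fun y => ∑ i ∈ T ∪ P, ((if i ∈ T then x i else 0) - (if i ∈ P then c i else 0)) * g i y) =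
      (f0 - G k) - (f0 - fun y => ∑ i ∈ T, x i * g i y) := by
    have e3 : (f0 - G k) - (f0 - fun y => ∑ i ∈ T, x i * g i y) =
      (fun y => ∑ i ∈ T, x i * g i y) - G k := by abel
    rw [e3, hc]
    ext y
    simp only [Pi.sub_apply, sub_mul, Finset.sum_sub_distrib, ite_mul, zero_mul, Finset.sum_ite_mem]
    rw [Finset.inter_eq_right.2 (Finset.subset_union_left : T ⊆ T ∪ P),
      Finset.inter_eq_right.2 (Finset.subset_union_right : P ⊆ T ∪ P)]
  rw [e1, e2] at h1
  refine h1.trans ?_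
  apply mul_le_mul_of_nonneg_left _ (by positivity)
  rw [add_comm]; exact hs.sub _ _

lemma wcga_F (hs : SN p nrm) (hp1 : 1 < p)
    (hw : IsWCGA g nrm t f0 φ G) (T : Finset ι) (x : ι → ℂ)
    (k : ℕ) (F : (X → ℂ) →ₗ[ℂ] ℂ)
    (hF : ∀ h, ‖F h‖ ≤ nrm h) (hFf : F (f0 - G k) = ((nrm (f0 - G k) : ℝ) : ℂ))
    (hf : 0 < nrm (f0 - G k)) :
    nrm (f0 - G k) ≤ nrm (f0 - fun y => ∑ i ∈ T, x i * g i y) +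
      ∑ i ∈ Tq φ T k, ‖x i‖ * ‖F (g i)‖ := by
  set h : X → ℂ := fun y => ∑ i ∈ T, x i * g i y with hh
  have hG := wcga_vanish hs hp1 hw k F hF hFf hf _ (wcga_mem hw k)
  have e : h = ∑ i ∈ T, x i • g i := by ext y; simp [hh]
  have hFh : F h = ∑ i ∈ Tq φ T k, x i * F (g i) := by
    rw [e, map_sum]
    simp only [map_smul, smul_eq_mul]
    symm
    apply Finset.sum_subset Finset.sdiff_subset
    intro i hi hi2
    have : i ∈ (Finset.range k).image φ := by
      by_contra h3; exact hi2 (Finset.mem_sdiff.2 ⟨hi, h3⟩)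
    obtain ⟨j, hj, rfl⟩ := Finset.mem_image.1 this
    rw [wcga_vanish hs hp1 hw k F hF hFf hf _ (Sp_mem (Finset.mem_range.1 hj)), mul_zero]
  have h1 : ((nrm (f0 - G k) : ℝ) : ℂ) = F (f0 - h) + F h := by
    rw [← hFf, map_sub, map_sub, hG]; ring
  have h2 : nrm (f0 - G k) = ‖F (f0 - h) + F h‖ := by
    rw [← h1, Complex.norm_real, Real.norm_eq_abs, abs_of_nonneg hf.le]
  rw [h2]
  refine (norm_add_le _ _).trans (add_le_add (hF _) ?_)
  rw [hFh]
  refine (norm_sum_le _ _).trans (le_of_eq ?_)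
  simp

lemma step_num {p t B V1 a η q η' : ℝ} (hp1 : 1 < p) (ht : 0 < t) (hB : 0 < B) (hV : 0 < V1)
    (ha : 0 < a) (hη : 0 ≤ η) (hq : t * (1 / (4 * V1 * a ^ (1 / p))) ≤ q)
    (h : ∀ r : ℝ, 0 ≤ r → η' ≤ η * (1 - r * q + 2 * (r ^ p * B ^ p))) :
    η' ≤ η * (1 - (1 / 2 * (1 / 4) ^ (1 / (p - 1)) * (t / 4) ^ (p / (p - 1))) *
      ((1 / (V1 * B)) ^ (p / (p - 1)) * (1 / a) ^ (1 / (p - 1)))) := by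
  set σ := t * (1 / (4 * V1 * a ^ (1 / p))) with hσ
  have hσ0 : 0 < σ := by positivity
  set r := (σ / (4 * B ^ p)) ^ (1 / (p - 1)) with hr
  have hp10 : 0 < p - 1 := by linarith
  have hr0 : 0 < r := by positivity
  have hrp : r ^ (p - 1) = σ / (4 * B ^ p) := by
    rw [hr, ← Real.rpow_mul (by positivity), one_div_mul_cancel (by linarith), Real.rpow_one]
  have h3 : r ^ p = r ^ (p - 1) * r := by
    rw [← Real.rpow_add_one hr0.ne']; congr 1; ring
  have hBp : 0 < B ^ p := by positivity
  have h4 : 2 * (r ^ p * B ^ p) = r * σ / 2 := by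
    rw [h3, hrp]; field_simp; norm_num
  have h5 := h r hr0.le
  rw [h4] at h5
  have h6 : r * σ / 2 = (1 / 2 * (1 / 4) ^ (1 / (p - 1)) * (t / 4) ^ (p / (p - 1))) *
      ((1 / (V1 * B)) ^ (p / (p - 1)) * (1 / a) ^ (1 / (p - 1))) := by
    have e1 : p / (p - 1) = 1 / (p - 1) + 1 := by field_simp; ring
    have e2 : σ ^ (p / (p - 1)) = (t / 4) ^ (p / (p - 1)) * (1 / V1) ^ (p / (p - 1)) *
        (1 / a) ^ (1 / (p - 1)) := by
      have : σ = (t / 4) * (1 / V1) * (1 / a) ^ (1 / p) := by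
        rw [hσ, Real.div_rpow zero_le_one ha.le, Real.one_rpow]; field_simp
      rw [this, Real.mul_rpow (by positivity) (by positivity), Real.mul_rpow (by positivity) (by positivity),
        ← Real.rpow_mul (by positivity)]
      congr 2
      field_simp
    have e3 : r * σ = (1 / 4) ^ (1 / (p - 1)) * σ ^ (p / (p - 1)) * (1 / B) ^ (p / (p - 1)) := by
      have : σ / (4 * B ^ p) = (1 / 4) * σ * (1 / B) ^ p := by
        rw [Real.div_rpow zero_le_one hB.le, Real.one_rpow]; field_simp
      rw [hr, this, Real.mul_rpow (by positivity) (by positivity), Real.mul_rpow (by positivity) (by positivity),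
        ← Real.rpow_mul (by positivity), mul_one_div]
      have : σ ^ (p / (p - 1)) = σ ^ (1 / (p - 1)) * σ := by
        rw [e1, Real.rpow_add_one hσ0.ne']
      rw [this]; ring
    have e4 : (1 / (V1 * B)) ^ (p / (p - 1)) = (1 / V1) ^ (p / (p - 1)) * (1 / B) ^ (p / (p - 1)) := by
      rw [← Real.mul_rpow (by positivity) (by positivity)]; congr 1; field_simp
    rw [e3, e2, e4]; ring
  rw [← h6]
  refine h5.trans (mul_le_mul_of_nonneg_left ?_ hη)
  have := mul_le_mul_of_nonneg_left hq hr0.le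
  linarith

lemma wcga_step (hs : SN p nrm) (hp1 : 1 < p) (ht : 0 < t) (hB : 0 < B) (hV : 0 < V1)
    (hgB : ∀ i, nrm (g i) ≤ B)
    (hinc : Incoherent g s s V1 (1 / p) nrm) (hsuv : u + v ≤ s)
    (hw : IsWCGA g nrm t f0 φ G) (T : Finset ι) (hT : T.card ≤ v) (x : ι → ℂ)
    {k : ℕ} (hk : k ≤ u) (A : Finset ι) (hA : A ⊆ Tq φ T k) (a : ℕ) (ha : 1 ≤ a) (hAa : A.card ≤ a)
    (hbig : 2 * (nrm (f0 - fun y => ∑ i ∈ T, x i * g i y) + B * ∑ i ∈ Tq φ T k \ A, ‖x i‖) <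
      nrm (f0 - G k)) :
    nrm (f0 - G (k + 1)) ≤ nrm (f0 - G k) *
      (1 - (1 / 2 * (1 / 4) ^ (1 / (p - 1)) * (t / 4) ^ (p / (p - 1))) *
      ((1 / (V1 * B)) ^ (p / (p - 1)) * (1 / (a:ℝ)) ^ (1 / (p - 1)))) := by
  set ε := nrm (f0 - fun y => ∑ i ∈ T, x i * g i y) with hε
  set η := nrm (f0 - G k) with hη
  have hε0 : 0 ≤ ε := hs.nn _
  have hτ0 : 0 ≤ ∑ i ∈ Tq φ T k \ A, ‖x i‖ := Finset.sum_nonneg fun _ _ => norm_nonneg _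
  have hBτ := mul_nonneg hB.le hτ0
  have hη0 : 0 < η := by linarith
  obtain ⟨F, hF, hFf, hsel⟩ := (hw.2 k).1
  have haR : (1:ℝ) ≤ a := by exact_mod_cast ha
  have h1 := wcga_F hs hp1 hw T x k F hF hFf hη0
  set q := ‖F (g (φ k))‖ with hq
  have hsel' : ∀ i, ‖F (g i)‖ ≤ q / t := by
    intro i; rw [le_div_iff₀ ht, mul_comm]; exact hsel i
  have h2 : ∑ i ∈ Tq φ T k, ‖x i‖ * ‖F (g i)‖ ≤
      B * ∑ i ∈ Tq φ T k \ A, ‖x i‖ + (∑ i ∈ A, ‖x i‖) * (q / t) := by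
    rw [← Finset.sum_sdiff hA]
    apply add_le_add
    · rw [Finset.mul_sum]
      refine Finset.sum_le_sum fun i _ => ?_
      rw [mul_comm B]
      exact mul_le_mul_of_nonneg_left ((hF _).trans (hgB i)) (norm_nonneg _)
    · rw [Finset.sum_mul]
      exact Finset.sum_le_sum fun i _ => mul_le_mul_of_nonneg_left (hsel' i) (norm_nonneg _)
  have h3 := wcga_incoh hs hV.le hinc hsuv hw T hT x hk A hA
  have hp : 0 < p := by linarith
  have h4 : (A.card : ℝ) ^ (1 / p) ≤ (a:ℝ) ^ (1 / p) :=
    Real.rpow_le_rpow (by positivity) (by exact_mod_cast hAa) (by positivity)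
  have hap : 0 < (a:ℝ) ^ (1 / p) := by positivity
  have h5 : ∑ i ∈ A, ‖x i‖ ≤ V1 * (a:ℝ) ^ (1 / p) * (2 * η) := by
    refine h3.trans ?_
    apply mul_le_mul
    · exact mul_le_mul_of_nonneg_left h4 hV.le
    · linarith
    · linarith
    · positivity
  have hq0 : 0 ≤ q / t := by positivity
  have h6 : η / 2 ≤ V1 * (a:ℝ) ^ (1 / p) * (2 * η) * (q / t) := by
    have := mul_le_mul_of_nonneg_right h5 hq0
    linarith
  have h7 : 1 ≤ 4 * V1 * (a:ℝ) ^ (1 / p) * (q / t) := by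
    by_contra hc
    push Not at hc
    nlinarith
  have h8 : t * (1 / (4 * V1 * (a:ℝ) ^ (1 / p))) ≤ q := by
    rw [mul_one_div, div_le_iff₀ (by positivity)]
    have : 4 * V1 * (a:ℝ) ^ (1 / p) * (q / t) = (q * (4 * V1 * (a:ℝ) ^ (1 / p))) / t := by ring
    rw [this, le_div_iff₀ ht] at h7
    linarith
  obtain ⟨w, hwr⟩ := hs.smooth_rot hp1 F hF hFf hη0 (g (φ k))
  apply step_num hp1 ht hB hV (by linarith) hη0.le h8
  intro r hr
  have h9 := hwr r hr
  refine le_trans ?_ (h9.trans ?_)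
  · rw [sub_sub]
    exact wcga_best hw (k + 1) _ (Submodule.add_mem _ (Sp_mono (Nat.le_succ k) (wcga_mem hw k))
      (Submodule.smul_mem _ _ (Sp_mem (Nat.lt_succ_self k))))
  · apply mul_le_mul_of_nonneg_left _ hη0.le
    have : nrm (g (φ k)) ^ p ≤ B ^ p := Real.rpow_le_rpow (hs.nn _) (hgB _) hp.le
    have := mul_le_mul_of_nonneg_left this (show 0 ≤ r ^ p by positivity)
    linarith

end wcga
end WCGAProof

namespace WCGAProof
section final

/-- the constant kappa -/
def kap (t p : ℝ) : ℝ := 1 / 2 * (1 / 4) ^ (1 / (p - 1)) * (t / 4) ^ (p / (p - 1))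

lemma kap_pos {t p : ℝ} (ht : 0 < t) : 0 < kap t p := by unfold kap; positivity

lemma kap_le {t p : ℝ} (hp1 : 1 < p) (ht : 0 < t) (ht1 : t ≤ 1) : kap t p ≤ 1 := by
  unfold kap
  have hp : 0 < p - 1 := by linarith
  have h1 : (1 / 4 : ℝ) ^ (1 / (p - 1)) ≤ 1 :=
    Real.rpow_le_one (by norm_num) (by norm_num) (by positivity)
  have h2 : (t / 4 : ℝ) ^ (p / (p - 1)) ≤ 1 :=
    Real.rpow_le_one (by positivity) (by linarith) (div_nonneg (by linarith) hp.le)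
  have h3 : 0 ≤ (1 / 4 : ℝ) ^ (1 / (p - 1)) := by positivity
  have h4 : 0 ≤ (t / 4 : ℝ) ^ (p / (p - 1)) := by positivity
  nlinarith [mul_le_one₀ h1 h4 h2]

lemma wcga_main {X ι : Type*} {p : ℝ} {nrm : (X → ℂ) → ℝ} {g : ι → X → ℂ} {t : ℝ} {f0 : X → ℂ}
    {φ : ℕ → ι} {G : ℕ → X → ℂ} {B V1 L : ℝ} {s u v : ℕ}
    (hs : SN p nrm) (hp1 : 1 < p) (hp2 : p ≤ 2) (ht : 0 < t) (ht1 : t ≤ 1) (hB : 0 < B) (hV : 0 < V1)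
    (hL : 10 * V1 * B ≤ L) (hL3 : 3 ≤ L) (hv0 : 1 ≤ v)
    (hgB : ∀ i, nrm (g i) ≤ B)
    (hinc : Incoherent g s s V1 (1 / p) nrm) (hsuv : u + v ≤ s)
    (hw : IsWCGA g nrm t f0 φ G)
    (hu : 4 * ((kap t p)⁻¹ * L ^ (p / (p - 1)) * Real.log (L * v)) * 2 ^ (1 / (p - 1)) *
      (v:ℝ) ^ (1 / (p - 1)) ≤ u)
    (T : Finset ι) (hT : T.card ≤ v) (x : ι → ℂ) :
    nrm (f0 - G u) ≤ 8 * nrm (f0 - fun y => ∑ i ∈ T, x i * g i y) := by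
  have hvR : (1:ℝ) ≤ v := by exact_mod_cast hv0
  have hp : 0 < p := by linarith
  have hp10 : 0 < p - 1 := by linarith
  have hκ := kap_pos (p := p) ht
  have hκ1 := kap_le hp1 ht ht1
  have hα : 1 ≤ 1 / (p - 1) := by rw [le_div_iff₀ hp10]; linarith
  have hp' : 0 ≤ p / (p - 1) := by positivity
  have hLv : L ≤ L * v := le_mul_of_one_le_right (by linarith) hvR
  have hlog : 1 ≤ Real.log (L * v) := by
    rw [Real.le_log_iff_exp_le (by linarith)]
    have := Real.exp_one_lt_d9
    linarith
  have hvp : (v:ℝ) ^ (1 / p) ≤ v := by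
    calc (v:ℝ) ^ (1 / p) ≤ (v:ℝ) ^ (1:ℝ) :=
          Real.rpow_le_rpow_of_exponent_le hvR (by rw [div_le_one hp]; linarith)
      _ = v := Real.rpow_one _
  have hcardle : ∀ k, (Tq φ T k).card ≤ v := fun k => (Finset.card_le_card Finset.sdiff_subset).trans hT
  refine greedy_comb (fun k => nrm (f0 - G k)) (fun k => hs.nn _) (wcga_anti hw) (Tq φ T) (Tq_anti T)
    (fun i => ‖x i‖) (fun i => norm_nonneg _) _ B (hs.nn _) hB u v
    (fun a => kap t p * ((1 / (V1 * B)) ^ (p / (p - 1)) * (1 / (a:ℝ)) ^ (1 / (p - 1))))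
    ((kap t p)⁻¹ * L ^ (p / (p - 1)) * Real.log (L * v)) (1 / (p - 1)) (L * v) (V1 * (v:ℝ) ^ (1 / p))
    ?_ ?_ ?_ (by positivity) ?_ (by linarith) ?_ ?_ hα (hcardle 0) hu
  · intro k hk A hA a ha hAa hbig
    exact wcga_step hs hp1 ht hB hV hgB hinc hsuv hw T hT x hk.le A hA a ha hAa hbig
  · intro k _
    have hsum : 0 ≤ B * ∑ i ∈ Tq φ T k, ‖x i‖ :=
      mul_nonneg hB.le (Finset.sum_nonneg fun _ _ => norm_nonneg _)
    rcases (hs.nn (f0 - G k)).eq_or_lt with h0 | h0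
    · simp only [← h0]
      exact add_nonneg (hs.nn _) hsum
    · obtain ⟨F, hF, hFf, -⟩ := (hw.2 k).1
      refine (wcga_F hs hp1 hw T x k F hF hFf h0).trans (add_le_add le_rfl ?_)
      rw [Finset.mul_sum]
      refine Finset.sum_le_sum fun i _ => ?_
      rw [mul_comm B]
      exact mul_le_mul_of_nonneg_left ((hF _).trans (hgB i)) (norm_nonneg _)
  · intro k hk
    refine (wcga_incoh hs hV.le hinc hsuv hw T hT x hk _ le_rfl).trans ?_
    rw [add_comm (nrm (f0 - G k))]
    apply mul_le_mul_of_nonneg_right _ (add_nonneg (hs.nn _) (hs.nn _))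
    apply mul_le_mul_of_nonneg_left _ hV.le
    exact Real.rpow_le_rpow (by positivity) (by exact_mod_cast hcardle k) (by positivity)
  · calc 10 * (V1 * (v:ℝ) ^ (1 / p) * B) = (10 * V1 * B) * (v:ℝ) ^ (1 / p) := by ring
      _ ≤ L * v := mul_le_mul hL hvp (by positivity) (by linarith)
  · intro a ha
    have haR : (0:ℝ) < a := by exact_mod_cast ha
    refine ⟨by positivity, ?_⟩
    have e : kap t p * ((1 / (V1 * B)) ^ (p / (p - 1)) * (1 / (a:ℝ)) ^ (1 / (p - 1))) *
        ((kap t p)⁻¹ * L ^ (p / (p - 1)) * Real.log (L * v) * (a:ℝ) ^ (1 / (p - 1))) =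
        (1 / (V1 * B) * L) ^ (p / (p - 1)) * Real.log (L * v) := by
      rw [Real.mul_rpow (by positivity) (by linarith), Real.div_rpow zero_le_one haR.le, Real.one_rpow]
      have : (a:ℝ) ^ (1 / (p - 1)) ≠ 0 := by positivity
      field_simp
    rw [e]
    have h1 : 1 ≤ (1 / (V1 * B) * L) ^ (p / (p - 1)) := by
      apply Real.one_le_rpow _ hp'
      have : 0 < V1 * B := by positivity
      rw [one_div_mul_eq_div, le_div_iff₀ this]
      linarith
    exact le_mul_of_one_le_left (by linarith) h1
  · have h1 : 1 ≤ (kap t p)⁻¹ := (one_le_inv₀ hκ).2 hκ1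
    have h2 : 1 ≤ L ^ (p / (p - 1)) := Real.one_le_rpow (by linarith) hp'
    have h3 := one_le_mul_of_one_le_of_one_le h1 h2
    exact one_le_mul_of_one_le_of_one_le h3 hlog

lemma dNorm_le_of_bound {X : Type*} {m : ℕ} (ξ : Fin m → X) {p : ℝ} (hp : 0 < p) (f : X → ℂ) {K : ℝ}
    (hK : 0 ≤ K) (hf : ∀ x, ‖f x‖ ≤ K) : dNorm ξ p f ≤ K := by
  unfold dNorm
  have h : (m:ℝ)⁻¹ * ∑ j, ‖f (ξ j)‖ ^ p ≤ K ^ p := by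
    have h1 : ∑ j : Fin m, ‖f (ξ j)‖ ^ p ≤ m * K ^ p := by
      calc _ ≤ ∑ j : Fin m, K ^ p :=
            Finset.sum_le_sum fun j _ => Real.rpow_le_rpow (norm_nonneg _) (hf _) hp.le
        _ = _ := by simp
    rcases Nat.eq_zero_or_pos m with h0 | h0
    · subst h0; simp; positivity
    · have : (0:ℝ) < m := by exact_mod_cast h0
      rw [inv_mul_le_iff₀ this]; exact h1
  have := Real.rpow_le_rpow (mul_nonneg (by positivity) (Finset.sum_nonneg fun _ _ => by positivity)) h
    (show 0 ≤ 1 / p by positivity)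
  rwa [← Real.rpow_mul hK, mul_one_div_cancel hp.ne', Real.rpow_one] at this

lemma le_sigmaErr {X ι : Type*} {nrm : (X → ℂ) → ℝ} {g : ι → X → ℂ} {v : ℕ} {f : X → ℂ} {C z : ℝ}
    (hC : 0 < C) (h : ∀ h ∈ SigmaSet g v, z ≤ C * nrm (f - h)) : z ≤ C * sigmaErr nrm g v f := by
  rw [← div_le_iff₀' hC]
  unfold sigmaErr
  apply le_csInf
  · refine Set.Nonempty.image _ ⟨0, ∅, 0, by simp, ?_⟩
    ext x; simp
  · rintro _ ⟨h', hh, rfl⟩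
    rw [div_le_iff₀' hC]; exact h _ hh

lemma lp_transfer {X : Type*} [TopologicalSpace X] [CompactSpace X] [T2Space X] [MeasurableSpace X]
    [BorelSpace X] (μ : Measure X) [IsProbabilityMeasure μ] {p : ℝ} (hp1 : 1 < p) (hp2 : p ≤ 2)
    {m : ℕ} (ξ : Fin m → X) {f h k : X → ℂ} (hf : Continuous f) (hh : Continuous h) (hk : Continuous k)
    (hd : ∫ y, ‖(h - k) y‖ ^ p ∂μ ≤ 4800 * Ep p ((h - k) ∘ ξ))
    (h8 : dNorm ξ p (f - k) ≤ 8 * dNorm ξ p (f - h)) :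
    lpNorm μ p (f - k) ≤ 1000000 * supNorm (f - h) := by
  have hp : 0 < p := by linarith
  have hfh : Continuous (f - h) := hf.sub hh
  have hbdd : BddAbove (Set.range fun x => ‖(f - h) x‖) :=
    (isCompact_range (hfh.norm)).bddAbove
  have hle : ∀ x, ‖(f - h) x‖ ≤ supNorm (f - h) := fun x => le_ciSup hbdd x
  set K := supNorm (f - h) with hKd
  have hK : 0 ≤ K := Real.iSup_nonneg fun _ => norm_nonneg _
  have hs := dNorm_SN ξ hp1.le hp2
  have h1 : dNorm ξ p (f - h) ≤ K := dNorm_le_of_bound ξ hp _ hK hle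
  have h2 : dNorm ξ p (h - k) ≤ 9 * K := by
    have e : h - k = (f - k) - (f - h) := by abel
    rw [e]; have := hs.sub (f - k) (f - h); linarith
  have h3 : Ep p ((h - k) ∘ ξ) ≤ (9 * K) ^ p := by
    have := Real.rpow_le_rpow (hs.nn _) h2 hp.le
    rwa [dNorm_eq, ← Real.rpow_mul (Ep_nonneg _ _), one_div_mul_cancel hp.ne', Real.rpow_one] at this
  have hi : ∀ {F : X → ℂ}, Continuous F → Integrable (fun y => ‖F y‖ ^ p) μ := by
    intro F hF
    exact (hF.norm.rpow_const fun _ => Or.inr hp.le).integrable_of_hasCompactSupport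
      (HasCompactSupport.of_compactSpace _)
  have h4 : ∫ y, ‖(f - k) y‖ ^ p ∂μ ≤ ∫ y, 2 * (‖(f - h) y‖ ^ p + ‖(h - k) y‖ ^ p) ∂μ := by
    apply integral_mono (hi (hf.sub hk)) (((hi hfh).add (hi (hh.sub hk))).const_mul 2)
    intro y
    have e : (f - k) y = (f - h) y + (h - k) y := by simp
    simp only [e]
    exact norm_add_rpow_le hp1.le hp2 _ _
  have h5 : ∫ y, ‖(f - h) y‖ ^ p ∂μ ≤ K ^ p := by
    calc _ ≤ ∫ y, K ^ p ∂μ := integral_mono (hi hfh) (integrable_const _) fun y =>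
          Real.rpow_le_rpow (norm_nonneg _) (hle y) hp.le
      _ = K ^ p := by simp
  rw [integral_const_mul, integral_add (hi hfh) (hi (hh.sub hk))] at h4
  have h6 : (9 * K) ^ p = 9 ^ p * K ^ p := Real.mul_rpow (by norm_num) hK
  have h9 : (9:ℝ) ^ p ≤ 81 := by
    calc (9:ℝ) ^ p ≤ 9 ^ (2:ℝ) := Real.rpow_le_rpow_of_exponent_le (by norm_num) hp2
      _ = 81 := by norm_num
  have hKp : 0 ≤ K ^ p := by positivity
  have h7 : ∫ y, ‖(f - k) y‖ ^ p ∂μ ≤ 1000000 * K ^ p := by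
    have : (9:ℝ) ^ p * K ^ p ≤ 81 * K ^ p := mul_le_mul_of_nonneg_right h9 hKp
    linarith
  have hM : (1000000:ℝ) ≤ 1000000 ^ p := by
    calc (1000000:ℝ) = 1000000 ^ (1:ℝ) := (Real.rpow_one _).symm
      _ ≤ _ := Real.rpow_le_rpow_of_exponent_le (by norm_num) hp1.le
  have h10 : ∫ y, ‖(f - k) y‖ ^ p ∂μ ≤ (1000000 * K) ^ p := by
    rw [Real.mul_rpow (by norm_num) hK]
    exact h7.trans (mul_le_mul_of_nonneg_right hM hKp)
  unfold SamplingRecovery.lpNorm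
  have := Real.rpow_le_rpow (integral_nonneg fun y => by positivity) h10 (show 0 ≤ 1 / p by positivity)
  rwa [← Real.rpow_mul (by positivity), mul_one_div_cancel hp.ne', Real.rpow_one] at this

lemma Sp_sigma {X ι : Type*} {g : ι → X → ℂ} {φ : ℕ → ι} {k : ℕ} {h : X → ℂ} (hh : h ∈ Sp g φ k) :
    h ∈ SigmaSet g k := by
  obtain ⟨c, hc⟩ := Sp_repr hh
  exact ⟨_, c, Finset.card_image_le.trans (by simp), hc⟩

end final
end WCGAProof

/-- sampling recovery by the WCGA for uniformly bounded orthonormal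
systems, `1 < p ≤ 2`.  There are constants `C0 ≥ 1` (absolute), `V = V(B) > 0`,
`c = c(t,p) ≥ 1` and `Cc = C(p,B)` such that whenever
`u := ⌈(1 + c(2V)^{p'} ln(2Vv)) v^{1/(p-1)}⌉ ≤ N`, there exist
`m ≤ Cc u log N (log 2u)² (log 2u + log log N)` points `ξ` for which every realization
of the WCGA in `L_p(Ω_m,μ_m)` satisfies the stated Lebesgue-type inequalities. -/
theorem wcga_orthonormal_recovery :
    ∃ C0 : ℝ, 1 ≤ C0 ∧
    ∃ V : ℝ → ℝ, (∀ B, 0 < B → 0 < V B) ∧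
    ∃ c : ℝ → ℝ → ℝ, (∀ t p, 1 ≤ c t p) ∧
    ∃ Cc : ℝ → ℝ → ℝ,
    ∀ B : ℝ, 0 < B →
    ∀ p t : ℝ, 1 < p → p ≤ 2 → 0 < t → t ≤ 1 →
    ∀ (d : ℕ) (Ω : Set (Fin d → ℝ)), IsCompact Ω →
    ∀ μ : Measure Ω, IsProbabilityMeasure μ →
    ∀ (N : ℕ) (g : Fin N → Ω → ℂ), (∀ i, Continuous (g i)) →
      (∀ i x, ‖g i x‖ ≤ B) →
      (∀ i j, ∫ x, g i x * (starRingEnd ℂ) (g j x) ∂μ = if i = j then 1 else 0) →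
    ∀ v : ℕ, 0 < v → uONS (c t p) (V B) p v ≤ N →
    ∃ (m : ℕ) (ξ : Fin m → Ω),
      (m : ℝ) ≤ Cc p B * (uONS (c t p) (V B) p v : ℝ) * Real.log N *
          (Real.log (2 * (uONS (c t p) (V B) p v : ℝ))) ^ 2 *
          (Real.log (2 * (uONS (c t p) (V B) p v : ℝ)) + Real.log (Real.log N)) ∧
      ∀ f0 : Ω → ℂ, Continuous f0 →
      ∀ (φ : ℕ → Fin N) (G : ℕ → Ω → ℂ),
        IsWCGA g (dNorm ξ p) t f0 φ G →
        dNorm ξ p (f0 - G (uONS (c t p) (V B) p v)) ≤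
          C0 * sigmaErr (dNorm ξ p) g v f0 ∧
        lpNorm μ p (f0 - G (uONS (c t p) (V B) p v)) ≤
          C0 * sigmaErr supNorm g v f0 := by
  refine ⟨1000000, by norm_num, fun B => 24000 * (max B 1) ^ 2, fun B _ => by positivity,
    fun t p => max 1 (4 * 2 ^ (1 / (p - 1)) * (WCGAProof.kap t p)⁻¹), fun t p => le_max_left _ _,
    fun _ B => WCGAProof.Cpt B, ?_⟩
  intro B hB0 p t hp1 hp2 ht ht1 d Ω hΩ μ hμ N g hgc hg ho v hv huN
  set u := uONS (max 1 (4 * 2 ^ (1 / (p - 1)) * (WCGAProof.kap t p)⁻¹)) (24000 * (max B 1) ^ 2) p v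
    with hu
  have : CompactSpace Ω := isCompact_iff_compactSpace.1 hΩ
  have hvR : (1:ℝ) ≤ v := by exact_mod_cast hv
  have hp10 : 0 < p - 1 := by linarith
  have hα : 1 ≤ 1 / (p - 1) := by rw [le_div_iff₀ hp10]; linarith
  have hp' : 0 ≤ p / (p - 1) := div_nonneg (by linarith) hp10.le
  have hb1 : (1:ℝ) ≤ max B 1 := le_max_right _ _
  have hL3 : (3:ℝ) ≤ 2 * (24000 * (max B 1) ^ 2) := by nlinarith
  set L := 2 * (24000 * (max B 1) ^ 2) with hLd
  set c := max 1 (4 * 2 ^ (1 / (p - 1)) * (WCGAProof.kap t p)⁻¹) with hc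
  have hc1 : 1 ≤ c := le_max_left _ _
  have hc2 : 4 * 2 ^ (1 / (p - 1)) * (WCGAProof.kap t p)⁻¹ ≤ c := le_max_right _ _
  have hLv : L ≤ L * v := le_mul_of_one_le_right (by linarith) hvR
  have hlog : 1 ≤ Real.log (L * v) := by
    rw [Real.le_log_iff_exp_le (by linarith)]
    have := Real.exp_one_lt_d9
    linarith
  have hLp : 1 ≤ L ^ (p / (p - 1)) := Real.one_le_rpow (by linarith) hp'
  have hLl : 1 ≤ L ^ (p / (p - 1)) * Real.log (L * v) := one_le_mul_of_one_le_of_one_le hLp hlog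
  have hva : (v:ℝ) ≤ (v:ℝ) ^ (1 / (p - 1)) := by
    calc (v:ℝ) = (v:ℝ) ^ (1:ℝ) := (Real.rpow_one _).symm
      _ ≤ _ := Real.rpow_le_rpow_of_exponent_le hvR hα
  have huR : (1 + c * L ^ (p / (p - 1)) * Real.log (L * v)) * (v:ℝ) ^ (1 / (p - 1)) ≤ u :=
    Nat.le_ceil _
  have hvu2 : 2 * (v:ℝ) ≤ u := by
    refine le_trans ?_ huR
    apply mul_le_mul _ hva (by positivity) _
    · have : 1 ≤ c * (L ^ (p / (p - 1)) * Real.log (L * v)) := one_le_mul_of_one_le_of_one_le hc1 hLl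
      linarith
    · have : 1 ≤ c * (L ^ (p / (p - 1)) * Real.log (L * v)) := one_le_mul_of_one_le_of_one_le hc1 hLl
      linarith
  have hvu : 2 * v ≤ u := by exact_mod_cast hvu2
  have hN : 0 < N := by omega
  have hB : 1 ≤ B := by
    have h1 := ho ⟨0, hN⟩ ⟨0, hN⟩
    rw [if_pos rfl] at h1
    have h2 : ‖∫ x, g ⟨0, hN⟩ x * (starRingEnd ℂ) (g ⟨0, hN⟩ x) ∂μ‖ ≤ (B * B) * μ.real Set.univ := by
      apply norm_integral_le_of_norm_le_const
      refine Filter.Eventually.of_forall fun x => ?_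
      rw [norm_mul, RCLike.norm_conj]
      exact mul_le_mul (hg _ _) (hg _ _) (norm_nonneg _) hB0.le
    rw [h1] at h2
    simp at h2
    nlinarith
  have hmax : max B 1 = B := max_eq_left hB
  obtain ⟨Q, M, Lq, m, hQ, hQB, hM, hMn, hLq, hm, hmb⟩ :=
    WCGAProof.disc_num B hB (N := N) u (u + v) (by omega) huN (by omega) (by omega)
  obtain ⟨ξ, hξ⟩ := WCGAProof.disc_combine μ g B hB hgc hg ho (by omega) hN hp1.le hp2 Q M Lq m hQ hQB hM
    hMn hLq hm
  refine ⟨m, ξ, hmb, ?_⟩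
  intro f0 hf0 φ G hw
  have hinc := WCGAProof.incoh_d μ g B hB hgc hg ho hp1 hp2 ξ hξ
  have hs := WCGAProof.dNorm_SN ξ hp1.le hp2
  have hbud : 4 * ((WCGAProof.kap t p)⁻¹ * L ^ (p / (p - 1)) * Real.log (L * v)) * 2 ^ (1 / (p - 1)) *
      (v:ℝ) ^ (1 / (p - 1)) ≤ u := by
    refine le_trans ?_ huR
    apply mul_le_mul_of_nonneg_right _ (by positivity)
    have := mul_le_mul_of_nonneg_right hc2 (show 0 ≤ L ^ (p / (p - 1)) * Real.log (L * v) by linarith)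
    linarith
  have main : ∀ h ∈ SigmaSet g v, dNorm ξ p (f0 - G u) ≤ 8 * dNorm ξ p (f0 - h) := by
    rintro h ⟨T, x, hT, rfl⟩
    refine WCGAProof.wcga_main (V1 := 4800 * B) (L := L) (s := u + v) hs hp1 hp2 ht ht1 hB0 (by positivity)
      ?_ hL3 hv ?_ hinc le_rfl hw hbud T hT x
    · rw [hLd, hmax]; nlinarith
    · intro i
      exact WCGAProof.dNorm_le_of_bound ξ (by linarith) _ hB0.le (hg i)
  constructor
  · apply WCGAProof.le_sigmaErr (by norm_num)
    intro h hh
    have := hs.nn (f0 - h)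
    have := main h hh
    linarith
  · apply WCGAProof.le_sigmaErr (by norm_num)
    intro h hh
    have hGs : G u ∈ SigmaSet g u := WCGAProof.Sp_sigma (WCGAProof.wcga_mem hw u)
    have hGc : Continuous (G u) := by
      obtain ⟨T, x, -, hx⟩ := hGs
      rw [hx]
      exact continuous_finsetSum _ fun i _ => continuous_const.mul (hgc i)
    have hhc : Continuous h := by
      obtain ⟨T, x, -, rfl⟩ := hh
      exact continuous_finsetSum _ fun i _ => continuous_const.mul (hgc i)
    have hd : h - G u ∈ SigmaSet g (u + v) := by
      rw [add_comm]; exact WCGAProof.sigma_sub g hh hGs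
    exact WCGAProof.lp_transfer μ hp1 hp2 ξ hf0 hhc hGc (hξ _ hd) (main h hh)
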